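/- Let $(p_1, p_2; p)$ satisfy $1/p = 1/p_1 + 1/p_2$, $p_1, p_2 \ge 1$, and let $w_j \in A_{p_j}^{\mathcal{R}}$ $(j=1,2)$. Then the bilinear operator $H_2(f_1,f_2) = (Hf_1)(Hf_2)$, the product of Hilbert transforms, is bounded from $L^{p_1,1}(w_1) \times L^{p_2,1}(w_2)$ to $L^{p,\infty}(w_1^{p/p_1} w_2^{p/p_2})$. -/

import Mathlib

open MeasureTheory ENNReal Set Filter

noncomputable section

/-- The measure with density `w` with respect to the ambient volume. -/
def wMeasure {α : Type*} [MeasureSpace α] (w : α → ℝ) : Measure α :=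
  (volume : Measure α).withDensity fun x => ENNReal.ofReal (w x)

/-- The weak Lorentz `L^{q,∞}(μ)` quasi-norm. -/
def wLorentz {α E : Type*} [MeasurableSpace α] [Norm E] (q : ℝ) (μ : Measure α)
    (g : α → E) : ℝ≥0∞ :=
  ⨆ (t : ℝ) (_ : 0 < t), ENNReal.ofReal t * μ {x | t < ‖g x‖} ^ (1 / q)

/-- The weak Lorentz `L^{q,∞}(μ)` quasi-norm, for `ℝ≥0∞`-valued functions. -/
def wLorentzE {α : Type*} [MeasurableSpace α] (q : ℝ) (μ : Measure α)
    (g : α → ℝ≥0∞) : ℝ≥0∞ :=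
  ⨆ (t : ℝ) (_ : 0 < t), ENNReal.ofReal t * μ {x | ENNReal.ofReal t < g x} ^ (1 / q)

/-- The Lorentz `L^{p,r}(μ)` quasi-norm (computed via the distribution function). -/
def lorentz {α E : Type*} [MeasurableSpace α] [Norm E] (p r : ℝ) (μ : Measure α)
    (g : α → E) : ℝ≥0∞ :=
  (∫⁻ t in Set.Ioi (0 : ℝ), ENNReal.ofReal (t ^ (r - 1)) * μ {x | t < ‖g x‖} ^ (r / p)) ^ (1 / r)

/-- A weight: a locally integrable, a.e. positive function. -/
def IsWeight {α : Type*} [MeasureSpace α] [TopologicalSpace α] (w : α → ℝ) : Prop :=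
  LocallyIntegrable w volume ∧ ∀ᵐ x : α ∂volume, 0 < w x


/-- The Hardy–Littlewood maximal operator over intervals on `ℝ`. -/
def maxOpR (f : ℝ → ℝ) (x : ℝ) : ℝ≥0∞ :=
  ⨆ (a : ℝ) (b : ℝ) (_ : a < b) (_ : x ∈ Set.Icc a b),
    (∫⁻ y in Set.Icc a b, ENNReal.ofReal |f y|) / volume (Set.Icc a b)

/-- The `A₁` constant on `ℝ`. -/
def A1ConstR (u : ℝ → ℝ) : ℝ≥0∞ :=
  sInf {C : ℝ≥0∞ | ∀ᵐ x : ℝ, maxOpR u x ≤ C * ENNReal.ofReal (u x)}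

def MemA1R (u : ℝ → ℝ) : Prop := IsWeight u ∧ A1ConstR u < ⊤

/-- The restricted `A_q^𝓡` constant on `ℝ`. -/
def AqRConstR (q : ℝ) (w : ℝ → ℝ) : ℝ≥0∞ :=
  ⨆ (a : ℝ) (b : ℝ) (_ : a < b) (E : Set ℝ) (_ : MeasurableSet E)
    (_ : E ⊆ Set.Icc a b) (_ : 0 < volume E),
    volume E / volume (Set.Icc a b) * (wMeasure w (Set.Icc a b) / wMeasure w E) ^ (1 / q)

/-- The Hilbert transform (principal value) of a complex-valued function. -/
def hilbertC (f : ℝ → ℂ) (x : ℝ) : ℂ :=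
  limUnder (nhdsWithin 0 (Set.Ioi (0 : ℝ)))
    fun ε : ℝ => ∫ t in {t : ℝ | ε < |x - t|}, f t / ((x : ℂ) - (t : ℂ))

/-- The Hilbert transform (principal value) of a real-valued function. -/
def hilbertR (f : ℝ → ℝ) (x : ℝ) : ℝ :=
  limUnder (nhdsWithin 0 (Set.Ioi (0 : ℝ)))
    fun ε : ℝ => ∫ t in {t : ℝ | ε < |x - t|}, f t / (x - t)

/-- `e(θ) = exp(iθ)`. -/
def eTerm (θ : ℝ) : ℂ := Complex.exp (Complex.I * θ)

/-- The Fourier transform `f̂(ξ) = ∫ f(x) e^{-2πixξ} dx`. -/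
def FT (f : ℝ → ℂ) (ξ : ℝ) : ℂ := ∫ x : ℝ, eTerm (-(2 * Real.pi * x * ξ)) * f x

/-- `H_r h(x) = ½[h(x) + i e^{2πixr} H(e^{-2πir·}h)(x)]`, the Fourier multiplier with
symbol `χ_{(r,∞)}`. -/
def Hmod (r : ℝ) (f : ℝ → ℂ) (x : ℝ) : ℂ :=
  (1 / 2) * (f x + Complex.I * eTerm (2 * Real.pi * x * r) *
    hilbertC (fun y => eTerm (-(2 * Real.pi * y * r)) * f y) x)

/-- The bounded-variation-type symbol `m(ξ,η) = ∫_{-∞}^ξ∫_{-∞}^η dμ(t,s)`. -/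
def mSymb (μ : Measure (ℝ × ℝ)) (ξ η : ℝ) : ℝ := (μ (Set.Iio ξ ×ˢ Set.Iio η)).toReal

/-- The bilinear Fourier multiplier
`B_m(f,g)(x) = ∫∫ m(ξ,η) f̂(ξ) ĝ(η) e^{2πix(ξ+η)} dξ dη`. -/
def Bm (μ : Measure (ℝ × ℝ)) (f g : ℝ → ℂ) (x : ℝ) : ℂ :=
  ∫ p : ℝ × ℝ, (mSymb μ p.1 p.2 : ℂ) * FT f p.1 * FT g p.2 *
    eTerm (2 * Real.pi * x * (p.1 + p.2))

namespace HilbertProduct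

/-- Weak-type bound for the centred maximal function of a finite measure on the line. -/
theorem volume_maximal_le (μ : Measure ℝ) [IsFiniteMeasure μ] {l : ℝ} (hl : 0 < l) :
    volume {x : ℝ | ∃ r > 0, ENNReal.ofReal (l * r) < μ (Metric.closedBall x r)} ≤
      ENNReal.ofReal (10 / l) * μ univ := by
  set A := {x : ℝ | ∃ r > 0, ENNReal.ofReal (l * r) < μ (Metric.closedBall x r)} with hA
  choose! r hr0 hr using fun x (hx : x ∈ A) => hx
  have hrR : ∀ a ∈ A, r a ≤ (μ univ).toReal / l := by
    intro a ha
    have h1 : ENNReal.ofReal (l * r a) ≤ μ univ := (hr a ha).le.trans (measure_mono (subset_univ _))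
    have h2 := (ENNReal.ofReal_le_iff_le_toReal (measure_ne_top _ _)).1 h1
    rw [le_div_iff₀ hl]; linarith
  obtain ⟨u, huA, hdisj, hcov⟩ :=
    Vitali.exists_disjoint_subfamily_covering_enlargement_closedBall A id r _ hrR 5 (by norm_num)
  have hcount : u.Countable := hdisj.countable_of_nonempty_interior fun a ha =>
    (Metric.nonempty_ball.2 (hr0 a (huA ha))).mono Metric.ball_subset_interior_closedBall
  have hsub : A ⊆ ⋃ b ∈ u, Metric.closedBall b (5 * r b) := by
    intro a ha
    obtain ⟨b, hb, h⟩ := hcov a ha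
    exact mem_biUnion hb (h (Metric.mem_closedBall_self (hr0 a ha).le))
  have := hcount.to_subtype
  calc volume A ≤ ∑' b : u, volume (Metric.closedBall (b : ℝ) (5 * r b)) :=
        (measure_mono hsub).trans (measure_biUnion_le _ hcount _)
    _ ≤ ∑' b : u, ENNReal.ofReal (10 / l) * μ (Metric.closedBall (b : ℝ) (r b)) := by
        refine ENNReal.tsum_le_tsum fun b => ?_
        rw [Real.volume_closedBall]
        calc ENNReal.ofReal (2 * (5 * r b)) = ENNReal.ofReal (10 / l) * ENNReal.ofReal (l * r b) := by
              rw [← ENNReal.ofReal_mul (by positivity)]; congr 1; field_simp; ring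
          _ ≤ _ := by gcongr; exact (hr b (huA b.2)).le
    _ = ENNReal.ofReal (10 / l) * μ (⋃ b ∈ u, Metric.closedBall b (r b)) := by
        rw [ENNReal.tsum_mul_left, measure_biUnion (f := fun b => Metric.closedBall b (r b)) hcount hdisj
          (fun b _ => Metric.isClosed_closedBall.measurableSet)]
    _ ≤ _ := by gcongr; exact subset_univ _

/-- A maximal-function bound at `x` controls Poisson-type tails at `x`. -/
theorem lintegral_tail_le (μ : Measure ℝ) {x r A : ℝ} (hr : 0 < r) (hA : 0 ≤ A)
    (h : ∀ s > 0, μ (Metric.closedBall x s) ≤ ENNReal.ofReal (A * s)) :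
    ∫⁻ t in {t | r < |x - t|}, ENNReal.ofReal (r / |x - t| ^ 2) ∂μ ≤ ENNReal.ofReal (4 * A) := by
  set S : ℕ → Set ℝ := fun k => {t | 2 ^ k * r ≤ |x - t| ∧ |x - t| < 2 ^ (k + 1) * r}
  have hcov : {t | r < |x - t|} ⊆ ⋃ k, S k := by
    intro t ht
    have ht' : r < |x - t| := ht
    obtain ⟨k, hk1, hk2⟩ := exists_nat_pow_near (x := |x - t| / r) (y := 2)
      ((one_le_div hr).2 ht'.le) (by norm_num)
    refine mem_iUnion.2 ⟨k, ?_, ?_⟩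
    · exact (le_div_iff₀ hr).1 hk1
    · exact (div_lt_iff₀ hr).1 hk2
  calc ∫⁻ t in {t | r < |x - t|}, ENNReal.ofReal (r / |x - t| ^ 2) ∂μ
      ≤ ∑' k, ∫⁻ t in S k, ENNReal.ofReal (r / |x - t| ^ 2) ∂μ :=
        (lintegral_mono_set hcov).trans (lintegral_iUnion_le _ _)
    _ ≤ ∑' k : ℕ, ENNReal.ofReal (2 * A) * ENNReal.ofReal (1 / 2) ^ k := by
        refine ENNReal.tsum_le_tsum fun k => ?_
        have hm : MeasurableSet (S k) := by
          have hf : Measurable fun t : ℝ => |x - t| := by fun_prop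
          exact (measurableSet_le measurable_const hf).inter
            (measurableSet_lt hf measurable_const)
        calc ∫⁻ t in S k, ENNReal.ofReal (r / |x - t| ^ 2) ∂μ
            ≤ ∫⁻ t in S k, ENNReal.ofReal (r / (2 ^ k * r) ^ 2) ∂μ := by
              refine setLIntegral_mono' hm fun t ht => ?_
              have := ht.1
              gcongr
          _ = ENNReal.ofReal (r / (2 ^ k * r) ^ 2) * μ (S k) := setLIntegral_const _ _
          _ ≤ ENNReal.ofReal (r / (2 ^ k * r) ^ 2) * ENNReal.ofReal (A * (2 ^ (k + 1) * r)) := by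
              gcongr
              refine (measure_mono ?_).trans (h _ (by positivity))
              intro t ht
              rw [Metric.mem_closedBall, dist_comm, Real.dist_eq]
              exact ht.2.le
          _ = _ := by
              rw [← ENNReal.ofReal_mul (by positivity), ← ENNReal.ofReal_pow (by norm_num),
                ← ENNReal.ofReal_mul (by positivity)]
              congr 1
              field_simp
              rw [one_div, inv_pow]; field_simp; ring
    _ = ENNReal.ofReal (4 * A) := by
        rw [ENNReal.tsum_mul_left, ENNReal.tsum_geometric]
        rw [show (1 : ℝ≥0∞) = ENNReal.ofReal 1 by simp, ← ENNReal.ofReal_sub _ (by norm_num),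
          ← ENNReal.ofReal_inv_of_pos (by norm_num), ← ENNReal.ofReal_mul (by positivity)]
        congr 1; ring

/-- The Hilbert transform of a finite sum of point masses. -/
def atomicHilbert (s : Finset ℝ) (c : ℝ → ℝ) (x : ℝ) : ℝ := ∑ a ∈ s, c a / (x - a)

/-- The open interval between the point `a` and the next point of `s` on its right. -/
def rightGap (s : Finset ℝ) (a : ℝ) : Set ℝ := {x | a < x ∧ ∀ b ∈ s, a < b → x < b}

theorem strictAntiOn_atomicHilbert {s : Finset ℝ} {c : ℝ → ℝ} (hc : ∀ a ∈ s, 0 < c a)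
    {a : ℝ} (ha : a ∈ s) : StrictAntiOn (atomicHilbert s c) (rightGap s a) := by
  intro x hx y hy hxy
  refine Finset.sum_lt_sum_of_nonempty ⟨a, ha⟩ fun b hb => ?_
  have hcb := hc b hb
  rcases le_or_gt b a with h | h
  · have h1 : 0 < x - b := by linarith [hx.1]
    exact div_lt_div_of_pos_left hcb h1 (by linarith)
  · have h2 : y - b < 0 := by linarith [hy.2 b hb h]
    have h1 : x - b < 0 := by linarith
    rw [← neg_div_neg_eq (c b) (x - b), ← neg_div_neg_eq (c b) (y - b), neg_div, neg_div, neg_lt_neg_iff]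
    exact div_lt_div_of_pos_left hcb (by linarith) (by linarith)

theorem notMem_of_mem_rightGap {s : Finset ℝ} {a x : ℝ} (hx : x ∈ rightGap s a) : x ∉ s :=
  fun h => lt_irrefl _ (hx.2 x h hx.1)

theorem ordConnected_rightGap (s : Finset ℝ) (a : ℝ) : OrdConnected (rightGap s a) :=
  ⟨fun _ hx _ hy _ hz => ⟨hx.1.trans_le hz.1, fun b hb hab => hz.2.trans_lt (hy.2 b hb hab)⟩⟩

theorem exists_atomicHilbert_eq {s : Finset ℝ} {c : ℝ → ℝ} (hc : ∀ a ∈ s, 0 < c a)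
    {a : ℝ} (ha : a ∈ s) {l : ℝ} (hl : 0 < l) : ∃ x ∈ rightGap s a, atomicHilbert s c x = l := by
  have hcont : ContinuousOn (atomicHilbert s c) (rightGap s a) := by
    refine continuousOn_finsetSum _ fun b hb => ?_
    refine continuousOn_const.div (by fun_prop) fun x hx h => ?_
    exact notMem_of_mem_rightGap hx (by rwa [sub_eq_zero.1 h])
  have hpre : IsPreconnected (rightGap s a) := (ordConnected_rightGap s a).isPreconnected
  have hrest : ∀ b ∈ s, Tendsto (fun x => ∑ d ∈ s.erase b, c d / (x - d)) (nhds b)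
      (nhds (∑ d ∈ s.erase b, c d / (b - d))) := by
    intro b hb
    refine tendsto_finsetSum _ fun d hd => ?_
    refine tendsto_const_nhds.div (tendsto_id.sub_const d) ?_
    exact sub_ne_zero.2 (Finset.ne_of_mem_erase hd).symm
  have hsplit : ∀ b ∈ s, atomicHilbert s c = fun x =>
      c b * (x - b)⁻¹ + ∑ d ∈ s.erase b, c d / (x - d) := by
    intro b hb
    funext x
    rw [← div_eq_mul_inv, Finset.add_sum_erase s (fun d => c d / (x - d)) hb]; rfl
  have hleft : Tendsto (atomicHilbert s c) (nhdsWithin a (Ioi a)) atTop := by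
    rw [hsplit a ha]
    refine Tendsto.atTop_add ?_ ((hrest a ha).mono_left nhdsWithin_le_nhds)
    refine Tendsto.const_mul_atTop (hc a ha) (tendsto_inv_nhdsGT_zero.comp ?_)
    refine tendsto_nhdsWithin_iff.2 ⟨?_, ?_⟩
    · have : Tendsto (fun x => x - a) (nhds a) (nhds (a - a)) := tendsto_id.sub_const a
      rw [sub_self] at this
      exact this.mono_left nhdsWithin_le_nhds
    · filter_upwards [self_mem_nhdsWithin] with x hx using sub_pos.2 (mem_Ioi.1 hx)
  have hle : nhdsWithin a (Ioi a) ≤ 𝓟 (rightGap s a) := by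
    rw [le_principal_iff]
    have h1 : ∀ᶠ x in nhds a, ∀ b ∈ s, a < b → x < b := by
      rw [eventually_all_finset]
      intro b _
      by_cases h : a < b
      · filter_upwards [eventually_lt_nhds h] with x hx _ using hx
      · exact Eventually.of_forall fun x hx => absurd hx h
    filter_upwards [self_mem_nhdsWithin, mem_nhdsWithin_of_mem_nhds h1] with x hx1 hx2
    exact ⟨hx1, hx2⟩
  rcases (s.filter (a < ·)).eq_empty_or_nonempty with hT | hT
  · have hle2 : atTop ≤ 𝓟 (rightGap s a) := by
      rw [le_principal_iff]
      filter_upwards [eventually_gt_atTop a] with x hx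
      refine ⟨hx, fun b hb hab => ?_⟩
      have : b ∈ s.filter (a < ·) := Finset.mem_filter.2 ⟨hb, hab⟩
      simp [hT] at this
    have hright : Tendsto (atomicHilbert s c) atTop (nhds 0) := by
      have : Tendsto (fun x => ∑ d ∈ s, c d / (x - d)) atTop (nhds (∑ d ∈ s, (0 : ℝ))) := by
        refine tendsto_finsetSum _ fun d _ => ?_
        exact tendsto_const_nhds.div_atTop (tendsto_atTop_add_const_right _ (-d) tendsto_id)
      rw [Finset.sum_const_zero] at this
      exact this
    exact hpre.intermediate_value_Ioi hle2 hle hcont hright hleft hl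
  · set b := (s.filter (a < ·)).min' hT with hb
    have hbT : b ∈ s.filter (a < ·) := Finset.min'_mem _ _
    obtain ⟨hbs, hab⟩ := Finset.mem_filter.1 hbT
    have hle2 : nhdsWithin b (Iio b) ≤ 𝓟 (rightGap s a) := by
      rw [le_principal_iff]
      filter_upwards [Ioo_mem_nhdsLT hab] with x hx
      refine ⟨hx.1, fun d hd had => hx.2.trans_le (Finset.min'_le _ _ ?_)⟩
      exact Finset.mem_filter.2 ⟨hd, had⟩
    have hright : Tendsto (atomicHilbert s c) (nhdsWithin b (Iio b)) atBot := by
      rw [hsplit b hbs]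
      refine Tendsto.atBot_add ?_ ((hrest b hbs).mono_left nhdsWithin_le_nhds)
      refine Tendsto.const_mul_atBot (hc b hbs) (tendsto_inv_nhdsLT_zero.comp ?_)
      refine tendsto_nhdsWithin_iff.2 ⟨?_, ?_⟩
      · have : Tendsto (fun x => x - b) (nhds b) (nhds (b - b)) := tendsto_id.sub_const b
        rw [sub_self] at this
        exact this.mono_left nhdsWithin_le_nhds
      · filter_upwards [self_mem_nhdsWithin] with x hx using sub_neg.2 (mem_Iio.1 hx)
    exact hpre.intermediate_value_Iii hle2 hle hcont hright hleft (mem_univ l)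

open Polynomial in
/-- Boole's identity for the roots of `atomicHilbert s c = l`. -/
theorem sum_roots_sub_eq {s : Finset ℝ} {c r : ℝ → ℝ} {l : ℝ} (hl : 0 < l)
    (hr : ∀ a ∈ s, r a ∈ rightGap s a ∧ atomicHilbert s c (r a) = l) :
    ∑ a ∈ s, (r a - a) = (∑ a ∈ s, c a) / l := by
  rcases s.eq_empty_or_nonempty with rfl | hs
  · simp
  have hinj : ∀ a ∈ s, ∀ b ∈ s, r a = r b → a = b := by
    intro a ha b hb hab
    by_contra hne
    rcases lt_or_gt_of_ne hne with h | h
    · have h1 := (hr a ha).1.2 b hb h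
      have h2 := (hr b hb).1.1
      linarith
    · have h1 := (hr b hb).1.2 a ha h
      have h2 := (hr a ha).1.1
      linarith
  set P : ℝ[X] := ∏ a ∈ s, (X - C a)
  set R : ℝ[X] := ∏ a ∈ s, (X - C (r a))
  set W : ℝ[X] := ∑ a ∈ s, c a • ∏ b ∈ s.erase a, (X - C b)
  have hPm : P.Monic := monic_prod_of_monic _ _ fun a _ => monic_X_sub_C a
  have hRm : R.Monic := monic_prod_of_monic _ _ fun a _ => monic_X_sub_C _
  have hPd : P.degree = s.card := by
    rw [degree_eq_natDegree hPm.ne_zero, natDegree_finsetProd_X_sub_C_eq_card]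
  have hRd : R.degree = s.card := by
    rw [degree_eq_natDegree hRm.ne_zero]
    rw [natDegree_prod_of_monic _ _ fun a _ => monic_X_sub_C _]; simp
  have hdeg : (l • (P - R) - W).degree < s.card := by
    rw [← mem_degreeLT]
    refine Submodule.sub_mem _ (Submodule.smul_mem _ _ ?_)
      (Submodule.sum_mem _ fun a ha => Submodule.smul_mem _ _ ?_)
    · rw [mem_degreeLT, ← hPd]
      exact degree_sub_lt_left (hPd.trans hRd.symm) hPm.ne_zero (by rw [hPm.leadingCoeff, hRm.leadingCoeff])
    · rw [mem_degreeLT, degree_eq_natDegree (monic_prod_of_monic _ _ fun b _ => monic_X_sub_C b).ne_zero,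
        natDegree_finsetProd_X_sub_C_eq_card, Finset.card_erase_of_mem ha]
      have := Finset.card_pos.2 hs
      exact_mod_cast Nat.sub_lt this one_pos
  have hzero : l • (P - R) - W = 0 := by
    refine eq_zero_of_degree_lt_of_eval_finset_eq_zero (s.image r) ?_ ?_
    · rwa [Finset.card_image_of_injOn (fun a ha b hb h => hinj a ha b hb h)]
    · intro x hx
      obtain ⟨a, ha, rfl⟩ := Finset.mem_image.1 hx
      obtain ⟨hg, hv⟩ := hr a ha
      have hne : ∀ b ∈ s, r a - b ≠ 0 := fun b hb h =>
        notMem_of_mem_rightGap hg (by rwa [sub_eq_zero.1 h])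
      have hR0 : eval (r a) R = 0 := by
        rw [eval_prod]
        exact Finset.prod_eq_zero ha (by simp)
      have hW : eval (r a) W = l * eval (r a) P := by
        rw [← hv, atomicHilbert, Finset.sum_mul, eval_finsetSum]
        refine Finset.sum_congr rfl fun b hb => ?_
        rw [eval_smul, eval_prod, eval_prod, ← Finset.mul_prod_erase s _ hb, smul_eq_mul]
        simp only [eval_sub, eval_X, eval_C]
        have := hne b hb
        field_simp
      rw [eval_sub, eval_smul, eval_sub, hR0, hW, smul_eq_mul]; ring
  have hcoeff := congrArg (fun p : ℝ[X] => p.coeff (s.card - 1)) hzero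
  have h1 : P.coeff (s.card - 1) = -∑ a ∈ s, a :=
    prod_X_sub_C_coeff_card_pred s (fun a => a) (Finset.card_pos.2 hs)
  have h2 : R.coeff (s.card - 1) = -∑ a ∈ s, r a :=
    prod_X_sub_C_coeff_card_pred s r (Finset.card_pos.2 hs)
  have h3 : W.coeff (s.card - 1) = ∑ a ∈ s, c a := by
    rw [finsetSum_coeff]
    refine Finset.sum_congr rfl fun a ha => ?_
    have hm : (∏ b ∈ s.erase a, (X - C b) : ℝ[X]).Monic :=
      monic_prod_of_monic _ _ fun b _ => monic_X_sub_C b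
    have : (∏ b ∈ s.erase a, (X - C b) : ℝ[X]).natDegree = s.card - 1 := by
      rw [natDegree_finsetProd_X_sub_C_eq_card, Finset.card_erase_of_mem ha]
    rw [coeff_smul, ← this, coeff_natDegree, hm.leadingCoeff, smul_eq_mul, mul_one]
  simp only [coeff_sub, coeff_smul, coeff_zero, h1, h2, h3, smul_eq_mul] at hcoeff
  rw [Finset.sum_sub_distrib, eq_div_iff hl.ne']
  linarith

theorem volume_lt_atomicHilbert_le {s : Finset ℝ} {c : ℝ → ℝ} (hc : ∀ a ∈ s, 0 < c a) {l : ℝ}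
    (hl : 0 < l) :
    volume {x | x ∉ s ∧ l < atomicHilbert s c x} ≤ ENNReal.ofReal ((∑ a ∈ s, c a) / l) := by
  choose! r hr using fun a (ha : a ∈ s) => exists_atomicHilbert_eq hc ha hl
  have hsub : {x | x ∉ s ∧ l < atomicHilbert s c x} ⊆ ⋃ a ∈ s, Ioo a (r a) := by
    rintro x ⟨hxs, hx⟩
    have hne : (s.filter (· < x)).Nonempty := by
      by_contra h
      rw [Finset.not_nonempty_iff_eq_empty] at h
      have : atomicHilbert s c x ≤ 0 := by
        refine Finset.sum_nonpos fun b hb => ?_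
        have : ¬ b < x := fun hbx => by
          have : b ∈ s.filter (· < x) := Finset.mem_filter.2 ⟨hb, hbx⟩
          simp [h] at this
        exact div_nonpos_of_nonneg_of_nonpos (hc b hb).le (by linarith)
      linarith
    set a := (s.filter (· < x)).max' hne
    obtain ⟨has, hax⟩ := Finset.mem_filter.1 ((s.filter (· < x)).max'_mem hne)
    have hgap : x ∈ rightGap s a := by
      refine ⟨hax, fun b hb hab => ?_⟩
      by_contra hxb
      have hbx : b < x := lt_of_le_of_ne (not_lt.1 hxb) fun h => hxs (h ▸ hb)
      have := (s.filter (· < x)).le_max' b (Finset.mem_filter.2 ⟨hb, hbx⟩)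
      exact absurd hab (not_lt.2 this)
    refine mem_biUnion has ⟨hax, ?_⟩
    by_contra hxr
    have := (strictAntiOn_atomicHilbert hc has).antitoneOn (hr a has).1 hgap (not_lt.1 hxr)
    rw [(hr a has).2] at this
    linarith
  calc volume {x | x ∉ s ∧ l < atomicHilbert s c x} ≤ ∑ a ∈ s, volume (Ioo a (r a)) :=
        (measure_mono hsub).trans (measure_biUnion_finset_le _ _)
    _ = ∑ a ∈ s, ENNReal.ofReal (r a - a) := by simp
    _ = ENNReal.ofReal (∑ a ∈ s, (r a - a)) :=
        (ENNReal.ofReal_sum_of_nonneg fun a ha => sub_nonneg.2 (hr a ha).1.1.le).symm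
    _ = _ := by rw [sum_roots_sub_eq hl hr]

/-- Weak-type `(1,1)` bound for the Hilbert transform of a finite sum of point masses. -/
theorem volume_lt_abs_atomicHilbert_le {s : Finset ℝ} {c : ℝ → ℝ} (hc : ∀ a ∈ s, 0 ≤ c a) {l : ℝ}
    (hl : 0 < l) :
    volume {x | l < |atomicHilbert s c x|} ≤ ENNReal.ofReal (2 * (∑ a ∈ s, c a) / l) := by
  set p := s.filter (fun a => 0 < c a) with hp
  have hpos : ∀ a ∈ p, 0 < c a := fun a ha => (Finset.mem_filter.1 ha).2
  have hz : ∀ a ∈ s, a ∉ p → c a = 0 := fun a ha hap =>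
    le_antisymm (not_lt.1 fun h => hap (Finset.mem_filter.2 ⟨ha, h⟩)) (hc a ha)
  have hps : p ⊆ s := Finset.filter_subset _ _
  have hsum : ∑ a ∈ p, c a = ∑ a ∈ s, c a := Finset.sum_subset hps hz
  have hH : ∀ x, atomicHilbert p c x = atomicHilbert s c x := fun x =>
    Finset.sum_subset hps fun a ha hap => by rw [hz a ha hap, zero_div]
  set p' := p.image (fun a => -a)
  have hneg : ∀ x, atomicHilbert p' (fun a => c (-a)) (-x) = -atomicHilbert p c x := by
    intro x
    simp only [atomicHilbert, p']
    rw [Finset.sum_image (fun a _ b _ h => neg_injective h), ← Finset.sum_neg_distrib]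
    refine Finset.sum_congr rfl fun a _ => ?_
    rw [neg_neg, ← div_neg]; congr 1; ring
  have hsum' : ∑ a ∈ p', c (-a) = ∑ a ∈ s, c a := by
    rw [Finset.sum_image (fun a _ b _ h => neg_injective h)]; simpa using hsum
  have h1 := volume_lt_atomicHilbert_le hpos hl
  have h2 := volume_lt_atomicHilbert_le (s := p') (c := fun a => c (-a)) (fun a ha => by
    obtain ⟨b, hb, rfl⟩ := Finset.mem_image.1 ha
    simpa using hpos b hb) hl
  rw [hsum] at h1
  rw [hsum'] at h2
  have hsub : {x | l < |atomicHilbert s c x|} ⊆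
      (p : Set ℝ) ∪ ({x | x ∉ p ∧ l < atomicHilbert p c x} ∪
        Neg.neg ⁻¹' {x | x ∉ p' ∧ l < atomicHilbert p' (fun a => c (-a)) x}) := by
    intro x hx
    by_cases hxp : x ∈ p
    · exact Or.inl hxp
    · right
      rcases lt_abs.1 (show l < |atomicHilbert s c x| from hx) with h | h
      · exact Or.inl ⟨hxp, by rwa [hH]⟩
      · refine Or.inr ⟨fun h' => hxp ?_, ?_⟩
        · obtain ⟨b, hb, hbx⟩ := Finset.mem_image.1 h'
          rwa [← neg_injective hbx]
        · rw [hneg, hH]; exact h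
  have hfin : 0 ≤ (∑ a ∈ s, c a) / l := div_nonneg (Finset.sum_nonneg hc) hl.le
  calc volume {x | l < |atomicHilbert s c x|}
      ≤ volume (p : Set ℝ) + (volume {x | x ∉ p ∧ l < atomicHilbert p c x} +
        volume (Neg.neg ⁻¹' {x | x ∉ p' ∧ l < atomicHilbert p' (fun a => c (-a)) x})) :=
        (measure_mono hsub).trans ((measure_union_le _ _).trans (by gcongr; exact measure_union_le _ _))
    _ ≤ 0 + (ENNReal.ofReal ((∑ a ∈ s, c a) / l) + ENNReal.ofReal ((∑ a ∈ s, c a) / l)) := by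
        gcongr
        · exact (p.finite_toSet.measure_zero _).le
        · rw [Measure.measure_preimage_neg]; exact h2
    _ = _ := by rw [zero_add, ← ENNReal.ofReal_add hfin hfin]; congr 1; ring

/-- The finite measure with point masses `c a` at the points `a ∈ s`. -/
def atomicMeasure (s : Finset ℝ) (c : ℝ → ℝ) : Measure ℝ :=
  ∑ a ∈ s, ENNReal.ofReal (c a) • Measure.dirac a

theorem lintegral_atomicMeasure (s : Finset ℝ) (c : ℝ → ℝ) (g : ℝ → ℝ≥0∞) :
    ∫⁻ t, g t ∂atomicMeasure s c = ∑ a ∈ s, ENNReal.ofReal (c a) * g a := by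
  rw [atomicMeasure, lintegral_finsetSum_measure]
  simp

theorem setLIntegral_atomicMeasure (s : Finset ℝ) (c : ℝ → ℝ) (g : ℝ → ℝ≥0∞) {S : Set ℝ}
    (hS : MeasurableSet S) [DecidablePred (· ∈ S)] :
    ∫⁻ t in S, g t ∂atomicMeasure s c = ∑ a ∈ s.filter (· ∈ S), ENNReal.ofReal (c a) * g a := by
  rw [← lintegral_indicator hS, lintegral_atomicMeasure, Finset.sum_filter]
  refine Finset.sum_congr rfl fun a _ => ?_
  by_cases h : a ∈ S <;> simp [h]

theorem atomicMeasure_apply (s : Finset ℝ) (c : ℝ → ℝ) {S : Set ℝ}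
    (hS : MeasurableSet S) [DecidablePred (· ∈ S)] :
    atomicMeasure s c S = ∑ a ∈ s.filter (· ∈ S), ENNReal.ofReal (c a) := by
  rw [← setLIntegral_one, setLIntegral_atomicMeasure s c _ hS]
  simp

theorem atomicMeasure_univ {s : Finset ℝ} {c : ℝ → ℝ} (hc : ∀ a ∈ s, 0 ≤ c a) :
    atomicMeasure s c univ = ENNReal.ofReal (∑ a ∈ s, c a) := by
  classical
  rw [atomicMeasure_apply s c MeasurableSet.univ, ENNReal.ofReal_sum_of_nonneg hc]
  simp

open Classical in
/-- The truncated Hilbert transform of a sum of point masses. -/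
def atomicTrunc (s : Finset ℝ) (c : ℝ → ℝ) (ε x : ℝ) : ℝ :=
  ∑ a ∈ s.filter (fun a => ε < |x - a|), c a / (x - a)

theorem measurable_atomicHilbert (s : Finset ℝ) (c : ℝ → ℝ) : Measurable (atomicHilbert s c) := by
  unfold atomicHilbert
  fun_prop

/-- The outer part of the Hilbert transform oscillates little near a point where the maximal
function is small. -/
theorem abs_atomicHilbert_sub_le {s : Finset ℝ} {c : ℝ → ℝ} (hc : ∀ a ∈ s, 0 ≤ c a) {x y ε A : ℝ}
    (hε : 0 < ε) (hA : 0 ≤ A)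
    (h : ∀ r > 0, atomicMeasure s c (Metric.closedBall x r) ≤ ENNReal.ofReal (A * r))
    (hy : |x - y| ≤ ε / 2) {s' : Finset ℝ} (hs' : ∀ a, a ∈ s' ↔ a ∈ s ∧ ε < |x - a|) :
    |atomicHilbert s' c y - atomicHilbert s' c x| ≤ 4 * A := by
  classical
  have htail := lintegral_tail_le _ hε hA h
  have hms : MeasurableSet {t : ℝ | ε < |x - t|} :=
    measurableSet_lt measurable_const (by fun_prop)
  rw [setLIntegral_atomicMeasure s c _ hms] at htail
  have hs'' : s.filter (· ∈ {t : ℝ | ε < |x - t|}) = s' := by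
    ext a; simp [hs']
  rw [hs''] at htail
  have hc' : ∀ a ∈ s', 0 ≤ c a := fun a ha => hc a ((hs' a).1 ha).1
  have h1 : ∑ a ∈ s', c a * (ε / |x - a| ^ 2) ≤ 4 * A := by
    rw [← ENNReal.ofReal_le_ofReal_iff (by positivity),
      ENNReal.ofReal_sum_of_nonneg fun a ha => mul_nonneg (hc' a ha) (by positivity)]
    refine le_trans (le_of_eq (Finset.sum_congr rfl fun a ha => ?_)) htail
    rw [ENNReal.ofReal_mul (hc' a ha)]
  refine le_trans ?_ h1
  rw [atomicHilbert, atomicHilbert, ← Finset.sum_sub_distrib]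
  refine (Finset.abs_sum_le_sum_abs _ _).trans (Finset.sum_le_sum fun a ha => ?_)
  have hxa : ε < |x - a| := ((hs' a).1 ha).2
  have hya : |x - a| / 2 ≤ |y - a| := by
    have := abs_sub_abs_le_abs_sub (x - a) (y - a)
    rw [sub_sub_sub_cancel_right] at this
    linarith
  have hxa0 : 0 < |x - a| := hε.trans hxa
  have hya0 : 0 < |y - a| := by linarith
  have e : c a / (y - a) - c a / (x - a) = c a * ((x - y) / ((y - a) * (x - a))) := by
    have := abs_pos.1 hxa0
    have := abs_pos.1 hya0
    field_simp
    ring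
  rw [e, abs_mul, abs_of_nonneg (hc' a ha), abs_div, abs_mul]
  refine mul_le_mul_of_nonneg_left ?_ (hc' a ha)
  rw [div_le_div_iff₀ (by positivity) (by positivity)]
  calc |x - y| * |x - a| ^ 2 ≤ ε / 2 * |x - a| ^ 2 := by gcongr
    _ = ε * (|x - a| / 2 * |x - a|) := by ring
    _ ≤ ε * (|y - a| * |x - a|) := by gcongr

/-- Weak-type bound for the maximal truncations of the Hilbert transform of point masses. -/
theorem volume_lt_abs_atomicTrunc_le {s : Finset ℝ} {c : ℝ → ℝ} (hc : ∀ a ∈ s, 0 ≤ c a) {l : ℝ}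
    (hl : 0 < l) :
    volume {x | ∃ ε > 0, l < |atomicTrunc s c ε x|} ≤ ENNReal.ofReal (720 * (∑ a ∈ s, c a) / l) := by
  classical
  have hS : 0 ≤ ∑ a ∈ s, c a := Finset.sum_nonneg hc
  set μ := atomicMeasure s c with hμ
  have hμu : μ univ = ENNReal.ofReal (∑ a ∈ s, c a) := atomicMeasure_univ hc
  have : IsFiniteMeasure μ := ⟨by rw [hμu]; exact ENNReal.ofReal_lt_top⟩
  set B := {x | l / 4 < |atomicHilbert s c x|} with hB
  have hBv : volume B ≤ ENNReal.ofReal (2 * (∑ a ∈ s, c a) / (l / 4)) :=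
    volume_lt_abs_atomicHilbert_le hc (by positivity)
  have hBm : MeasurableSet B := measurableSet_lt measurable_const
    (measurable_atomicHilbert s c).abs
  have : IsFiniteMeasure (volume.restrict B) :=
    ⟨by rw [Measure.restrict_apply_univ]; exact hBv.trans_lt ENNReal.ofReal_lt_top⟩
  have hsub : {x | ∃ ε > 0, l < |atomicTrunc s c ε x|} ⊆
      {x | ∃ r > 0, ENNReal.ofReal (l / 64 * r) < μ (Metric.closedBall x r)} ∪
      {x | ∃ r > 0, ENNReal.ofReal (1 * r) < volume.restrict B (Metric.closedBall x r)} := by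
    rintro x ⟨ε, hε, hx⟩
    by_cases hM : ∃ r > 0, ENNReal.ofReal (l / 64 * r) < μ (Metric.closedBall x r)
    · exact Or.inl hM
    push Not at hM
    refine Or.inr ⟨ε / 2, by positivity, ?_⟩
    set so := s.filter (fun a => ε < |x - a|) with hso
    set si := s.filter (fun a => ¬ ε < |x - a|) with hsi
    have hci : ∀ a ∈ si, 0 ≤ c a := fun a ha => hc a (Finset.mem_filter.1 ha).1
    have hin : ∑ a ∈ si, c a ≤ l / 64 * ε := by
      have h1 := hM ε hε
      rw [hμ, atomicMeasure_apply s c Metric.isClosed_closedBall.measurableSet] at h1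
      rw [← ENNReal.ofReal_le_ofReal_iff (by positivity), ENNReal.ofReal_sum_of_nonneg hci]
      refine le_trans (le_of_eq (Finset.sum_congr ?_ fun _ _ => rfl)) h1
      ext a
      simp [hsi, Metric.mem_closedBall, Real.dist_eq, abs_sub_comm a x]
    set D := {y | l / 2 < |atomicHilbert si c y|} with hD
    have hDv : volume D ≤ ENNReal.ofReal (ε / 16) := by
      refine (volume_lt_abs_atomicHilbert_le hci (by positivity)).trans (ENNReal.ofReal_le_ofReal ?_)
      rw [div_le_iff₀ (by positivity)]
      linarith
    have hcover : Metric.closedBall x (ε / 2) ⊆ (Metric.closedBall x (ε / 2) ∩ B) ∪ D := by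
      intro y hy
      by_cases hyD : y ∈ D
      · exact Or.inr hyD
      refine Or.inl ⟨hy, ?_⟩
      have hyD' : |atomicHilbert si c y| ≤ l / 2 := not_lt.1 hyD
      have hy' : |x - y| ≤ ε / 2 := by
        rw [abs_sub_comm]; exact hy
      have h1 := abs_atomicHilbert_sub_le hc hε (by positivity) hM hy'
        (s' := so) (fun a => by simp [hso])
      have h2 : atomicHilbert s c y = atomicHilbert so c y + atomicHilbert si c y :=
        (Finset.sum_filter_add_sum_filter_not s _ _).symm
      have h3 : l < |atomicHilbert so c x| := hx
      have h4 := abs_sub_abs_le_abs_sub (atomicHilbert so c x) (atomicHilbert so c y)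
      rw [abs_sub_comm] at h4
      have h5 := abs_sub_abs_le_abs_sub (atomicHilbert so c y) (-atomicHilbert si c y)
      rw [sub_neg_eq_add, ← h2, abs_neg] at h5
      show l / 4 < |atomicHilbert s c y|
      linarith
    have hfinal : ENNReal.ofReal ε ≤ volume (Metric.closedBall x (ε / 2) ∩ B) + ENNReal.ofReal (ε / 16) := by
      calc ENNReal.ofReal ε = volume (Metric.closedBall x (ε / 2)) := by
            rw [Real.volume_closedBall]; congr 1; ring
        _ ≤ _ := (measure_mono hcover).trans ((measure_union_le _ _).trans (by gcongr))
    rw [Measure.restrict_apply Metric.isClosed_closedBall.measurableSet]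
    by_contra hcon
    rw [not_lt] at hcon
    have h6 : ENNReal.ofReal ε ≤ ENNReal.ofReal (1 * (ε / 2) + ε / 16) := by
      rw [ENNReal.ofReal_add (by positivity) (by positivity)]
      exact hfinal.trans (by gcongr)
    rw [ENNReal.ofReal_le_ofReal_iff (by positivity)] at h6
    linarith
  calc _ ≤ _ := (measure_mono hsub).trans (measure_union_le _ _)
    _ ≤ ENNReal.ofReal (10 / (l / 64)) * μ univ + ENNReal.ofReal (10 / 1) * volume.restrict B univ := by
        gcongr
        · exact volume_maximal_le μ (by positivity)
        · exact volume_maximal_le _ one_pos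
    _ ≤ ENNReal.ofReal (10 / (l / 64)) * ENNReal.ofReal (∑ a ∈ s, c a) +
        ENNReal.ofReal (10 / 1) * ENNReal.ofReal (2 * (∑ a ∈ s, c a) / (l / 4)) := by
        rw [hμu, Measure.restrict_apply_univ]; gcongr
    _ = _ := by
        rw [← ENNReal.ofReal_mul (by positivity), ← ENNReal.ofReal_mul (by positivity),
          ← ENNReal.ofReal_add (by positivity) (by positivity)]
        congr 1
        field_simp
        ring

/-- The truncated Hilbert kernel. -/
def truncKernel (ε u : ℝ) : ℝ := {u | ε < |u|}.indicator (fun u => u⁻¹) u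

/-- The truncated Hilbert transform. -/
def truncHilbert (f : ℝ → ℝ) (ε x : ℝ) : ℝ := ∫ t in {t : ℝ | ε < |x - t|}, f t / (x - t)

theorem measurableSet_trunc (ε x : ℝ) : MeasurableSet {t : ℝ | ε < |x - t|} :=
  measurableSet_lt measurable_const (by fun_prop)

theorem measurable_truncKernel (ε : ℝ) : Measurable (truncKernel ε) :=
  measurable_inv.indicator (measurableSet_lt measurable_const (by fun_prop))

theorem abs_truncKernel_le {ε : ℝ} (hε : 0 < ε) (u : ℝ) : |truncKernel ε u| ≤ ε⁻¹ := by
  unfold truncKernel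
  by_cases h : u ∈ {u | ε < |u|}
  · rw [indicator_of_mem h, abs_inv]
    exact inv_anti₀ hε (le_of_lt h)
  · rw [indicator_of_notMem h, abs_zero]; positivity

theorem continuousAt_truncKernel {ε u : ℝ} (hε : 0 < ε) (hu : |u| ≠ ε) :
    ContinuousAt (truncKernel ε) u := by
  rcases lt_or_gt_of_ne hu with h | h
  · have : truncKernel ε =ᶠ[nhds u] fun _ => 0 := by
      filter_upwards [(continuous_abs.tendsto u).eventually_lt_const h] with v hv
      exact indicator_of_notMem (by simpa using hv.le) _
    exact continuousAt_const.congr this.symm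
  · have : truncKernel ε =ᶠ[nhds u] fun v => v⁻¹ := by
      filter_upwards [(continuous_abs.tendsto u).eventually_const_lt h] with v hv
      exact indicator_of_mem (by simpa using hv) _
    refine ContinuousAt.congr (continuousAt_inv₀ ?_) this.symm
    exact abs_pos.1 (hε.trans h)

theorem truncHilbert_eq (f : ℝ → ℝ) (ε x : ℝ) :
    truncHilbert f ε x = ∫ t, f t * truncKernel ε (x - t) := by
  rw [truncHilbert, ← integral_indicator (measurableSet_trunc ε x)]
  congr 1
  funext t
  by_cases h : ε < |x - t|
  · simp [truncKernel, h, div_eq_mul_inv]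
  · simp [truncKernel, h]

/-- The left endpoint of the interval of the grid of mesh `1 / (n + 1)` containing `t`. -/
def gridPoint (n : ℕ) (t : ℝ) : ℝ := (⌊((n : ℝ) + 1) * t⌋ : ℝ) / (n + 1)

theorem measurable_gridPoint (n : ℕ) : Measurable (gridPoint n) := by
  unfold gridPoint
  have : Measurable fun t : ℝ => ((⌊((n : ℝ) + 1) * t⌋ : ℤ) : ℝ) :=
    (measurable_from_top (f := fun z : ℤ => (z : ℝ))).comp
      (Int.measurable_floor.comp (measurable_const_mul _))
  exact this.div_const _

theorem tendsto_gridPoint (t : ℝ) : Tendsto (fun n => gridPoint n t) atTop (nhds t) := by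
  have h0 : Tendsto (fun n : ℕ => 1 / ((n : ℝ) + 1)) atTop (nhds 0) :=
    tendsto_one_div_add_atTop_nhds_zero_nat
  have h1 : Tendsto (fun n : ℕ => t - 1 / ((n : ℝ) + 1)) atTop (nhds t) := by
    simpa using tendsto_const_nhds.sub h0
  refine tendsto_of_tendsto_of_tendsto_of_le_of_le h1 tendsto_const_nhds (fun n => ?_) fun n => ?_
  · have := Int.lt_floor_add_one (((n : ℝ) + 1) * t)
    have hn : (0 : ℝ) < n + 1 := by positivity
    show t - 1 / ((n : ℝ) + 1) ≤ _ / _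
    rw [le_div_iff₀ hn, sub_mul, one_div, inv_mul_cancel₀ hn.ne']
    linarith
  · have := Int.floor_le (((n : ℝ) + 1) * t)
    have hn : (0 : ℝ) < n + 1 := by positivity
    show _ / _ ≤ t
    rw [div_le_iff₀ hn]; linarith

/-- The grid points of mesh `1 / (n + 1)` in a large bounded interval. -/
def gridFinset (n : ℕ) : Finset ℝ :=
  (Finset.Icc (-((n : ℤ) + 1) ^ 2) (((n : ℤ) + 1) ^ 2)).image fun j : ℤ => (j : ℝ) / (n + 1)

theorem gridPoint_mem {n : ℕ} {t : ℝ} (h : |t| ≤ n) : gridPoint n t ∈ gridFinset n := by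
  refine Finset.mem_image.2 ⟨⌊((n : ℝ) + 1) * t⌋, Finset.mem_Icc.2 ⟨?_, ?_⟩, rfl⟩
  · rw [Int.le_floor]
    push_cast
    have := (abs_le.1 h).1
    nlinarith
  · have h1 := Int.floor_le (((n : ℝ) + 1) * t)
    have := (abs_le.1 h).2
    have : (⌊((n : ℝ) + 1) * t⌋ : ℝ) ≤ ((((n : ℤ) + 1) ^ 2 : ℤ) : ℝ) := by
      push_cast
      nlinarith
    exact_mod_cast this

theorem sum_grid_eq {f : ℝ → ℝ} (hf : Integrable f) (n : ℕ) (s : Finset ℝ) (K : ℝ → ℝ) :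
    ∑ a ∈ s, (∫ t in {t | gridPoint n t = a}, f t) * K a =
      ∫ t, {t | gridPoint n t ∈ s}.indicator (fun t => f t * K (gridPoint n t)) t := by
  classical
  have hm : ∀ a, MeasurableSet {t | gridPoint n t = a} := fun a =>
    measurable_gridPoint n (measurableSet_singleton a)
  calc _ = ∑ a ∈ s, ∫ t, {t | gridPoint n t = a}.indicator (fun t => f t * K a) t := by
        refine Finset.sum_congr rfl fun a _ => ?_
        rw [integral_indicator (hm a), integral_mul_const]
    _ = ∫ t, ∑ a ∈ s, {t | gridPoint n t = a}.indicator (fun t => f t * K a) t :=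
        (integral_finsetSum _ fun a _ => (hf.mul_const _).indicator (hm a)).symm
    _ = _ := by
        congr 1
        funext t
        simp only [indicator_apply, mem_ofPred_eq]
        rw [Finset.sum_ite_eq]

theorem tendsto_atomicTrunc {f : ℝ → ℝ} (hf : Integrable f) {ε : ℝ} (hε : 0 < ε) (x : ℝ) :
    Tendsto (fun n => atomicTrunc (gridFinset n) (fun a => ∫ t in {t | gridPoint n t = a}, f t) ε x)
      atTop (nhds (truncHilbert f ε x)) := by
  have e : ∀ n, atomicTrunc (gridFinset n) (fun a => ∫ t in {t | gridPoint n t = a}, f t) ε x =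
      ∫ t, {t | gridPoint n t ∈ gridFinset n}.indicator
        (fun t => f t * truncKernel ε (x - gridPoint n t)) t := by
    intro n
    rw [← sum_grid_eq hf n (gridFinset n) (fun a => truncKernel ε (x - a)), atomicTrunc,
      Finset.sum_filter]
    refine Finset.sum_congr rfl fun a _ => ?_
    by_cases h : ε < |x - a| <;> simp [truncKernel, h, div_eq_mul_inv]
  simp only [e]
  rw [truncHilbert_eq]
  refine tendsto_integral_of_dominated_convergence (fun t => |f t| * ε⁻¹) (fun n => ?_)
    (hf.abs.mul_const _) (fun n => Eventually.of_forall fun t => ?_) ?_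
  · refine (hf.aestronglyMeasurable.mul ?_).indicator
      (measurable_gridPoint n (Finset.measurableSet _))
    exact ((measurable_truncKernel ε).comp
      (measurable_const.sub (measurable_gridPoint n))).aestronglyMeasurable
  · refine (norm_indicator_le_norm_self _ _).trans ?_
    rw [norm_mul, Real.norm_eq_abs, Real.norm_eq_abs]
    exact mul_le_mul_of_nonneg_left (abs_truncKernel_le hε _) (abs_nonneg _)
  · have h1 : ∀ᵐ t : ℝ, t ≠ x - ε := Measure.ae_ne _ _
    have h2 : ∀ᵐ t : ℝ, t ≠ x + ε := Measure.ae_ne _ _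
    filter_upwards [h1, h2] with t ht1 ht2
    have hne : |x - t| ≠ ε := by
      intro h
      rcases abs_choice (x - t) with h' | h'
      · exact ht1 (by linarith)
      · exact ht2 (by linarith)
    have hk : Tendsto (fun n => f t * truncKernel ε (x - gridPoint n t)) atTop
        (nhds (f t * truncKernel ε (x - t))) :=
      ((continuousAt_truncKernel hε hne).tendsto.comp
        ((tendsto_gridPoint t).const_sub x)).const_mul _
    refine hk.congr' ?_
    obtain ⟨N, hN⟩ := exists_nat_ge |t|
    filter_upwards [eventually_ge_atTop N] with n hn
    rw [indicator_of_mem]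
    exact gridPoint_mem (hN.trans (by exact_mod_cast hn))

theorem volume_lt_abs_truncHilbert_le_of_nonneg {f : ℝ → ℝ} (hf : Integrable f) (h0 : 0 ≤ f) {l : ℝ}
    (hl : 0 < l) :
    volume {x | ∃ ε > 0, l < |truncHilbert f ε x|} ≤ ENNReal.ofReal (720 * (∫ t, f t) / l) := by
  set G : ℕ → Set ℝ := fun n => {x | ∃ ε > 0, l < |atomicTrunc (gridFinset n)
    (fun a => ∫ t in {t | gridPoint n t = a}, f t) ε x|}
  have hG : ∀ n, volume (G n) ≤ ENNReal.ofReal (720 * (∫ t, f t) / l) := by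
    intro n
    refine (volume_lt_abs_atomicTrunc_le (fun a _ => integral_nonneg h0) hl).trans ?_
    refine ENNReal.ofReal_le_ofReal ?_
    gcongr
    have := sum_grid_eq hf n (gridFinset n) fun _ => 1
    simp only [mul_one] at this
    rw [this]
    refine integral_mono (hf.indicator (measurable_gridPoint n (Finset.measurableSet _))) hf ?_
    exact indicator_le_self' fun t _ => h0 t
  have hsub : {x | ∃ ε > 0, l < |truncHilbert f ε x|} ⊆ ⋃ N, ⋂ n ≥ N, G n := by
    rintro x ⟨ε, hε, hx⟩
    have := (tendsto_atomicTrunc hf hε x).abs.eventually_const_lt hx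
    obtain ⟨N, hN⟩ := eventually_atTop.1 this
    exact mem_iUnion.2 ⟨N, mem_iInter₂.2 fun n hn => ⟨ε, hε, hN n hn⟩⟩
  have hmono : Monotone fun N => ⋂ n ≥ N, G n := fun N M hNM =>
    biInter_subset_biInter_left fun n hn => le_trans hNM hn
  refine (measure_mono hsub).trans ?_
  rw [hmono.measure_iUnion]
  exact iSup_le fun N => (measure_mono (biInter_subset_of_mem (mem_Ici.2 le_rfl))).trans (hG N)

theorem integrable_mul_truncKernel {f : ℝ → ℝ} (hf : Integrable f) {ε : ℝ} (hε : 0 < ε) (x : ℝ) :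
    Integrable fun t => f t * truncKernel ε (x - t) := by
  refine hf.mul_bdd (c := ε⁻¹) ?_ (Eventually.of_forall fun t => ?_)
  · exact ((measurable_truncKernel ε).comp (measurable_const.sub measurable_id)).aestronglyMeasurable
  · exact abs_truncKernel_le hε _

theorem truncHilbert_sub {f g : ℝ → ℝ} (hf : Integrable f) (hg : Integrable g) {ε : ℝ} (hε : 0 < ε)
    (x : ℝ) : truncHilbert (fun t => f t - g t) ε x = truncHilbert f ε x - truncHilbert g ε x := by
  simp only [truncHilbert_eq, sub_mul]
  exact integral_sub (integrable_mul_truncKernel hf hε x) (integrable_mul_truncKernel hg hε x)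

/-- Weak-type `(1,1)` bound for the maximal truncated Hilbert transform. -/
theorem volume_lt_abs_truncHilbert_le {f : ℝ → ℝ} (hf : Integrable f) {l : ℝ}
    (hl : 0 < l) :
    volume {x | ∃ ε > 0, l < |truncHilbert f ε x|} ≤ ENNReal.ofReal (1440 * (∫ t, |f t|) / l) := by
  have hp := hf.pos_part
  have hn := hf.neg_part
  have hsub : {x | ∃ ε > 0, l < |truncHilbert f ε x|} ⊆
      {x | ∃ ε > 0, l / 2 < |truncHilbert (fun t => max (f t) 0) ε x|} ∪
      {x | ∃ ε > 0, l / 2 < |truncHilbert (fun t => max (-f t) 0) ε x|} := by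
    rintro x ⟨ε, hε, hx⟩
    have e : f = fun t => max (f t) 0 - max (-f t) 0 := by
      funext t; rcases le_total 0 (f t) with h | h <;> simp [h]
    rw [e, truncHilbert_sub hp hn hε] at hx
    by_contra hcon
    simp only [mem_union, mem_ofPred_eq, not_or, not_exists, not_and, not_lt] at hcon
    have := hcon.1 ε hε
    have := hcon.2 ε hε
    have := abs_sub (truncHilbert (fun t => max (f t) 0) ε x) (truncHilbert (fun t => max (-f t) 0) ε x)
    linarith
  have hp0 : 0 ≤ fun t => max (f t) 0 := fun t => le_max_right _ _
  have hn0 : 0 ≤ fun t => max (-f t) 0 := fun t => le_max_right _ _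
  refine (measure_mono hsub).trans ((measure_union_le _ _).trans ?_)
  refine (add_le_add (volume_lt_abs_truncHilbert_le_of_nonneg hp hp0 (half_pos hl))
    (volume_lt_abs_truncHilbert_le_of_nonneg hn hn0 (half_pos hl))).trans ?_
  rw [← ENNReal.ofReal_add]
  · refine ENNReal.ofReal_le_ofReal (le_of_eq ?_)
    have : ∫ t, |f t| = (∫ t, max (f t) 0) + ∫ t, max (-f t) 0 := by
      rw [← integral_add hp hn]
      congr 1; funext t; rcases le_total 0 (f t) with h | h <;> simp [h, abs_of_nonneg, abs_of_nonpos]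
    rw [this]
    field_simp
    ring
  · have := integral_nonneg (μ := volume) hp0; positivity
  · have := integral_nonneg (μ := volume) hn0; positivity

/-- Principal values of Lipschitz functions exist everywhere. -/
theorem exists_tendsto_truncHilbert_of_lipschitz {g : ℝ → ℝ} (hg : Integrable g) {K : NNReal}
    (hK : LipschitzWith K g) (x : ℝ) :
    ∃ L, Tendsto (fun ε => truncHilbert g ε x) (nhdsWithin 0 (Ioi 0)) (nhds L) := by
  set T : Set ℝ := {t | |x - t| ≤ 1} with hT
  have hTm : MeasurableSet T := measurableSet_le (by fun_prop) measurable_const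
  have hTv : volume T < ⊤ := by
    have : T = Metric.closedBall x 1 := by
      ext t; simp [hT, Metric.mem_closedBall, Real.dist_eq, abs_sub_comm]
    rw [this]; exact measure_closedBall_lt_top
  have hTi : Integrable (T.indicator fun _ => g x) :=
    (integrable_indicator_iff hTm).2 (integrableOn_const hTv.ne)
  set h : ℝ → ℝ := fun t => g t - T.indicator (fun _ => g x) t with hh
  have hhi : Integrable h := hg.sub hTi
  have e : ∀ ε > 0, truncHilbert g ε x = ∫ t, h t * truncKernel ε (x - t) := by
    intro ε hε
    have e1 : ∫ t, T.indicator (fun _ => g x) t * truncKernel ε (x - t) = 0 := by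
      set F : ℝ → ℝ := fun u => {u : ℝ | |u| ≤ 1}.indicator (fun _ => g x) u * truncKernel ε u
      have hF : ∀ u, F (-u) = -F u := by
        intro u
        have : truncKernel ε (-u) = - truncKernel ε u := by
          by_cases h : ε < |u| <;> simp [truncKernel, h]
        by_cases h : |u| ≤ 1 <;> simp [F, this, h]
      have h1 : ∫ t, T.indicator (fun _ => g x) t * truncKernel ε (x - t) = ∫ u, F u := by
        rw [← integral_sub_left_eq_self F volume x]; rfl
      have h2 : ∫ u, F u = - ∫ u, F u := by
        conv_lhs => rw [← integral_neg_eq_self F volume]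
        rw [← integral_neg]; simp only [hF]
      rw [h1]; linarith
    rw [truncHilbert_eq, ← sub_zero (∫ t, g t * truncKernel ε (x - t)), ← e1,
      ← integral_sub (integrable_mul_truncKernel hg hε x) (integrable_mul_truncKernel hTi hε x)]
    simp only [hh, sub_mul]
  refine ⟨∫ t, h t * (x - t)⁻¹, ?_⟩
  have key : Tendsto (fun ε => ∫ t, h t * truncKernel ε (x - t)) (nhdsWithin 0 (Ioi 0))
      (nhds (∫ t, h t * (x - t)⁻¹)) := by
    refine tendsto_integral_filter_of_dominated_convergence
      (fun t => T.indicator (fun _ => (K : ℝ)) t + |g t|) ?_ ?_ ?_ ?_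
    · refine Eventually.of_forall fun ε => hhi.aestronglyMeasurable.mul ?_
      exact ((measurable_truncKernel ε).comp
        (measurable_const.sub measurable_id)).aestronglyMeasurable
    · refine Eventually.of_forall fun ε => Eventually.of_forall fun t => ?_
      have hk : |truncKernel ε (x - t)| ≤ |x - t|⁻¹ := by
        by_cases h : ε < |x - t| <;> simp [truncKernel, h]
      rw [norm_mul, Real.norm_eq_abs, Real.norm_eq_abs]
      refine (mul_le_mul_of_nonneg_left hk (abs_nonneg _)).trans ?_
      by_cases ht : t ∈ T
      · have h1 : |g t - g x| ≤ K * |x - t| := by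
          have := hK.dist_le_mul t x
          rwa [Real.dist_eq, Real.dist_eq, abs_sub_comm t x] at this
        simp only [hh, indicator_of_mem ht]
        rcases (abs_nonneg (x - t)).eq_or_lt with h0 | h0
        · rw [← h0, _root_.inv_zero, mul_zero]; positivity
        · calc |g t - g x| * |x - t|⁻¹ ≤ K * |x - t| * |x - t|⁻¹ := by gcongr
            _ = K := by rw [mul_assoc, mul_inv_cancel₀ h0.ne', mul_one]
            _ ≤ K + |g t| := by linarith [abs_nonneg (g t)]
      · simp only [hh, indicator_of_notMem ht, sub_zero, zero_add]
        have : 1 < |x - t| := not_le.1 ht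
        exact mul_le_of_le_one_right (abs_nonneg _) (inv_le_one_of_one_le₀ this.le)
    · exact ((integrable_indicator_iff hTm).2 (integrableOn_const hTv.ne)).add hg.abs
    · have h1 : ∀ᵐ t : ℝ, t ≠ x := Measure.ae_ne _ _
      filter_upwards [h1] with t ht
      have h0 : 0 < |x - t| := abs_pos.2 (sub_ne_zero.2 ht.symm)
      refine Tendsto.congr' ?_ tendsto_const_nhds
      filter_upwards [mem_nhdsWithin_of_mem_nhds (eventually_lt_nhds h0)] with ε hε
      have hε' : ε < |x - t| := hε
      simp [truncKernel, hε']
  refine key.congr' ?_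
  filter_upwards [self_mem_nhdsWithin] with ε hε
  exact (e ε hε).symm

/-- The points at which the truncated Hilbert transforms oscillate by more than `l`. -/
def oscSet (f : ℝ → ℝ) (l : ℝ) : Set ℝ :=
  {x | ∀ δ > 0, ∃ ε₁ ∈ Ioo 0 δ, ∃ ε₂ ∈ Ioo 0 δ, l < |truncHilbert f ε₁ x - truncHilbert f ε₂ x|}

theorem volume_oscSet {f : ℝ → ℝ} (hf : Integrable f) {l : ℝ} (hl : 0 < l) :
    volume (oscSet f l) = 0 := by
  refine le_antisymm (ENNReal.le_of_forall_pos_le_add fun η' hη' _ => ?_) bot_le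
  have hη'0 : (0 : ℝ) < η' := by exact_mod_cast hη'
  obtain ⟨g, hgc, hgs, hg⟩ := (memLp_one_iff_integrable.2 hf).exist_eLpNorm_sub_le
    ENNReal.one_ne_top le_rfl (ε := η' * l / 5760) (by positivity)
  have hgi : Integrable g := hgs.continuous.integrable_of_hasCompactSupport hgc
  obtain ⟨K, hK⟩ := hgs.lipschitzWith_of_hasCompactSupport hgc (by simp)
  have hsub : oscSet f l ⊆ {x | ∃ ε > 0, l / 4 < |truncHilbert (fun t => f t - g t) ε x|} := by
    intro x hx
    by_contra hcon
    simp only [mem_ofPred_eq, not_exists, not_and, not_lt] at hcon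
    obtain ⟨L, hL⟩ := exists_tendsto_truncHilbert_of_lipschitz hgi hK x
    have hev := hL.eventually (Metric.ball_mem_nhds L (show (0 : ℝ) < l / 4 by positivity))
    obtain ⟨δ, hδ, hδ'⟩ := (mem_nhdsGT_iff_exists_Ioo_subset).1 hev
    obtain ⟨ε₁, h₁, ε₂, h₂, h⟩ := hx δ hδ
    have a1 : |truncHilbert g ε₁ x - L| < l / 4 := hδ' h₁
    have a2 : |truncHilbert g ε₂ x - L| < l / 4 := hδ' h₂
    have b1 := hcon ε₁ h₁.1
    have b2 := hcon ε₂ h₂.1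
    rw [truncHilbert_sub hf hgi h₁.1] at b1
    rw [truncHilbert_sub hf hgi h₂.1] at b2
    rw [abs_le] at b1 b2
    rw [abs_lt] at a1 a2
    rcases lt_abs.1 h with h | h <;> linarith
  rw [zero_add]
  refine (measure_mono hsub).trans ((volume_lt_abs_truncHilbert_le (hf.sub hgi) (by positivity)).trans ?_)
  have h1 : ∫ t, |f t - g t| ≤ η' * l / 5760 := by
    have h2 := (memLp_one_iff_integrable.2 (hf.sub hgi))
    rw [eLpNorm_one_eq_lintegral_enorm] at hg
    have h3 : ENNReal.ofReal (∫ t, |f t - g t|) = ∫⁻ t, ‖(f - g) t‖ₑ :=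
      ofReal_integral_norm_eq_lintegral_enorm (hf.sub hgi)
    rw [← h3, ENNReal.ofReal_le_ofReal_iff (by positivity)] at hg
    exact hg
  refine le_trans (ENNReal.ofReal_le_ofReal (q := η') ?_) (by simp)
  rw [div_le_iff₀ (by positivity)]
  simp only [Pi.sub_apply]
  linarith

/-- Principal values of integrable functions exist almost everywhere. -/
theorem ae_exists_tendsto_truncHilbert {f : ℝ → ℝ} (hf : Integrable f) :
    ∀ᵐ x, ∃ L, Tendsto (fun ε => truncHilbert f ε x) (nhdsWithin 0 (Ioi 0)) (nhds L) := by
  have h : ∀ᵐ x, ∀ n : ℕ, x ∉ oscSet f (1 / ((n : ℝ) + 1)) :=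
    ae_all_iff.2 fun n => measure_eq_zero_iff_ae_notMem.1 (volume_oscSet hf (by positivity))
  filter_upwards [h] with x hx
  refine cauchy_map_iff_exists_tendsto.1 ?_
  rw [Metric.cauchy_iff]
  refine ⟨inferInstance, fun η hη => ?_⟩
  obtain ⟨n, hn⟩ := exists_nat_one_div_lt hη
  have hxn := hx n
  simp only [oscSet, mem_ofPred_eq] at hxn
  push Not at hxn
  obtain ⟨δ, hδ, hδ'⟩ := hxn
  refine ⟨(fun ε => truncHilbert f ε x) '' Ioo 0 δ, image_mem_map (Ioo_mem_nhdsGT hδ), ?_⟩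
  rintro _ ⟨ε₁, h₁, rfl⟩ _ ⟨ε₂, h₂, rfl⟩
  exact (hδ' ε₁ h₁ ε₂ h₂).trans_lt hn

theorem ae_tendsto_hilbertR {f : ℝ → ℝ} (hf : Integrable f) :
    ∀ᵐ x, Tendsto (fun ε => truncHilbert f ε x) (nhdsWithin 0 (Ioi 0)) (nhds (hilbertR f x)) := by
  filter_upwards [ae_exists_tendsto_truncHilbert hf] with x hx
  exact tendsto_nhds_limUnder hx

/-- The restriction of `f` to the interval `[-n, n)`. -/
def cutoff (n : ℕ) (f : ℝ → ℝ) : ℝ → ℝ := (Ico (-(n : ℝ)) n).indicator f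

theorem integrable_cutoff {f : ℝ → ℝ} (hf : Measurable f)
    (hI : Integrable fun t => f t / (1 + |t|)) (n : ℕ) : Integrable (cutoff n f) := by
  refine (hI.abs.const_mul ((n : ℝ) + 1)).mono' (hf.indicator measurableSet_Ico).aestronglyMeasurable
    (Eventually.of_forall fun t => ?_)
  by_cases h : t ∈ Ico (-(n : ℝ)) n
  · rw [cutoff, indicator_of_mem h, Real.norm_eq_abs, abs_div, abs_of_pos (show 0 < 1 + |t| by positivity),
      ← mul_div_assoc, le_div_iff₀ (by positivity), mul_comm]
    have : |t| ≤ n := abs_le.2 ⟨h.1, h.2.le⟩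
    exact mul_le_mul_of_nonneg_right (by linarith) (abs_nonneg _)
  · rw [cutoff, indicator_of_notMem h, norm_zero]; positivity

theorem tendsto_hilbertR_cutoff {f : ℝ → ℝ} (hf : Measurable f)
    (hI : Integrable fun t => f t / (1 + |t|)) :
    ∀ᵐ x, Tendsto (fun n : ℕ => hilbertR (cutoff n f) x) atTop (nhds (hilbertR f x)) := by
  filter_upwards [ae_all_iff.2 fun n => ae_tendsto_hilbertR (integrable_cutoff hf hI n)] with x hx
  set g : ℕ → ℝ → ℝ := fun n t => (Ico (-(n : ℝ)) n)ᶜ.indicator f t * (x - t)⁻¹ with hg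
  obtain ⟨N, hN⟩ := exists_nat_ge (2 * |x| + 2)
  have hgap : ∀ n ≥ N, ∀ t ∉ Ico (-(n : ℝ)) n, 1 + |t| ≤ 2 * |x - t| := by
    intro n hn t ht
    have hn' : (N : ℝ) ≤ n := by exact_mod_cast hn
    have ht' : (n : ℝ) ≤ |t| := by
      by_contra h
      rw [not_le, abs_lt] at h
      exact ht ⟨h.1.le, h.2⟩
    have := abs_sub_abs_le_abs_sub t x
    rw [abs_sub_comm] at this
    linarith
  have hgm : ∀ n, AEStronglyMeasurable (g n) volume := fun n =>
    ((hf.indicator measurableSet_Ico.compl).mul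
      (measurable_const.sub measurable_id).inv).aestronglyMeasurable
  have hgb : ∀ n ≥ N, ∀ t, ‖g n t‖ ≤ 2 * |f t / (1 + |t|)| := by
    intro n hn t
    by_cases ht : t ∈ Ico (-(n : ℝ)) n
    · simp [hg, ht]
    · have h1 := hgap n hn t ht
      have h2 : 0 < 1 + |t| := by positivity
      have h3 : 0 < |x - t| := by linarith
      simp only [hg, indicator_of_mem (mem_compl ht)]
      rw [norm_mul, norm_inv, Real.norm_eq_abs, Real.norm_eq_abs, abs_div, abs_of_pos h2,
        ← div_eq_mul_inv, div_le_iff₀ h3, mul_div_assoc', div_mul_eq_mul_div, le_div_iff₀ h2]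
      nlinarith [abs_nonneg (f t)]
  have hgi : ∀ n ≥ N, Integrable (g n) := fun n hn =>
    (hI.abs.const_mul 2).mono' (hgm n) (Eventually.of_forall (hgb n hn))
  have hsplit : ∀ n ≥ N, ∀ ε ∈ Ioo (0 : ℝ) (1 / 2), truncHilbert f ε x =
      truncHilbert (cutoff n f) ε x + ∫ t, g n t := by
    intro n hn ε hε
    rw [truncHilbert_eq, truncHilbert_eq, ← integral_add
      (integrable_mul_truncKernel (integrable_cutoff hf hI n) hε.1 x) (hgi n hn)]
    congr 1
    funext t
    by_cases ht : t ∈ Ico (-(n : ℝ)) n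
    · simp [hg, cutoff, ht]
    · have h1 := hgap n hn t ht
      have h2 : ε < |x - t| := by linarith [abs_nonneg t, hε.2]
      simp only [hg, cutoff, indicator_of_mem (mem_compl ht), indicator_of_notMem ht, zero_mul,
        zero_add]
      simp [truncKernel, h2]
  have hlim : ∀ n ≥ N, hilbertR f x = hilbertR (cutoff n f) x + ∫ t, g n t := by
    intro n hn
    have h1 := (hx n).add_const (∫ t, g n t)
    have h2 : Tendsto (fun ε => truncHilbert f ε x) (nhdsWithin 0 (Ioi 0))
        (nhds (hilbertR (cutoff n f) x + ∫ t, g n t)) := by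
      refine h1.congr' ?_
      filter_upwards [Ioo_mem_nhdsGT (show (0 : ℝ) < 1 / 2 by norm_num)] with ε hε
      exact (hsplit n hn ε hε).symm
    exact h2.limUnder_eq
  have hg0 : Tendsto (fun n => ∫ t, g n t) atTop (nhds 0) := by
    rw [← integral_zero ℝ ℝ (μ := volume)]
    refine tendsto_integral_filter_of_dominated_convergence (fun t => 2 * |f t / (1 + |t|)|)
      (Eventually.of_forall hgm) ?_ (hI.abs.const_mul 2) (Eventually.of_forall fun t => ?_)
    · filter_upwards [eventually_ge_atTop N] with n hn using Eventually.of_forall (hgb n hn)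
    · refine Tendsto.congr' ?_ tendsto_const_nhds
      obtain ⟨M, hM⟩ := exists_nat_gt |t|
      filter_upwards [eventually_ge_atTop M] with n hn
      have hn' : (M : ℝ) ≤ n := by exact_mod_cast hn
      have ht : t ∈ Ico (-(n : ℝ)) n := by
        have := abs_lt.1 (hM.trans_le hn')
        exact ⟨this.1.le, this.2⟩
      simp [hg, ht]
  have h3 : Tendsto (fun n => hilbertR f x - ∫ t, g n t) atTop (nhds (hilbertR f x)) := by
    simpa using hg0.const_sub (hilbertR f x)
  refine h3.congr' ?_
  filter_upwards [eventually_ge_atTop N] with n hn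
  rw [hlim n hn]; ring

/-- The `i`-th interval of generation `n` in the dyadic subdivision of `[a, a + ℓ)`. -/
def dyadic (a ℓ : ℝ) (n i : ℕ) : Set ℝ :=
  Ico (a + i * (ℓ / 2 ^ n)) (a + i * (ℓ / 2 ^ n) + ℓ / 2 ^ n)

theorem mem_dyadic_iff {a ℓ : ℝ} (hℓ : 0 < ℓ) {n i : ℕ} {x : ℝ} :
    x ∈ dyadic a ℓ n i ↔ a ≤ x ∧ ⌊(x - a) / ℓ * 2 ^ n⌋₊ = i := by
  have h2 : (0 : ℝ) < ℓ / 2 ^ n := by positivity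
  have e : (x - a) / ℓ * 2 ^ n = (x - a) / (ℓ / 2 ^ n) := by field_simp
  rw [e]
  constructor
  · rintro ⟨h, h'⟩
    have : (0 : ℝ) ≤ i * (ℓ / 2 ^ n) := by positivity
    have hx : a ≤ x := by linarith
    refine ⟨hx, (Nat.floor_eq_iff (div_nonneg (by linarith) h2.le)).2 ⟨?_, ?_⟩⟩
    · rw [le_div_iff₀ h2]; linarith
    · rw [div_lt_iff₀ h2]; linarith
  · rintro ⟨hx, h⟩
    obtain ⟨h1, h3⟩ := (Nat.floor_eq_iff (div_nonneg (by linarith) h2.le)).1 h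
    rw [le_div_iff₀ h2] at h1
    rw [div_lt_iff₀ h2] at h3
    exact ⟨by linarith, by linarith⟩

theorem dyadic_zero (a ℓ : ℝ) : dyadic a ℓ 0 0 = Ico a (a + ℓ) := by simp [dyadic]

theorem volume_dyadic (a ℓ : ℝ) (n i : ℕ) :
    volume (dyadic a ℓ n i) = ENNReal.ofReal (ℓ / 2 ^ n) := by
  rw [dyadic, Real.volume_Ico]; congr 1; ring

theorem measurableSet_dyadic (a ℓ : ℝ) (n i : ℕ) : MeasurableSet (dyadic a ℓ n i) :=
  measurableSet_Ico

theorem mem_dyadic_ancestor {a ℓ : ℝ} (hℓ : 0 < ℓ) {n i : ℕ} {x : ℝ} (h : x ∈ dyadic a ℓ n i)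
    {m : ℕ} (hm : m ≤ n) : x ∈ dyadic a ℓ m (i / 2 ^ (n - m)) := by
  obtain ⟨hx, rfl⟩ := (mem_dyadic_iff hℓ).1 h
  refine (mem_dyadic_iff hℓ).2 ⟨hx, ?_⟩
  rw [← Nat.floor_div_natCast]
  congr 1
  push_cast
  rw [mul_div_assoc, eq_comm]
  congr 1
  rw [div_eq_iff (by positivity), ← pow_add, Nat.add_sub_cancel' hm]

theorem dyadic_subset {a ℓ : ℝ} (hℓ : 0 < ℓ) {n i : ℕ} (hi : i < 2 ^ n) :
    dyadic a ℓ n i ⊆ Ico a (a + ℓ) := by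
  intro x hx
  have := mem_dyadic_ancestor hℓ hx (Nat.zero_le n)
  rwa [Nat.sub_zero, Nat.div_eq_of_lt hi, dyadic_zero] at this

theorem exists_mem_dyadic {a ℓ : ℝ} (hℓ : 0 < ℓ) {x : ℝ} (hx : x ∈ Ico a (a + ℓ)) (n : ℕ) :
    ∃ i < 2 ^ n, x ∈ dyadic a ℓ n i := by
  refine ⟨_, ?_, (mem_dyadic_iff hℓ).2 ⟨hx.1, rfl⟩⟩
  have h0 : 0 ≤ (x - a) / ℓ := div_nonneg (by linarith [hx.1]) hℓ.le
  have h1 : (x - a) / ℓ < 1 := by rw [div_lt_one hℓ]; linarith [hx.2]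
  rw [Nat.floor_lt (by positivity)]
  push_cast
  have : (0 : ℝ) < 2 ^ n := by positivity
  nlinarith

/-- Small dyadic intervals containing a point of an open set lie in the open set. -/
theorem exists_dyadic_subset {a ℓ : ℝ} (hℓ : 0 < ℓ) {U : Set ℝ} (hU : IsOpen U) {x : ℝ}
    (hx : x ∈ Ico a (a + ℓ)) (hxU : x ∈ U) :
    ∃ n i, i < 2 ^ n ∧ x ∈ dyadic a ℓ n i ∧ dyadic a ℓ n i ⊆ U := by
  obtain ⟨δ, hδ, hδU⟩ := Metric.isOpen_iff.1 hU x hxU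
  obtain ⟨n, hn⟩ := exists_pow_lt_of_lt_one (div_pos hδ hℓ) (show (1 / 2 : ℝ) < 1 by norm_num)
  obtain ⟨i, hi, hxi⟩ := exists_mem_dyadic hℓ hx n
  refine ⟨n, i, hi, hxi, fun y hy => hδU ?_⟩
  rw [lt_div_iff₀ hℓ, one_div, inv_pow, inv_mul_eq_div] at hn
  rw [Metric.mem_ball, Real.dist_eq, abs_lt]
  constructor <;> linarith [hy.1, hy.2, hxi.1, hxi.2]

/-- The maximal dyadic intervals satisfying `P`. -/
def stoppingSet (P : ℕ → ℕ → Prop) : Set (ℕ × ℕ) :=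
  {I | I.2 < 2 ^ I.1 ∧ P I.1 I.2 ∧ ∀ m < I.1, ¬ P m (I.2 / 2 ^ (I.1 - m))}

theorem pairwiseDisjoint_stoppingSet {a ℓ : ℝ} (hℓ : 0 < ℓ) (P : ℕ → ℕ → Prop) :
    (stoppingSet P).PairwiseDisjoint fun I => dyadic a ℓ I.1 I.2 := by
  have key : ∀ I ∈ stoppingSet P, ∀ J ∈ stoppingSet P, ∀ x, x ∈ dyadic a ℓ I.1 I.2 →
      x ∈ dyadic a ℓ J.1 J.2 → I.1 ≤ J.1 → I = J := by
    intro I hI J hJ x hxI hxJ h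
    have h1 := mem_dyadic_ancestor hℓ hxJ h
    have h2 : J.2 / 2 ^ (J.1 - I.1) = I.2 :=
      ((mem_dyadic_iff hℓ).1 h1).2.symm.trans ((mem_dyadic_iff hℓ).1 hxI).2
    rcases h.lt_or_eq with h | h
    · exact absurd (h2 ▸ hI.2.1) (hJ.2.2 _ h)
    · rw [h, Nat.sub_self, pow_zero, Nat.div_one] at h2
      exact Prod.ext h h2.symm
  intro I hI J hJ hne
  rw [Function.onFun, Set.disjoint_left]
  intro x hxI hxJ
  rcases le_total I.1 J.1 with h | h
  · exact hne (key I hI J hJ x hxI hxJ h)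
  · exact hne (key J hJ I hI x hxJ hxI h).symm

theorem exists_stopping_of_mem {a ℓ : ℝ} (hℓ : 0 < ℓ) {P : ℕ → ℕ → Prop} {n i : ℕ}
    (hi : i < 2 ^ n) (hP : P n i) {x : ℝ} (hx : x ∈ dyadic a ℓ n i) :
    ∃ I ∈ stoppingSet P, x ∈ dyadic a ℓ I.1 I.2 := by
  classical
  have hxQ := dyadic_subset hℓ hi hx
  have hex : ∃ n, ∃ i < 2 ^ n, x ∈ dyadic a ℓ n i ∧ P n i := ⟨n, i, hi, hx, hP⟩
  obtain ⟨j, hj, hxj, hPj⟩ := Nat.find_spec hex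
  refine ⟨(Nat.find hex, j), ⟨hj, hPj, fun m hm hPm => ?_⟩, hxj⟩
  refine Nat.find_min hex hm ⟨_, ?_, mem_dyadic_ancestor hℓ hxj hm.le, hPm⟩
  rw [Nat.div_lt_iff_lt_mul (by positivity), ← pow_add, Nat.add_sub_cancel' hm.le]
  exact hj

/-- The parent of a stopping interval. -/
theorem exists_parent {a ℓ : ℝ} (hℓ : 0 < ℓ) {P : ℕ → ℕ → Prop} (h0 : ¬ P 0 0) {I : ℕ × ℕ}
    (hI : I ∈ stoppingSet P) :
    ∃ m j, I.1 = m + 1 ∧ j < 2 ^ m ∧ ¬ P m j ∧ dyadic a ℓ I.1 I.2 ⊆ dyadic a ℓ m j := by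
  obtain ⟨n, i⟩ := I
  obtain ⟨hi, hP, hm⟩ := hI
  rcases n with _ | m
  · simp only [pow_zero, Nat.lt_one_iff] at hi
    simp only at hP
    exact absurd (hi ▸ hP) h0
  · have h1 := hm m (Nat.lt_succ_self m)
    simp only [Nat.add_sub_cancel_left, pow_one] at h1
    refine ⟨m, i / 2, rfl, ?_, h1, fun x hx => ?_⟩
    · simp only [pow_succ] at hi
      omega
    · have := mem_dyadic_ancestor hℓ hx (Nat.le_succ m)
      simpa using this

/-- The upper limit of the moduli of the truncated Hilbert transforms. -/
def upperHilbert (f : ℝ → ℝ) (x : ℝ) : ℝ≥0∞ :=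
  limsup (fun ε => ‖truncHilbert f ε x‖ₑ) (nhdsWithin 0 (Ioi 0))

theorem upperHilbert_eq {f : ℝ → ℝ} (hf : Integrable f) :
    ∀ᵐ x, upperHilbert f x = ‖hilbertR f x‖ₑ := by
  filter_upwards [ae_tendsto_hilbertR hf] with x hx
  exact hx.enorm.limsup_eq

theorem upperHilbert_le_of_forall {f : ℝ → ℝ} {x A : ℝ} (h : ∀ ε > 0, |truncHilbert f ε x| ≤ A) :
    upperHilbert f x ≤ ENNReal.ofReal A := by
  refine limsup_le_of_le (h := ?_)
  filter_upwards [self_mem_nhdsWithin] with ε hε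
  rw [← ofReal_norm]
  exact ENNReal.ofReal_le_ofReal (h ε hε)

/-- Localization of the Hilbert transform to `3P`, given a point of `P` at which the maximal
functions are controlled. -/
theorem upperHilbert_le_local {g : ℝ → ℝ} (hgm : Measurable g) (hg : Integrable g)
    {b m x ξ A : ℝ} (hm : 0 < m) (hA : 0 ≤ A) (hx : x ∈ Ico b (b + m)) (hξ : ξ ∈ Ico b (b + m))
    (hT : ∀ r > 0, |truncHilbert g r ξ| ≤ A)
    (hM : ∀ r > 0, ∫⁻ t in Metric.closedBall ξ r, ‖g t‖ₑ ≤ ENNReal.ofReal (A * r)) :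
    upperHilbert g x ≤
      upperHilbert ((Icc (b - m) (b + 2 * m)).indicator g) x + ENNReal.ofReal (7 * A) := by
  set T := Icc (b - m) (b + 2 * m) with hTdef
  have hTm : MeasurableSet T := measurableSet_Icc
  have hout : ∀ t ∉ T, m < |x - t| := by
    intro t ht
    rw [hTdef, mem_Icc, not_and_or, not_le, not_le] at ht
    rcases ht with h | h
    · exact lt_abs.2 (Or.inl (by linarith [hx.1]))
    · exact lt_abs.2 (Or.inr (by linarith [hx.2]))
  have hin : ∀ t ∈ T, |ξ - t| ≤ 2 * m := fun t ht =>
    abs_le.2 ⟨by linarith [ht.2, hξ.1], by linarith [ht.1, hξ.2]⟩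
  set F : ℝ → ℝ := fun t => Tᶜ.indicator g t * (x - t)⁻¹ with hF
  have hFb : ∀ t, ‖F t‖ ≤ |g t| * m⁻¹ := by
    intro t
    by_cases ht : t ∈ T
    · simp only [hF, indicator_of_notMem (notMem_compl_iff.2 ht), zero_mul, norm_zero]; positivity
    · simp only [hF, indicator_of_mem (mem_compl ht)]
      rw [norm_mul, norm_inv, Real.norm_eq_abs, Real.norm_eq_abs]
      exact mul_le_mul_of_nonneg_left (inv_anti₀ hm (hout t ht).le) (abs_nonneg _)
  have hFi : Integrable F := (hg.abs.mul_const _).mono'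
    ((hgm.indicator hTm.compl).mul (measurable_const.sub measurable_id).inv).aestronglyMeasurable
    (Eventually.of_forall hFb)
  have hsplit : ∀ ε ∈ Ioo 0 m, truncHilbert g ε x =
      truncHilbert (T.indicator g) ε x + ∫ t, F t := by
    intro ε hε
    rw [truncHilbert_eq, truncHilbert_eq, ← integral_add
      (integrable_mul_truncKernel (hg.indicator hTm) hε.1 x) hFi]
    congr 1
    funext t
    by_cases ht : t ∈ T
    · simp [hF, ht]
    · have h2 : ε < |x - t| := hε.2.trans (hout t ht)
      simp only [hF, indicator_of_mem (mem_compl ht), indicator_of_notMem ht, zero_mul, zero_add]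
      simp [truncKernel, h2]
  set μ := (volume : Measure ℝ).withDensity fun t => ‖g t‖ₑ with hμ
  have hr : (0 : ℝ) < 2 * m := by positivity
  have htail := lintegral_tail_le μ (x := ξ) (r := 2 * m) (A := A) hr hA (fun s hs => by
    rw [hμ, withDensity_apply _ Metric.isClosed_closedBall.measurableSet]; exact hM s hs)
  have hkm : Measurable fun t : ℝ => ENNReal.ofReal (2 * m / |ξ - t| ^ 2) := by fun_prop
  rw [hμ, setLIntegral_withDensity_eq_setLIntegral_mul _ hgm.enorm hkm (measurableSet_trunc _ _)] at htail
  have hball : {t | |ξ - t| ≤ 2 * m} = Metric.closedBall ξ (2 * m) := by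
    ext t; simp [Metric.mem_closedBall, Real.dist_eq, abs_sub_comm]
  have hpt : ∀ t, ‖F t - g t * truncKernel (2 * m) (ξ - t)‖ₑ ≤
      (Metric.closedBall ξ (2 * m)).indicator (fun t => ENNReal.ofReal m⁻¹ * ‖g t‖ₑ) t +
      {t | 2 * m < |ξ - t|}.indicator
        ((fun t => ‖g t‖ₑ) * fun t => ENNReal.ofReal (2 * m / |ξ - t| ^ 2)) t := by
    intro t
    by_cases h : 2 * m < |ξ - t|
    · have htT : t ∉ T := fun h' => absurd (hin t h') (not_le.2 h)
      refine le_add_left ?_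
      rw [indicator_of_mem (by exact h), Pi.mul_apply, ← ofReal_norm, ← ofReal_norm,
        ← ENNReal.ofReal_mul (norm_nonneg _)]
      refine ENNReal.ofReal_le_ofReal ?_
      have hk : truncKernel (2 * m) (ξ - t) = (ξ - t)⁻¹ := by simp [truncKernel, h]
      have h1 : |ξ - t| / 2 ≤ |x - t| := by
        have := abs_sub_abs_le_abs_sub (ξ - t) (x - t)
        rw [sub_sub_sub_cancel_right] at this
        have : |ξ - x| ≤ m := abs_le.2 ⟨by linarith [hξ.1, hx.2], by linarith [hξ.2, hx.1]⟩
        linarith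
      have h2 : |ξ - x| ≤ m := abs_le.2 ⟨by linarith [hξ.1, hx.2], by linarith [hξ.2, hx.1]⟩
      have h0 : 0 < |ξ - t| := by linarith
      have h0' : 0 < |x - t| := by linarith
      have e : F t - g t * truncKernel (2 * m) (ξ - t) =
          g t * ((ξ - x) / ((x - t) * (ξ - t))) := by
        simp only [hF, indicator_of_mem (mem_compl htT), hk]
        have := abs_pos.1 h0
        have := abs_pos.1 h0'
        field_simp
        ring
      rw [e, norm_mul, Real.norm_eq_abs, Real.norm_eq_abs]
      refine mul_le_mul_of_nonneg_left ?_ (abs_nonneg _)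
      rw [abs_div, abs_mul, div_le_div_iff₀ (by positivity) (by positivity)]
      calc |ξ - x| * |ξ - t| ^ 2 ≤ m * |ξ - t| ^ 2 := by gcongr
        _ = 2 * m * (|ξ - t| / 2 * |ξ - t|) := by ring
        _ ≤ 2 * m * (|x - t| * |ξ - t|) := by gcongr
    · refine le_add_right ?_
      have hk : truncKernel (2 * m) (ξ - t) = 0 := by simp [truncKernel, h]
      have hmem : t ∈ Metric.closedBall ξ (2 * m) := by
        rw [← hball]; exact not_lt.1 h
      rw [indicator_of_mem hmem, hk, mul_zero, sub_zero, ← ofReal_norm,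
        ← ofReal_norm, ← ENNReal.ofReal_mul (by positivity), mul_comm]
      exact ENNReal.ofReal_le_ofReal (hFb t)
  have hdiff : |(∫ t, F t) - truncHilbert g (2 * m) ξ| ≤ 6 * A := by
    rw [← ENNReal.ofReal_le_ofReal_iff (by positivity), ← Real.norm_eq_abs, ofReal_norm,
      truncHilbert_eq, ← integral_sub hFi (integrable_mul_truncKernel hg hr ξ)]
    refine (enorm_integral_le_lintegral_enorm _).trans ((lintegral_mono hpt).trans ?_)
    rw [lintegral_add_left ((hgm.enorm.const_mul _).indicator
      Metric.isClosed_closedBall.measurableSet),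
      lintegral_indicator Metric.isClosed_closedBall.measurableSet,
      lintegral_indicator (measurableSet_trunc _ _), lintegral_const_mul _ hgm.enorm]
    refine (add_le_add (mul_le_mul_right (hM _ hr) _) htail).trans ?_
    rw [← ENNReal.ofReal_mul (by positivity), ← ENNReal.ofReal_add (by positivity) (by positivity)]
    refine ENNReal.ofReal_le_ofReal (le_of_eq ?_)
    field_simp
    ring
  have hfar : |∫ t, F t| ≤ 7 * A := by
    have h1 := hT _ hr
    rw [abs_le] at *
    constructor <;> linarith [hdiff.1, hdiff.2, h1.1, h1.2]
  have hev : ∀ᶠ ε in nhdsWithin (0 : ℝ) (Ioi 0), ‖truncHilbert g ε x‖ₑ ≤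
      ‖truncHilbert (T.indicator g) ε x‖ₑ + ENNReal.ofReal (7 * A) := by
    filter_upwards [Ioo_mem_nhdsGT hm] with ε hε
    rw [hsplit ε hε]
    refine (enorm_add_le _ _).trans ?_
    gcongr
    rw [← ofReal_norm]
    exact ENNReal.ofReal_le_ofReal hfar
  refine (limsup_le_limsup hev).trans ?_
  rw [limsup_add_const (nhdsWithin (0 : ℝ) (Ioi 0)) _ _ (by isBoundedDefault) (by isBoundedDefault)]
  rfl

/-- The interval `[b, b + m)` encoded by the pair `(b, m)`. -/
def base (P : ℝ × ℝ) : Set ℝ := Ico P.1 (P.1 + P.2)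

/-- The threefold dilate of the interval encoded by `(b, m)`. -/
def triple (P : ℝ × ℝ) : Set ℝ := Icc (P.1 - P.2) (P.1 + 2 * P.2)

/-- The mass of `f` on the threefold dilate, divided by the length of the interval. -/
def mean (f : ℝ → ℝ) (P : ℝ × ℝ) : ℝ≥0∞ := (∫⁻ t in triple P, ‖f t‖ₑ) / ENNReal.ofReal P.2

theorem measurableSet_triple (P : ℝ × ℝ) : MeasurableSet (triple P) := measurableSet_Icc

theorem measurableSet_base (P : ℝ × ℝ) : MeasurableSet (base P) := measurableSet_Ico

theorem volume_base (P : ℝ × ℝ) : volume (base P) = ENNReal.ofReal P.2 := by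
  rw [base, Real.volume_Ico]; congr 1; ring

theorem triple_subset {P Q : ℝ × ℝ} (hP : 0 < P.2) (h : base P ⊆ base Q) :
    triple P ⊆ triple Q := by
  obtain ⟨h1, h2⟩ := (Ico_subset_Ico_iff (by linarith)).1 h
  exact Icc_subset_Icc (by linarith) (by linarith)

theorem exists_sparse_children {f : ℝ → ℝ} (hfm : Measurable f) (hf : Integrable f) {Q : ℝ × ℝ}
    (hQ : 0 < Q.2) :
    ∃ C : Set (ℝ × ℝ), C.Countable ∧ (∀ P ∈ C, 0 < P.2 ∧ base P ⊆ base Q) ∧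
      C.PairwiseDisjoint base ∧ 2 * volume (⋃ P ∈ C, base P) ≤ ENNReal.ofReal Q.2 ∧
      ∀ x ∈ base Q, (x ∉ ⋃ P ∈ C, base P →
        upperHilbert ((triple Q).indicator f) x ≤ ENNReal.ofReal 101500 * mean f Q) ∧
        ∀ P ∈ C, x ∈ base P → upperHilbert ((triple Q).indicator f) x ≤
          upperHilbert ((triple P).indicator f) x + ENNReal.ofReal 101500 * mean f Q := by
  obtain ⟨a, ℓ⟩ := Q
  simp only at hQ
  set g := (triple (a, ℓ)).indicator f with hg
  have hgm : Measurable g := hfm.indicator (measurableSet_triple _)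
  have hgi : Integrable g := hf.indicator (measurableSet_triple _)
  set I := ∫ t, |g t| with hI
  have hI0 : 0 ≤ I := integral_nonneg fun t => abs_nonneg _
  have hIe : ∫⁻ t, ‖g t‖ₑ = ENNReal.ofReal I :=
    (ofReal_integral_norm_eq_lintegral_enorm hgi).symm
  set A := 14500 * I / ℓ with hA
  have hA0 : 0 ≤ A := by positivity
  have hmean : ENNReal.ofReal 101500 * mean f (a, ℓ) = ENNReal.ofReal (7 * A) := by
    have : ∫⁻ t in triple (a, ℓ), ‖f t‖ₑ = ENNReal.ofReal I := by
      rw [← hIe, ← lintegral_indicator (measurableSet_triple _)]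
      congr 1; funext t
      rw [hg, enorm_indicator_eq_indicator_enorm]
    rw [mean, this, ← ENNReal.ofReal_div_of_pos hQ, ← ENNReal.ofReal_mul (by positivity)]
    congr 1; rw [hA]; ring
  rw [hmean]
  set μ := (volume : Measure ℝ).withDensity fun t => ‖g t‖ₑ with hμ
  have hμu : μ univ = ENNReal.ofReal I := by
    rw [hμ, withDensity_apply _ MeasurableSet.univ, Measure.restrict_univ, hIe]
  have : IsFiniteMeasure μ := ⟨by rw [hμu]; exact ENNReal.ofReal_lt_top⟩
  have hball : ∀ x r, μ (Metric.closedBall x r) = ∫⁻ t in Metric.closedBall x r, ‖g t‖ₑ := fun x r =>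
    withDensity_apply _ Metric.isClosed_closedBall.measurableSet
  set Ω := {x | ∃ ε > 0, A < |truncHilbert g ε x|} ∪
    {x | ∃ r > 0, ENNReal.ofReal (A * r) < μ (Metric.closedBall x r)} with hΩ
  have hΩv : volume Ω < ENNReal.ofReal (ℓ / 8) := by
    rcases hI0.eq_or_lt with h0 | h0
    · have hA' : A = 0 := by rw [hA, ← h0]; simp
      have hg0 : g =ᵐ[volume] 0 := by
        have := (integral_eq_zero_iff_of_nonneg (fun t => abs_nonneg (g t)) hgi.abs).1 h0.symm
        filter_upwards [this] with t ht using abs_eq_zero.1 ht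
      have hemp : Ω = ∅ := by
        refine eq_empty_iff_forall_notMem.2 ?_
        rintro x (⟨ε, hε, hx⟩ | ⟨r, hr, hx⟩)
        · have : truncHilbert g ε x = 0 := by
            rw [truncHilbert_eq, integral_eq_zero_of_ae]
            filter_upwards [hg0] with t ht
            simp [ht]
          rw [this, hA', abs_zero] at hx
          exact lt_irrefl _ hx
        · have : μ (Metric.closedBall x r) ≤ 0 := by
            refine (measure_mono (subset_univ _)).trans ?_
            rw [hμu, ← h0, ENNReal.ofReal_zero]
          exact absurd (hx.trans_le this) not_lt_bot
      rw [hemp, measure_empty]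
      exact ENNReal.ofReal_pos.2 (by positivity)
    · have hA1 : 0 < A := by positivity
      calc volume Ω ≤ ENNReal.ofReal (1440 * I / A) + ENNReal.ofReal (10 / A) * μ univ :=
            (measure_union_le _ _).trans (add_le_add (volume_lt_abs_truncHilbert_le hgi hA1)
              (volume_maximal_le μ hA1))
        _ = ENNReal.ofReal (1440 * I / A + 10 / A * I) := by
            rw [hμu, ← ENNReal.ofReal_mul (by positivity), ← ENNReal.ofReal_add (by positivity) (by positivity)]
        _ < _ := by
            refine (ENNReal.ofReal_lt_ofReal_iff (by positivity)).2 ?_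
            have : 1440 * I / A + 10 / A * I = ℓ / 10 := by
              rw [hA]; field_simp; norm_num
            rw [this]; linarith
  obtain ⟨U, hΩU, hUo, hUv⟩ := Ω.exists_isOpen_lt_of_lt _ hΩv
  have hgood : ∀ x ∉ U, (∀ ε > 0, |truncHilbert g ε x| ≤ A) ∧
      ∀ r > 0, ∫⁻ t in Metric.closedBall x r, ‖g t‖ₑ ≤ ENNReal.ofReal (A * r) := by
    intro x hx
    have hx' : x ∉ Ω := fun h => hx (hΩU h)
    simp only [hΩ, mem_union, mem_ofPred_eq, not_or, not_exists, not_and, not_lt, hball] at hx'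
    exact hx'
  set Pr : ℕ → ℕ → Prop := fun n i => volume (dyadic a ℓ n i) < 4 * volume (U ∩ dyadic a ℓ n i) with hPr
  have hPr0 : ¬ Pr 0 0 := by
    rw [hPr, not_lt, volume_dyadic]
    calc 4 * volume (U ∩ dyadic a ℓ 0 0) ≤ ENNReal.ofReal 4 * ENNReal.ofReal (ℓ / 8) := by
          rw [ENNReal.ofReal_ofNat]
          gcongr
          exact (measure_mono inter_subset_left).trans hUv.le
      _ = ENNReal.ofReal (4 * (ℓ / 8)) := (ENNReal.ofReal_mul (by norm_num)).symm
      _ ≤ _ := ENNReal.ofReal_le_ofReal (by rw [pow_zero]; linarith)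
  set enc : ℕ × ℕ → ℝ × ℝ := fun I => (a + I.2 * (ℓ / 2 ^ I.1), ℓ / 2 ^ I.1) with henc
  have hbase : ∀ I, base (enc I) = dyadic a ℓ I.1 I.2 := fun I => rfl
  have hdisj := pairwiseDisjoint_stoppingSet (a := a) hQ Pr
  refine ⟨enc '' stoppingSet Pr, (to_countable _).image _, ?_, ?_, ?_, ?_⟩
  · rintro _ ⟨I, hI, rfl⟩
    refine ⟨by simp only [henc]; positivity, ?_⟩
    rw [hbase]
    exact dyadic_subset hQ hI.1
  · rintro _ ⟨I, hI, rfl⟩ _ ⟨J, hJ, rfl⟩ hne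
    exact hdisj hI hJ fun h => hne (by rw [h])
  · rw [biUnion_image]
    calc 2 * volume (⋃ I ∈ stoppingSet Pr, base (enc I))
        ≤ 2 * ∑' I : stoppingSet Pr, volume (dyadic a ℓ I.1.1 I.1.2) := by
          gcongr; exact measure_biUnion_le _ (to_countable _) _
      _ ≤ 2 * ∑' I : stoppingSet Pr, 4 * volume (U ∩ dyadic a ℓ I.1.1 I.1.2) := by
          gcongr with I
          exact I.2.2.1.le
      _ = 8 * volume (⋃ I ∈ stoppingSet Pr, U ∩ dyadic a ℓ I.1 I.2) := by
          rw [ENNReal.tsum_mul_left, measure_biUnion (to_countable _)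
            (hdisj.mono fun I => inter_subset_right)
            fun I _ => hUo.measurableSet.inter (measurableSet_dyadic _ _ _ _), ← mul_assoc]
          norm_num
      _ ≤ ENNReal.ofReal 8 * ENNReal.ofReal (ℓ / 8) := by
          rw [ENNReal.ofReal_ofNat]
          gcongr
          exact (measure_mono (iUnion₂_subset fun I _ => inter_subset_left)).trans hUv.le
      _ = _ := by
          rw [← ENNReal.ofReal_mul (by norm_num)]; congr 1; ring
  · intro x hx
    constructor
    · intro hxC
      have hxU : x ∉ U := by
        intro hxU
        obtain ⟨n, i, hi, hxi, hsub⟩ := exists_dyadic_subset hQ hUo hx hxU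
        have hP : Pr n i := by
          simp only [hPr]
          rw [inter_eq_self_of_subset_right hsub, volume_dyadic]
          have h1 : 0 < ENNReal.ofReal (ℓ / 2 ^ n) := ENNReal.ofReal_pos.2 (by positivity)
          calc ENNReal.ofReal (ℓ / 2 ^ n) = 1 * ENNReal.ofReal (ℓ / 2 ^ n) := (one_mul _).symm
            _ < _ := ENNReal.mul_lt_mul_left h1.ne' ENNReal.ofReal_ne_top (by norm_num)
        obtain ⟨I, hI, hxI⟩ := exists_stopping_of_mem hQ hi hP hxi
        exact hxC (mem_biUnion (mem_image_of_mem enc hI) hxI)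
      exact (upperHilbert_le_of_forall (hgood x hxU).1).trans
        (ENNReal.ofReal_le_ofReal (by linarith))
    · rintro _ ⟨I, hI, rfl⟩ hxI
      obtain ⟨m, j, hm, hj, hnP, hsub⟩ := exists_parent hQ hPr0 hI
      have hex : ∃ ξ ∈ dyadic a ℓ I.1 I.2, ξ ∉ U := by
        by_contra hcon
        push Not at hcon
        simp only [hPr, not_lt] at hnP
        have h1 : 4 * ENNReal.ofReal (ℓ / 2 ^ I.1) ≤ 2 * ENNReal.ofReal (ℓ / 2 ^ I.1) := by
          calc 4 * ENNReal.ofReal (ℓ / 2 ^ I.1) ≤ 4 * volume (U ∩ dyadic a ℓ m j) := by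
                rw [← volume_dyadic a ℓ I.1 I.2]
                gcongr
                exact subset_inter hcon hsub
            _ ≤ volume (dyadic a ℓ m j) := hnP
            _ = ENNReal.ofReal 2 * ENNReal.ofReal (ℓ / 2 ^ I.1) := by
                rw [volume_dyadic, hm, ← ENNReal.ofReal_mul (by norm_num)]
                congr 1; rw [pow_succ]; field_simp
            _ = _ := by rw [ENNReal.ofReal_ofNat]
        have h2 : 0 < ENNReal.ofReal (ℓ / 2 ^ I.1) := ENNReal.ofReal_pos.2 (by positivity)
        exact absurd h1 (not_le.2 (ENNReal.mul_lt_mul_left h2.ne' ENNReal.ofReal_ne_top (by norm_num)))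
      obtain ⟨ξ, hξ, hξU⟩ := hex
      have hpos : 0 < (enc I).2 := by simp only [henc]; positivity
      have h := upperHilbert_le_local hgm hgi hpos hA0 (show x ∈ base (enc I) from hxI)
        (show ξ ∈ base (enc I) from hξ) (hgood ξ hξU).1 (hgood ξ hξU).2
      have hind : (Icc ((enc I).1 - (enc I).2) ((enc I).1 + 2 * (enc I).2)).indicator g =
          (triple (enc I)).indicator f := by
        rw [hg, indicator_indicator, triple]
        congr 1
        exact inter_eq_self_of_subset_left (triple_subset (Q := (a, ℓ)) hpos (dyadic_subset hQ hI.1))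
      rwa [hind] at h

/-- The generations of a family produced by iterating the children map `C` from `Q`. -/
def generation (C : ℝ × ℝ → Set (ℝ × ℝ)) (Q : ℝ × ℝ) : ℕ → Set (ℝ × ℝ)
  | 0 => {Q}
  | k + 1 => ⋃ P ∈ generation C Q k, C P

theorem exists_sparse {f : ℝ → ℝ} (hfm : Measurable f) (hf : Integrable f) {Q : ℝ × ℝ}
    (hQ : 0 < Q.2) :
    ∃ (S : Set (ℕ × ℝ × ℝ)) (E : ℕ × ℝ × ℝ → Set ℝ), S.Countable ∧
      (∀ s ∈ S, 0 < s.2.2 ∧ MeasurableSet (E s) ∧ E s ⊆ base s.2 ∧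
        ENNReal.ofReal s.2.2 ≤ 2 * volume (E s)) ∧ S.PairwiseDisjoint E ∧
      ∀ᵐ x, x ∈ base Q → ∃ F : Finset (ℕ × ℝ × ℝ), (∀ s ∈ F, s ∈ S ∧ x ∈ base s.2) ∧
        upperHilbert ((triple Q).indicator f) x ≤
          ENNReal.ofReal 101500 * ∑ s ∈ F, mean f s.2 := by
  classical
  choose! C hCc hCb hCd hCv hCx using
    fun (R : ℝ × ℝ) (hR : 0 < R.2) => exists_sparse_children hfm hf hR
  set G := generation C Q with hG
  have hpos : ∀ k, ∀ P ∈ G k, 0 < P.2 := by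
    intro k
    induction k with
    | zero => intro P hP; rw [show P = Q from hP]; exact hQ
    | succ k ih =>
      intro P hP
      obtain ⟨R, hR, hPR⟩ := mem_iUnion₂.1 hP
      exact (hCb R (ih R hR) P hPR).1
  have hcount : ∀ k, (G k).Countable := by
    intro k
    induction k with
    | zero => exact countable_singleton _
    | succ k ih => exact ih.biUnion fun R hR => hCc R (hpos k R hR)
  have hne : ∀ P : ℝ × ℝ, 0 < P.2 → (base P).Nonempty := fun P hP =>
    ⟨P.1, by simp [base, hP]⟩
  have hdisj : ∀ k, (G k).PairwiseDisjoint base := by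
    intro k
    induction k with
    | zero => exact pairwiseDisjoint_singleton _ _
    | succ k ih =>
      intro P hP P' hP' hPP
      obtain ⟨R, hR, hPR⟩ := mem_iUnion₂.1 hP
      obtain ⟨R', hR', hPR'⟩ := mem_iUnion₂.1 hP'
      by_cases h : R = R'
      · subst h
        exact hCd R (hpos k R hR) hPR hPR' hPP
      · exact (ih hR hR' h).mono (hCb R (hpos k R hR) P hPR).2 (hCb R' (hpos k R' hR') P' hPR').2
  set U : ℕ → Set ℝ := fun k => ⋃ P ∈ G k, base P with hU
  have hUm : ∀ k, MeasurableSet (U k) := fun k =>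
    MeasurableSet.biUnion (hcount k) fun P _ => measurableSet_base P
  have hanti : ∀ k, U (k + 1) ⊆ U k := by
    intro k x hx
    obtain ⟨P, hP, hxP⟩ := mem_iUnion₂.1 hx
    obtain ⟨R, hR, hPR⟩ := mem_iUnion₂.1 hP
    exact mem_iUnion₂.2 ⟨R, hR, (hCb R (hpos k R hR) P hPR).2 hxP⟩
  have hUanti : Antitone U := antitone_nat_of_succ_le hanti
  have hloc : ∀ k, ∀ P ∈ G k, base P ∩ U (k + 1) ⊆ ⋃ P' ∈ C P, base P' := by
    rintro k P hP x ⟨hx, hxU⟩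
    obtain ⟨P', hP', hxP'⟩ := mem_iUnion₂.1 hxU
    obtain ⟨R, hR, hPR⟩ := mem_iUnion₂.1 hP'
    have : P = R := by
      by_contra h
      exact disjoint_left.1 (hdisj k hP hR h) hx ((hCb R (hpos k R hR) P' hPR).2 hxP')
    subst this
    exact mem_iUnion₂.2 ⟨P', hPR, hxP'⟩
  have hhalf : ∀ k, ∀ P ∈ G k, 2 * volume (base P ∩ U (k + 1)) ≤ volume (base P) := by
    intro k P hP
    rw [volume_base]
    exact (mul_le_mul_right (measure_mono (hloc k P hP)) 2).trans (hCv P (hpos k P hP))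
  have hUhalf : ∀ k, 2 * volume (U (k + 1)) ≤ volume (U k) := by
    intro k
    have h1 : U (k + 1) = ⋃ P ∈ G k, (base P ∩ U (k + 1)) := by
      rw [← iUnion₂_inter]
      exact (inter_eq_right.2 (hanti k)).symm
    rw [h1, measure_biUnion (hcount k) (fun P hP P' hP' h => (hdisj k hP hP' h).mono
      inter_subset_left inter_subset_left) fun P _ => (measurableSet_base P).inter (hUm _),
      hU, measure_biUnion (hcount k) (hdisj k) fun P _ => measurableSet_base P,
      ← ENNReal.tsum_mul_left]
    exact ENNReal.tsum_le_tsum fun P => hhalf k P P.2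
  have hUk : ∀ k, volume (U k) ≤ (2⁻¹ : ℝ≥0∞) ^ k * ENNReal.ofReal Q.2 := by
    intro k
    induction k with
    | zero => 
      have : U 0 = base Q := by
        have : G 0 = {Q} := rfl
        simp [hU, this]
      simp [this, volume_base]
    | succ k ih =>
      have h2 : volume (U (k + 1)) ≤ 2⁻¹ * volume (U k) := by
        rw [mul_comm, ← div_eq_mul_inv, ENNReal.le_div_iff_mul_le (by simp) (by simp), mul_comm]
        exact hUhalf k
      calc _ ≤ _ := h2
        _ ≤ 2⁻¹ * ((2⁻¹ : ℝ≥0∞) ^ k * ENNReal.ofReal Q.2) := by gcongr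
        _ = _ := by ring
  have hnull : volume (⋂ k, U k) = 0 := by
    have h3 : Tendsto (fun k => (2⁻¹ : ℝ≥0∞) ^ k * ENNReal.ofReal Q.2) atTop (nhds 0) := by
      have := ENNReal.Tendsto.mul_const (b := ENNReal.ofReal Q.2)
        (ENNReal.tendsto_pow_atTop_nhds_zero_of_lt_one (r := 2⁻¹) (by simp)) (Or.inr (by simp))
      simpa using this
    refine le_antisymm (ge_of_tendsto' h3 fun k => ?_) zero_le
    exact (measure_mono (iInter_subset _ k)).trans (hUk k)
  have hmain : ∀ x, ∀ n j P, P ∈ G j → x ∈ base P → x ∉ U (j + n + 1) →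
      ∃ F : Finset (ℕ × ℝ × ℝ), (∀ s ∈ F, s.2 ∈ G s.1 ∧ x ∈ base s.2 ∧ j ≤ s.1) ∧
        upperHilbert ((triple P).indicator f) x ≤
          ENNReal.ofReal 101500 * ∑ s ∈ F, mean f s.2 := by
    intro x n
    have hbase : ∀ j P, P ∈ G j → x ∈ base P → x ∉ U (j + 1) → 
      ∃ F : Finset (ℕ × ℝ × ℝ), (∀ s ∈ F, s.2 ∈ G s.1 ∧ x ∈ base s.2 ∧ j ≤ s.1) ∧
        upperHilbert ((triple P).indicator f) x ≤
          ENNReal.ofReal 101500 * ∑ s ∈ F, mean f s.2 := by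
      intro j P hP hx hxU
      refine ⟨{(j, P)}, by simp [hP, hx], ?_⟩
      rw [Finset.sum_singleton]
      refine (hCx P (hpos j P hP) x hx).1 fun h => hxU ?_
      obtain ⟨P', hP', hxP'⟩ := mem_iUnion₂.1 h
      exact mem_iUnion₂.2 ⟨P', mem_iUnion₂.2 ⟨P, hP, hP'⟩, hxP'⟩
    induction n with
    | zero => exact hbase
    | succ n ih =>
      intro j P hP hx hxU
      by_cases h : x ∈ ⋃ P' ∈ C P, base P'
      · obtain ⟨P', hP', hxP'⟩ := mem_iUnion₂.1 h
        have hP'G : P' ∈ G (j + 1) := mem_iUnion₂.2 ⟨P, hP, hP'⟩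
        obtain ⟨F, hF, hFx⟩ := ih (j + 1) P' hP'G hxP' (by rwa [show j + 1 + n + 1 = j + (n + 1) + 1 by ring])
        have hnot : (j, P) ∉ F := fun hh => by have := (hF _ hh).2.2; simp at this
        refine ⟨insert (j, P) F, ?_, ?_⟩
        · intro s hs
          rcases Finset.mem_insert.1 hs with rfl | hs
          · exact ⟨hP, hx, le_rfl⟩
          · obtain ⟨a, b, c⟩ := hF s hs
            exact ⟨a, b, by omega⟩
        · rw [Finset.sum_insert hnot, mul_add, add_comm]
          exact ((hCx P (hpos j P hP) x hx).2 P' hP' hxP').trans (by gcongr)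
      · refine hbase j P hP hx fun hh => h (hloc j P hP ⟨hx, hh⟩)
  refine ⟨{s | s.2 ∈ G s.1}, fun s => base s.2 \ U (s.1 + 1), ?_, ?_, ?_, ?_⟩
  · have : {s : ℕ × ℝ × ℝ | s.2 ∈ G s.1} = ⋃ k, (fun P => (k, P)) '' G k := by
      ext ⟨k, P⟩; simp
    rw [this]
    exact countable_iUnion fun k => (hcount k).image _
  · intro s hs
    refine ⟨hpos _ _ hs, (measurableSet_base _).diff (hUm _), sdiff_subset, ?_⟩
    have h4 := hhalf s.1 s.2 hs
    have h5 := measure_inter_add_sdiff (μ := volume) (base s.2) (hUm (s.1 + 1))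
    have hfin : volume (base s.2 ∩ U (s.1 + 1)) ≠ ∞ := ne_top_of_le_ne_top
      (by rw [volume_base]; exact ENNReal.ofReal_ne_top) (measure_mono inter_subset_left)
    rw [← volume_base]
    rw [← h5, two_mul] at h4
    rw [← h5, two_mul]
    exact add_le_add_left ((ENNReal.add_le_add_iff_left hfin).1 h4) _
  · rintro ⟨k, P⟩ hs ⟨k', P'⟩ hs' hne'
    rcases lt_trichotomy k k' with h | rfl | h
    · refine disjoint_left.2 fun x hx hx' => hx.2 (hUanti (show k + 1 ≤ k' from h) ?_)
      exact mem_iUnion₂.2 ⟨P', hs', hx'.1⟩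
    · exact (hdisj k hs hs' fun hh => hne' (Prod.ext rfl hh)).mono sdiff_subset sdiff_subset
    · refine disjoint_left.2 fun x hx hx' => hx'.2 (hUanti (show k' + 1 ≤ k from h) ?_)
      exact mem_iUnion₂.2 ⟨P, hs, hx.1⟩
  · filter_upwards [compl_mem_ae_iff.2 hnull] with x hx hxQ
    obtain ⟨n, hn⟩ := not_forall.1 fun h => hx (mem_iInter.2 h)
    have hn1 : x ∉ U (0 + n + 1) := fun h => by
      have := hUanti (show n ≤ 0 + n + 1 by omega) h
      exact hn this
    obtain ⟨F, hF, hFx⟩ := hmain x n 0 Q rfl hxQ hn1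
    exact ⟨F, fun s hs => ⟨(hF s hs).1, (hF s hs).2.1⟩, hFx⟩

/-- Measures that are positive and finite on intervals and satisfy a power-type `A_∞` condition. -/
structure IsAInfty (μ : Measure ℝ) : Prop where
  ac : μ ≪ volume
  pos : ∀ a b, a < b → 0 < μ (Icc a b)
  fin : ∀ a b, μ (Icc a b) < ∞
  ineq : ∃ C : ℝ≥0∞, C ≠ ∞ ∧ ∃ n : ℕ, ∀ a b, a < b → ∀ A ⊆ Icc a b, MeasurableSet A →
    volume A ^ n * μ (Icc a b) ≤ C * volume (Icc a b) ^ n * μ A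

theorem aemeasurable_of_isWeight {w : ℝ → ℝ} (hw : IsWeight w) : AEMeasurable w :=
  hw.1.aestronglyMeasurable.aemeasurable

theorem wMeasure_ac (w : ℝ → ℝ) : wMeasure w ≪ volume := withDensity_absolutelyContinuous _ _

theorem wMeasure_pos_of_ae_pos {w : ℝ → ℝ} (hwm : AEMeasurable w) (hw : ∀ᵐ x, 0 < w x)
    {A : Set ℝ} (hA : 0 < volume A) : 0 < wMeasure w A := by
  refine pos_iff_ne_zero.2 fun h => hA.ne' ?_
  have h1 : volume ≪ wMeasure w := by
    refine withDensity_absolutelyContinuous' ?_ ?_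
    · exact hwm.ennreal_ofReal
    · filter_upwards [hw] with x hx
      simpa using hx
  exact h1 h

theorem wMeasure_pos {w : ℝ → ℝ} (hw : IsWeight w) {A : Set ℝ} (hA : 0 < volume A) :
    0 < wMeasure w A :=
  wMeasure_pos_of_ae_pos (aemeasurable_of_isWeight hw) hw.2 hA

theorem wMeasure_Icc_lt_top {w : ℝ → ℝ} (hw : IsWeight w) (a b : ℝ) :
    wMeasure w (Icc a b) < ∞ := by
  rw [wMeasure, withDensity_apply _ measurableSet_Icc]
  have h := (hw.1.integrableOn_isCompact (isCompact_Icc (a := a) (b := b))).hasFiniteIntegral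
  refine lt_of_le_of_lt (lintegral_mono fun x => ?_) h
  exact Real.ofReal_le_enorm _

theorem volume_mul_le_of_restricted {q : ℝ} (hq : 1 ≤ q) {w : ℝ → ℝ} (hw : IsWeight w)
    {a b : ℝ} (hab : a < b) {A : Set ℝ} (hA : A ⊆ Icc a b) (hAm : MeasurableSet A) :
    volume A * wMeasure w (Icc a b) ^ (1 / q) ≤
      AqRConstR q w * volume (Icc a b) * wMeasure w A ^ (1 / q) := by
  rcases eq_or_ne (volume A) 0 with h0 | h0
  · simp [h0]
  have hA0 : 0 < volume A := pos_iff_ne_zero.2 h0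
  have hw0 := wMeasure_pos hw hA0
  have hwf : wMeasure w A < ∞ := (measure_mono hA).trans_lt (wMeasure_Icc_lt_top hw a b)
  have hC : volume A / volume (Icc a b) * (wMeasure w (Icc a b) / wMeasure w A) ^ (1 / q) ≤
      AqRConstR q w := by
    unfold AqRConstR
    exact le_iSup_of_le a <| le_iSup_of_le b <| le_iSup_of_le hab <| le_iSup_of_le A <|
      le_iSup_of_le hAm <| le_iSup_of_le hA <| le_iSup_of_le hA0 le_rfl
  have hq0 : 0 ≤ 1 / q := by positivity
  rw [ENNReal.div_rpow_of_nonneg _ _ hq0, ← ENNReal.mul_div_mul_comm 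
    (Or.inr (ENNReal.rpow_ne_top_of_nonneg hq0 hwf.ne)) (Or.inr (ENNReal.rpow_pos hw0 hwf.ne).ne'),
    ENNReal.div_le_iff_le_mul] at hC
  · rwa [mul_assoc]
  · left
    refine mul_ne_zero ?_ (ENNReal.rpow_pos hw0 hwf.ne).ne'
    simp [Real.volume_Icc, hab]
  · left
    refine ENNReal.mul_ne_top (by simp [Real.volume_Icc]) (ENNReal.rpow_ne_top_of_nonneg hq0 hwf.ne)

theorem isAInfty_of_restricted {q : ℝ} (hq : 1 ≤ q) {w : ℝ → ℝ} (hw : IsWeight w)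
    (hR : AqRConstR q w < ⊤) : IsAInfty (wMeasure w) where
  ac := wMeasure_ac w
  pos a b hab := wMeasure_pos hw (by simp [Real.volume_Icc, hab])
  fin := wMeasure_Icc_lt_top hw
  ineq := by
    refine ⟨AqRConstR q w ^ q, ENNReal.rpow_ne_top_of_nonneg (by linarith) hR.ne, ⌈q⌉₊, ?_⟩
    intro a b hab A hA hAm
    have h := volume_mul_le_of_restricted hq hw hab hA hAm
    have hq0 : 0 ≤ q := by linarith
    have hqn : q ≠ 0 := by linarith
    have h1 := ENNReal.rpow_le_rpow h hq0
    simp only [ENNReal.mul_rpow_of_nonneg _ _ hq0, ← ENNReal.rpow_mul, one_div,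
      inv_mul_cancel₀ hqn, ENNReal.rpow_one] at h1
    have hle : volume A ≤ volume (Icc a b) := measure_mono hA
    have hr : 0 ≤ (⌈q⌉₊ : ℝ) - q := by linarith [Nat.le_ceil q]
    have hsplit : ∀ z : ℝ≥0∞, z ^ ⌈q⌉₊ = z ^ ((⌈q⌉₊ : ℝ) - q) * z ^ q := fun z => by
      rw [← ENNReal.rpow_add_of_nonneg _ _ hr hq0, sub_add_cancel, ENNReal.rpow_natCast]
    rw [hsplit, hsplit]
    calc _ = volume A ^ ((⌈q⌉₊ : ℝ) - q) * (volume A ^ q * wMeasure w (Icc a b)) := by ring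
      _ ≤ volume (Icc a b) ^ ((⌈q⌉₊ : ℝ) - q) *
          (AqRConstR q w ^ q * volume (Icc a b) ^ q * wMeasure w A) := by gcongr
      _ = _ := by ring

theorem wMeasure_mul_rpow_le {θ : ℝ} (h0 : 0 ≤ θ) (h1 : θ ≤ 1) {w1 w2 : ℝ → ℝ}
    (hw1 : IsWeight w1) (hw2 : IsWeight w2) {A : Set ℝ} (hA : MeasurableSet A) :
    wMeasure (fun x => w1 x ^ θ * w2 x ^ (1 - θ)) A ≤
      wMeasure w1 A ^ θ * wMeasure w2 A ^ (1 - θ) := by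
  rw [wMeasure, wMeasure, wMeasure, withDensity_apply _ hA, withDensity_apply _ hA,
    withDensity_apply _ hA]
  refine le_trans (le_of_eq ?_) (ENNReal.lintegral_mul_norm_pow_le
    (aemeasurable_of_isWeight hw1).ennreal_ofReal.restrict
    (aemeasurable_of_isWeight hw2).ennreal_ofReal.restrict h0 (by linarith) (by ring))
  refine lintegral_congr_ae (ae_restrict_of_ae ?_)
  filter_upwards [hw1.2, hw2.2] with x h1x h2x
  rw [ENNReal.ofReal_mul (by positivity), ENNReal.ofReal_rpow_of_pos h1x,
    ENNReal.ofReal_rpow_of_pos h2x]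

theorem volume_lt_average_le {w : ℝ → ℝ} (hw : IsWeight w) {C : ℝ} {n : ℕ}
    (hn : n ≠ 0) {a b : ℝ} (hab : a < b)
    (h : ∀ A ⊆ Icc a b, MeasurableSet A → volume A ^ n * wMeasure w (Icc a b) ≤
      ENNReal.ofReal C * volume (Icc a b) ^ n * wMeasure w A) (hC : 0 < C)
    {A : Set ℝ} (hA : A ⊆ Icc a b) (hAm : MeasurableSet A) {v : ℝ} (hv : 0 ≤ v) :
    ∃ F ⊆ A, MeasurableSet F ∧ volume F ≤ ENNReal.ofReal (v / 4) ∧ ∀ᵐ x, x ∈ A → x ∉ F →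
      (v / (4 * (b - a))) ^ n / C * ((wMeasure w (Icc a b)).toReal / (b - a)) ≤ w x := by
  have hwm := aemeasurable_of_isWeight hw
  set M := (wMeasure w (Icc a b)).toReal with hM
  have hMe : wMeasure w (Icc a b) = ENNReal.ofReal M :=
    (ENNReal.ofReal_toReal (wMeasure_Icc_lt_top hw a b).ne).symm
  have hMpos : 0 < M := ENNReal.toReal_pos
    (wMeasure_pos hw (by simp [Real.volume_Icc, hab])).ne' (wMeasure_Icc_lt_top hw a b).ne
  set V := b - a with hV
  have hVpos : 0 < V := sub_pos.2 hab
  set s := (v / (4 * V)) ^ n / C with hs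
  have hs0 : 0 ≤ s := by positivity
  set F := A ∩ {x | hwm.mk w x < s * (M / V)} with hF
  have hFm : MeasurableSet F := hAm.inter (measurableSet_lt hwm.measurable_mk measurable_const)
  refine ⟨F, inter_subset_left, hFm, ?_, ?_⟩
  · have hFA : F ⊆ Icc a b := inter_subset_left.trans hA
    have hFV : volume F ≤ ENNReal.ofReal V := by
      rw [← Real.volume_Icc]; exact measure_mono hFA
    have hwF : wMeasure w F ≤ ENNReal.ofReal (s * (M / V)) * volume F := by
      rw [wMeasure, withDensity_apply _ hFm, ← setLIntegral_const]
      refine setLIntegral_mono_ae' hFm ?_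
      filter_upwards [hwm.ae_eq_mk] with x hx hxF
      rw [hx]; exact ENNReal.ofReal_le_ofReal hxF.2.le
    set φ := (volume F).toReal with hφ
    have hφe : volume F = ENNReal.ofReal φ :=
      (ENNReal.ofReal_toReal (hFV.trans_lt ENNReal.ofReal_lt_top).ne).symm
    have hφ0 : 0 ≤ φ := ENNReal.toReal_nonneg
    have hφV : φ ≤ V := by
      rw [hφe] at hFV; exact (ENNReal.ofReal_le_ofReal_iff hVpos.le).1 hFV
    have h1 := (h F hFA hFm).trans (mul_le_mul_right hwF _)
    rw [hMe, Real.volume_Icc, hφe, ← ENNReal.ofReal_pow hφ0, ← ENNReal.ofReal_pow hVpos.le,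
      ← ENNReal.ofReal_mul (by positivity), ← ENNReal.ofReal_mul (by positivity),
      ← ENNReal.ofReal_mul (by positivity), ← ENNReal.ofReal_mul (by positivity),
      ENNReal.ofReal_le_ofReal_iff (by positivity)] at h1
    rw [hφe]
    refine ENNReal.ofReal_le_ofReal ?_
    refine le_of_pow_le_pow_left₀ hn (by positivity) ?_
    have h2 : C * V ^ n * (s * (M / V) * φ) ≤ (v / 4) ^ n * M := by
      have h3 : C * V ^ n * s = (v / 4) ^ n := by
        rw [hs, div_pow, div_pow, mul_pow]; field_simp
      calc _ = (C * V ^ n * s) * M * (φ / V) := by ring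
        _ ≤ (C * V ^ n * s) * M * 1 := by
          gcongr
          exact (div_le_one hVpos).2 hφV
        _ = _ := by rw [h3]; ring
    exact le_of_mul_le_mul_right (h1.trans h2) hMpos
  · filter_upwards [hwm.ae_eq_mk] with x hx hxA hxF
    rw [hx]
    by_contra hlt
    exact hxF ⟨hxA, not_le.1 hlt⟩

theorem IsAInfty.exists_common {μ ν : Measure ℝ} (hμ : IsAInfty μ) (hν : IsAInfty ν) :
    ∃ C : ℝ, 0 < C ∧ ∃ n : ℕ, n ≠ 0 ∧ ∀ a b, a < b → ∀ A ⊆ Icc a b, MeasurableSet A →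
      volume A ^ n * μ (Icc a b) ≤ ENNReal.ofReal C * volume (Icc a b) ^ n * μ A ∧
      volume A ^ n * ν (Icc a b) ≤ ENNReal.ofReal C * volume (Icc a b) ^ n * ν A := by
  obtain ⟨C, hC, n, h⟩ := hμ.ineq
  obtain ⟨D, hD, m, h'⟩ := hν.ineq
  refine ⟨C.toReal + D.toReal + 1, by positivity, n + m + 1, by positivity, ?_⟩
  intro a b hab A hA hAm
  have hle : volume A ≤ volume (Icc a b) := measure_mono hA
  have hCC : C ≤ ENNReal.ofReal (C.toReal + D.toReal + 1) := by
    conv_lhs => rw [← ENNReal.ofReal_toReal hC]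
    exact ENNReal.ofReal_le_ofReal (by linarith [D.toReal_nonneg])
  have hDD : D ≤ ENNReal.ofReal (C.toReal + D.toReal + 1) := by
    conv_lhs => rw [← ENNReal.ofReal_toReal hD]
    exact ENNReal.ofReal_le_ofReal (by linarith [C.toReal_nonneg])
  constructor
  · calc _ = volume A ^ (m + 1) * (volume A ^ n * μ (Icc a b)) := by ring
      _ ≤ volume (Icc a b) ^ (m + 1) * (C * volume (Icc a b) ^ n * μ A) :=
        mul_le_mul' (pow_le_pow_left' hle _) (h a b hab A hA hAm)
      _ = C * volume (Icc a b) ^ (n + m + 1) * μ A := by ring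
      _ ≤ _ := by gcongr
  · calc _ = volume A ^ (n + 1) * (volume A ^ m * ν (Icc a b)) := by ring
      _ ≤ volume (Icc a b) ^ (n + 1) * (D * volume (Icc a b) ^ m * ν A) :=
        mul_le_mul' (pow_le_pow_left' hle _) (h' a b hab A hA hAm)
      _ = D * volume (Icc a b) ^ (n + m + 1) * ν A := by ring
      _ ≤ _ := by gcongr

theorem isAInfty_mul_rpow {θ : ℝ} (h0 : 0 ≤ θ) (h1 : θ ≤ 1) {w1 w2 : ℝ → ℝ}
    (hw1 : IsWeight w1) (hw2 : IsWeight w2) (hA1 : IsAInfty (wMeasure w1))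
    (hA2 : IsAInfty (wMeasure w2)) :
    IsAInfty (wMeasure fun x => w1 x ^ θ * w2 x ^ (1 - θ)) := by
  have hwm : AEMeasurable fun x => w1 x ^ θ * w2 x ^ (1 - θ) :=
    ((aemeasurable_of_isWeight hw1).pow_const _).mul ((aemeasurable_of_isWeight hw2).pow_const _)
  have hwp : ∀ᵐ x, 0 < w1 x ^ θ * w2 x ^ (1 - θ) := by
    filter_upwards [hw1.2, hw2.2] with x h1x h2x
    positivity
  refine ⟨wMeasure_ac _, fun a b hab => wMeasure_pos_of_ae_pos hwm hwp
    (by simp [Real.volume_Icc, hab]), fun a b => ?_, ?_⟩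
  · refine (wMeasure_mul_rpow_le h0 h1 hw1 hw2 measurableSet_Icc).trans_lt ?_
    exact ENNReal.mul_lt_top
      (ENNReal.rpow_lt_top_of_nonneg h0 (wMeasure_Icc_lt_top hw1 a b).ne)
      (ENNReal.rpow_lt_top_of_nonneg (by linarith) (wMeasure_Icc_lt_top hw2 a b).ne)
  obtain ⟨C, hC, n, hn, h⟩ := hA1.exists_common hA2
  refine ⟨ENNReal.ofReal (2 * 4 ^ n * C), ENNReal.ofReal_ne_top, n + 1, ?_⟩
  intro a b hab A hA hAm
  set V := b - a with hV
  have hVpos : 0 < V := sub_pos.2 hab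
  have hVe : volume (Icc a b) = ENNReal.ofReal V := Real.volume_Icc
  set v := (volume A).toReal with hv
  have hve : volume A = ENNReal.ofReal v := (ENNReal.ofReal_toReal
    ((measure_mono hA).trans_lt (by rw [hVe]; exact ENNReal.ofReal_lt_top)).ne).symm
  have hv0 : 0 ≤ v := ENNReal.toReal_nonneg
  obtain ⟨F1, hF1A, hF1m, hF1v, hF1⟩ := volume_lt_average_le hw1 hn hab
    (fun A hA hAm => (h a b hab A hA hAm).1) hC hA hAm hv0
  obtain ⟨F2, hF2A, hF2m, hF2v, hF2⟩ := volume_lt_average_le hw2 hn hab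
    (fun A hA hAm => (h a b hab A hA hAm).2) hC hA hAm hv0
  rw [← hV] at hF1 hF2
  set M1 := (wMeasure w1 (Icc a b)).toReal with hM1
  set M2 := (wMeasure w2 (Icc a b)).toReal with hM2
  have hM1p : 0 ≤ M1 := ENNReal.toReal_nonneg
  have hM2p : 0 ≤ M2 := ENNReal.toReal_nonneg
  set s := (v / (4 * V)) ^ n / C with hs
  have hs0 : 0 ≤ s := by positivity
  have h10 : 0 ≤ 1 - θ := by linarith
  have hG : ENNReal.ofReal (v / 2) ≤ volume (A \ (F1 ∪ F2)) := by
    have := le_measure_sdiff (μ := volume) (s₁ := A) (s₂ := F1 ∪ F2)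
    refine le_trans ?_ this
    have h3 : volume (F1 ∪ F2) ≤ ENNReal.ofReal (v / 2) := by
      refine (measure_union_le _ _).trans ((add_le_add hF1v hF2v).trans ?_)
      rw [← ENNReal.ofReal_add (by positivity) (by positivity)]
      exact ENNReal.ofReal_le_ofReal (by linarith)
    refine le_trans ?_ (tsub_le_tsub_left h3 _)
    rw [hve, ← ENNReal.ofReal_sub _ (by positivity)]
    exact ENNReal.ofReal_le_ofReal (by linarith)
  have hlow : ENNReal.ofReal (s * (M1 / V) ^ θ * (M2 / V) ^ (1 - θ)) * ENNReal.ofReal (v / 2) ≤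
      wMeasure (fun x => w1 x ^ θ * w2 x ^ (1 - θ)) A := by
    have hGm : MeasurableSet (A \ (F1 ∪ F2)) := hAm.diff (hF1m.union hF2m)
    refine le_trans ?_ (measure_mono (sdiff_subset (s := A) (t := F1 ∪ F2)))
    refine (mul_le_mul_right hG _).trans ?_
    rw [wMeasure, withDensity_apply _ hGm, ← setLIntegral_const]
    refine setLIntegral_mono_ae' hGm ?_
    filter_upwards [hF1, hF2] with x h1x h2x hx
    refine ENNReal.ofReal_le_ofReal ?_
    have e1 := Real.rpow_le_rpow (by positivity) (h1x hx.1 fun hh => hx.2 (Or.inl hh)) h0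
    have e2 := Real.rpow_le_rpow (by positivity) (h2x hx.1 fun hh => hx.2 (Or.inr hh)) h10
    refine le_trans (le_of_eq ?_) (mul_le_mul e1 e2 (by positivity) (le_trans (by positivity) e1))
    rw [Real.mul_rpow hs0 (by positivity), Real.mul_rpow hs0 (by positivity)]
    have : s ^ θ * s ^ (1 - θ) = s := by
      rw [← Real.rpow_add_of_nonneg hs0 h0 h10]; simp
    calc _ = (s ^ θ * s ^ (1 - θ)) * (M1 / V) ^ θ * (M2 / V) ^ (1 - θ) := by rw [this]
      _ = _ := by ring
  have hup : wMeasure (fun x => w1 x ^ θ * w2 x ^ (1 - θ)) (Icc a b) ≤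
      ENNReal.ofReal (V * ((M1 / V) ^ θ * (M2 / V) ^ (1 - θ))) := by
    refine (wMeasure_mul_rpow_le h0 h1 hw1 hw2 measurableSet_Icc).trans (le_of_eq ?_)
    rw [← ENNReal.ofReal_toReal (wMeasure_Icc_lt_top hw1 a b).ne,
      ← ENNReal.ofReal_toReal (wMeasure_Icc_lt_top hw2 a b).ne,
      ENNReal.ofReal_rpow_of_nonneg hM1p h0, ENNReal.ofReal_rpow_of_nonneg hM2p h10,
      ← ENNReal.ofReal_mul (by positivity)]
    congr 1
    rw [Real.div_rpow hM1p hVpos.le, Real.div_rpow hM2p hVpos.le]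
    have : V ^ θ * V ^ (1 - θ) = V := by
      rw [← Real.rpow_add hVpos]; simp
    have hp1 : 0 < V ^ θ := by positivity
    have hp2 : 0 < V ^ (1 - θ) := by positivity
    rw [div_mul_div_comm, this]
    field_simp
  rw [hVe, hve, ← ENNReal.ofReal_pow hv0, ← ENNReal.ofReal_pow hVpos.le,
    ← ENNReal.ofReal_mul (by positivity)]
  refine (mul_le_mul_right hup _).trans ?_
  refine le_trans (le_of_eq ?_) (mul_le_mul_right hlow _)
  rw [← ENNReal.ofReal_mul (by positivity), ← ENNReal.ofReal_mul (by positivity),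
    ← ENNReal.ofReal_mul (by positivity)]
  congr 1
  rw [hs, div_pow, mul_pow]
  field_simp
  ring

namespace IsAInfty

variable {μ ν : Measure ℝ}

theorem measure_Ico (hμ : IsAInfty μ) (a b : ℝ) : μ (Ico a b) = μ (Icc a b) :=
  measure_congr (hμ.ac.ae_le Ico_ae_eq_Icc)

theorem exists_le_mul (hμ : IsAInfty μ) {κ : ℝ≥0∞} (hκ : κ ≠ ∞) :
    ∃ D : ℝ≥0∞, D ≠ ∞ ∧ ∀ a b, a < b → ∀ A ⊆ Icc a b, MeasurableSet A →
      volume (Icc a b) ≤ κ * volume A → μ (Icc a b) ≤ D * μ A := by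
  obtain ⟨C, hC, n, h⟩ := hμ.ineq
  refine ⟨C * κ ^ n, ENNReal.mul_ne_top hC (ENNReal.pow_ne_top hκ), ?_⟩
  intro a b hab A hA hAm hv
  have hA0 : volume A ≠ 0 := by
    intro h0
    rw [h0, mul_zero, Real.volume_Icc] at hv
    simp at hv
    linarith
  have hAf : volume A ≠ ∞ := ne_top_of_le_ne_top (by simp [Real.volume_Icc]) (measure_mono hA)
  have h1 : volume A ^ n * μ (Icc a b) ≤ volume A ^ n * (C * κ ^ n * μ A) := by
    refine (h a b hab A hA hAm).trans ?_
    calc _ ≤ C * (κ * volume A) ^ n * μ A := by gcongr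
      _ = _ := by ring
  exact (ENNReal.mul_le_mul_iff_right (pow_ne_zero n hA0) (ENNReal.pow_ne_top hAf)).1 h1

theorem exists_half (hμ : IsAInfty μ) :
    ∃ η : ℝ≥0∞, η < 1 ∧ ∀ a b, a < b → ∀ A ⊆ Icc a b, MeasurableSet A →
      2 * volume A ≤ volume (Icc a b) → μ A ≤ η * μ (Icc a b) := by
  obtain ⟨D, hD, h⟩ := hμ.exists_le_mul (κ := 2) (by simp)
  refine ⟨1 - D⁻¹, ENNReal.sub_lt_self (by simp) (by simp) (ENNReal.inv_ne_zero.2 hD), ?_⟩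
  intro a b hab A hA hAm hv
  have hAf : volume A ≠ ∞ := ne_top_of_le_ne_top (by simp [Real.volume_Icc]) (measure_mono hA)
  have hμA : μ A ≠ ∞ := ne_top_of_le_ne_top (hμ.fin a b).ne (measure_mono hA)
  have hB : volume (Icc a b) ≤ 2 * volume (Icc a b \ A) := by
    have h5 := measure_inter_add_sdiff (μ := volume) (Icc a b) hAm
    rw [inter_eq_right.2 hA] at h5
    rw [← h5, two_mul] at hv
    rw [← h5, two_mul]
    exact add_le_add_left ((ENNReal.add_le_add_iff_left hAf).1 hv) _
  have h1 := h a b hab _ sdiff_subset (measurableSet_Icc.diff hAm) hB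
  have hD0 : D ≠ 0 := fun h0 => by
    rw [h0, zero_mul] at h1
    exact (hμ.pos a b hab).not_ge h1
  have h2 : D⁻¹ * μ (Icc a b) ≤ μ (Icc a b \ A) := by
    rw [mul_comm, ← div_eq_mul_inv]
    exact ENNReal.div_le_of_le_mul' h1
  have h3 : μ A = μ (Icc a b) - μ (Icc a b \ A) := by
    have h5 := measure_inter_add_sdiff (μ := μ) (Icc a b) hAm
    rw [inter_eq_right.2 hA] at h5
    rw [← h5, ENNReal.add_sub_cancel_right]
    exact ne_top_of_le_ne_top (hμ.fin a b).ne (measure_mono sdiff_subset)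
  rw [h3, ENNReal.sub_mul (fun _ _ => (hμ.fin a b).ne), one_mul]
  exact tsub_le_tsub_left h2 _

theorem exists_decay_dyadic (hμ : IsAInfty μ) :
    ∃ η : ℝ≥0∞, η < 1 ∧ ∀ a ℓ, 0 < ℓ → ∀ (k : ℕ) (U : Set ℝ), MeasurableSet U →
      (∀ x ∈ U, ∃ n i, i < 2 ^ n ∧ x ∈ dyadic a ℓ n i ∧ dyadic a ℓ n i ⊆ U) →
      4 ^ k * volume U ≤ ENNReal.ofReal ℓ → μ U ≤ η ^ k * μ (Icc a (a + ℓ)) := by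
  obtain ⟨η, hη, h⟩ := hμ.exists_half
  refine ⟨η, hη, fun a ℓ hℓ k => ?_⟩
  induction k with
  | zero =>
    intro U hUm hU _
    rw [pow_zero, one_mul]
    refine measure_mono fun x hx => ?_
    obtain ⟨n, i, hi, hxi, -⟩ := hU x hx
    exact Ico_subset_Icc_self (dyadic_subset hℓ hi hxi)
  | succ k ih =>
    intro U hUm hU hv
    set P : ℕ → ℕ → Prop := fun n i =>
      volume (dyadic a ℓ n i) < 4 * volume (U ∩ dyadic a ℓ n i) with hP
    have h0 : ¬ P 0 0 := by
      change ¬ (_ < _)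
      rw [volume_dyadic, not_lt]
      calc 4 * volume (U ∩ dyadic a ℓ 0 0) ≤ 4 * volume U := by gcongr; exact inter_subset_left
        _ ≤ 4 ^ (k + 1) * volume U := by
          gcongr
          calc (4 : ℝ≥0∞) = 4 ^ 1 := by simp
            _ ≤ 4 ^ (k + 1) := pow_le_pow_right₀ (by norm_num) (by omega)
        _ ≤ _ := by simpa using hv
    set Ω := ⋃ I ∈ stoppingSet P, dyadic a ℓ I.1 I.2 with hΩ
    have hcount : (stoppingSet P).Countable := to_countable _
    have hdisj := pairwiseDisjoint_stoppingSet (a := a) hℓ P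
    have hUΩ : U ⊆ Ω := by
      intro x hx
      obtain ⟨n, i, hi, hxi, hsub⟩ := hU x hx
      have hPi : P n i := by
        change _ < _
        rw [inter_eq_right.2 hsub, volume_dyadic]
        have hpos : 0 < ENNReal.ofReal (ℓ / 2 ^ n) := ENNReal.ofReal_pos.2 (by positivity)
        calc ENNReal.ofReal (ℓ / 2 ^ n) = 1 * ENNReal.ofReal (ℓ / 2 ^ n) := (one_mul _).symm
          _ < 4 * ENNReal.ofReal (ℓ / 2 ^ n) :=
            (ENNReal.mul_lt_mul_iff_left hpos.ne' ENNReal.ofReal_ne_top).2 (by norm_num)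
      obtain ⟨I, hI, hxI⟩ := exists_stopping_of_mem hℓ hi hPi hxi
      exact mem_iUnion₂.2 ⟨I, hI, hxI⟩
    have hΩm : MeasurableSet Ω := MeasurableSet.biUnion hcount fun I _ => measurableSet_dyadic _ _ _ _
    have hΩv : volume Ω ≤ 4 * volume U := by
      rw [hΩ, measure_biUnion hcount hdisj fun I _ => measurableSet_dyadic _ _ _ _]
      calc _ ≤ ∑' I : stoppingSet P, 4 * volume (U ∩ dyadic a ℓ I.1.1 I.1.2) :=
            ENNReal.tsum_le_tsum fun I => I.2.2.1.le
        _ = 4 * volume (⋃ I ∈ stoppingSet P, U ∩ dyadic a ℓ I.1 I.2) := by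
            rw [ENNReal.tsum_mul_left, measure_biUnion hcount (fun I hI J hJ hIJ =>
              (hdisj hI hJ hIJ).mono inter_subset_right inter_subset_right)
              fun I _ => hUm.inter (measurableSet_dyadic _ _ _ _)]
        _ ≤ _ := by
            gcongr
            exact iUnion₂_subset fun I _ => inter_subset_left
    have hΩμ : μ U ≤ η * μ Ω := by
      have hU' : U = ⋃ I ∈ stoppingSet P, U ∩ dyadic a ℓ I.1 I.2 := by
        rw [← inter_iUnion₂]
        exact (inter_eq_left.2 hUΩ).symm
      conv_lhs => rw [hU']
      rw [hΩ, measure_biUnion hcount hdisj fun I _ => measurableSet_dyadic _ _ _ _,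
        measure_biUnion hcount (fun I hI J hJ hIJ =>
              (hdisj hI hJ hIJ).mono inter_subset_right inter_subset_right)
              fun I _ => hUm.inter (measurableSet_dyadic _ _ _ _), ← ENNReal.tsum_mul_left]
      refine ENNReal.tsum_le_tsum fun I => ?_
      obtain ⟨m, j, hm, hj, hnP, hsub⟩ := exists_parent (a := a) hℓ h0 I.2
      have hpos : 0 < ℓ / 2 ^ I.1.1 := by positivity
      rw [dyadic, hμ.measure_Ico]
      refine h _ _ (by linarith) _ (inter_subset_right.trans Ico_subset_Icc_self)
        (hUm.inter measurableSet_Ico) ?_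
      replace hnP := not_lt.1 hnP
      rw [volume_dyadic] at hnP
      have h4 : 4 * volume (U ∩ dyadic a ℓ I.1.1 I.1.2) ≤ ENNReal.ofReal (ℓ / 2 ^ m) :=
        le_trans (by gcongr) hnP
      have h5 : ENNReal.ofReal (ℓ / 2 ^ m) = 2 * ENNReal.ofReal (ℓ / 2 ^ I.1.1) := by
        rw [show (2 : ℝ≥0∞) = ENNReal.ofReal 2 by simp, ← ENNReal.ofReal_mul (by norm_num), hm]
        congr 1
        rw [pow_succ]; field_simp
      rw [Real.volume_Icc, add_sub_cancel_left]
      refine (ENNReal.mul_le_mul_iff_right (a := 2) (by simp) (by simp)).1 ?_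
      rw [← h5, ← mul_assoc]
      refine le_trans (le_of_eq ?_) h4
      rw [dyadic]; norm_num
    refine hΩμ.trans ?_
    rw [pow_succ', mul_assoc]
    gcongr
    refine ih Ω hΩm (fun x hx => ?_) ?_
    · obtain ⟨I, hI, hxI⟩ := mem_iUnion₂.1 hx
      exact ⟨I.1, I.2, hI.1, hxI, subset_biUnion_of_mem (u := fun I : ℕ × ℕ => dyadic a ℓ I.1 I.2) hI⟩
    · calc _ ≤ 4 ^ k * (4 * volume U) := by gcongr
        _ = 4 ^ (k + 1) * volume U := by ring
        _ ≤ _ := hv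

theorem exists_decay (hμ : IsAInfty μ) :
    ∃ η : ℝ≥0∞, η < 1 ∧ ∀ a b, a < b → ∀ (k : ℕ) (U : Set ℝ), IsOpen U →
      4 ^ k * volume (U ∩ Icc a b) ≤ volume (Icc a b) →
      μ (U ∩ Icc a b) ≤ η ^ k * μ (Icc a b) := by
  obtain ⟨η, hη, h⟩ := hμ.exists_decay_dyadic
  refine ⟨η, hη, fun a b hab k U hU hv => ?_⟩
  have hℓ : 0 < b - a := sub_pos.2 hab
  have h1 := h a (b - a) hℓ k (U ∩ Ico a b) (hU.measurableSet.inter measurableSet_Ico) ?_ ?_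
  · have e : μ (U ∩ Icc a b) = μ (U ∩ Ico a b) :=
      measure_congr (hμ.ac.ae_le ((ae_eq_refl U).inter Ico_ae_eq_Icc.symm))
    rw [e]
    simpa using h1
  · rintro x ⟨hxU, hx⟩
    obtain ⟨n, i, hi, hxi, hsub⟩ := exists_dyadic_subset (a := a) hℓ hU (by simpa using hx) hxU
    refine ⟨n, i, hi, hxi, subset_inter hsub ?_⟩
    simpa using dyadic_subset (a := a) hℓ hi
  · rw [← Real.volume_Icc]
    refine le_trans ?_ hv
    gcongr
    exact Ico_subset_Icc_self

/-- Smallness of an open set for one `A_∞` measure implies geometric smallness for another. -/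
theorem exists_transfer (hμ : IsAInfty μ) (hν : IsAInfty ν) :
    ∃ L : ℝ≥0∞, 1 < L ∧ L ≠ ∞ ∧ ∃ η : ℝ≥0∞, η < 1 ∧ ∀ a b, a < b → ∀ (k : ℕ) (U : Set ℝ), IsOpen U →
      L ^ k * μ (U ∩ Icc a b) ≤ L * μ (Icc a b) →
      ν (U ∩ Icc a b) ≤ η ^ (k - 1) * ν (Icc a b) := by
  obtain ⟨η, hη, hd⟩ := hν.exists_decay
  obtain ⟨C, hC0, n, hn, hc⟩ := hμ.exists_common hν
  set L : ℝ≥0∞ := 4 ^ n * ENNReal.ofReal (C + 1) with hL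
  have hC1 : 1 ≤ ENNReal.ofReal (C + 1) := by
    rw [← ENNReal.ofReal_one]; exact ENNReal.ofReal_le_ofReal (by linarith)
  have h4n : (1 : ℝ≥0∞) < 4 ^ n := one_lt_pow₀ (by norm_num) hn
  have hL1 : 1 < L := h4n.trans_le (le_mul_of_one_le_right' hC1)
  have hLt : L ≠ ∞ := ENNReal.mul_ne_top (by simp) ENNReal.ofReal_ne_top
  have hL0 : L ≠ 0 := (zero_lt_one.trans hL1).ne'
  refine ⟨L, hL1, hLt, η, hη, fun a b hab k U hU hv => ?_⟩
  rcases k with _ | _ | k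
  · simpa using measure_mono inter_subset_right
  · simpa using measure_mono inter_subset_right
  refine hd a b hab (k + 1) U hU ?_
  set A := U ∩ Icc a b with hA
  have h1 := (hc a b hab A inter_subset_right (hU.measurableSet.inter measurableSet_Icc)).1
  have hμ0 := (hμ.pos a b hab).ne'
  have hμt := (hμ.fin a b).ne
  have hv1 : L ^ (k + 1) * μ A ≤ μ (Icc a b) := by
    refine (ENNReal.mul_le_mul_iff_right hL0 hLt).1 ?_
    refine le_trans (le_of_eq ?_) hv
    ring
  have h2 : (4 ^ (k + 1) * volume A) ^ n * μ (Icc a b) ≤ volume (Icc a b) ^ n * μ (Icc a b) := by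
    calc (4 ^ (k + 1) * volume A) ^ n * μ (Icc a b)
        = (4 ^ n) ^ (k + 1) * (volume A ^ n * μ (Icc a b)) := by
          rw [mul_pow, ← pow_mul, ← pow_mul, mul_comm n]; ring
      _ ≤ (4 ^ n) ^ (k + 1) * (ENNReal.ofReal C * volume (Icc a b) ^ n * μ A) := by gcongr
      _ ≤ (4 ^ n) ^ (k + 1) * (ENNReal.ofReal (C + 1) ^ (k + 1) * volume (Icc a b) ^ n * μ A) := by
          gcongr
          calc ENNReal.ofReal C ≤ ENNReal.ofReal (C + 1) := ENNReal.ofReal_le_ofReal (by linarith)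
            _ ≤ _ := le_self_pow₀ hC1 (by omega)
      _ = volume (Icc a b) ^ n * (L ^ (k + 1) * μ A) := by rw [hL, mul_pow]; ring
      _ ≤ _ := by gcongr
  have h3 := (ENNReal.mul_le_mul_iff_left hμ0 hμt).1 h2
  exact (ENNReal.pow_le_pow_left_iff hn).1 h3

end IsAInfty

theorem sum_rpow_mul_rpow_mul_rpow_le {ι : Type*} (s : Finset ι) (x y z : ι → ℝ≥0∞) {a b c : ℝ}
    (ha : 0 ≤ a) (hb : 0 ≤ b) (hc : 0 ≤ c) (habc : a + b + c = 1) :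
    ∑ i ∈ s, x i ^ a * y i ^ b * z i ^ c ≤
      (∑ i ∈ s, x i) ^ a * (∑ i ∈ s, y i) ^ b * (∑ i ∈ s, z i) ^ c := by
  let _ : MeasurableSpace s := ⊤
  have h := ENNReal.lintegral_prod_norm_pow_le (μ := (Measure.count : Measure s))
    (Finset.univ : Finset (Fin 3)) (f := fun k i => (![x i, y i, z i] : Fin 3 → ℝ≥0∞) k)
    (p := ![a, b, c]) (fun k _ => (measurable_from_top).aemeasurable)
    (by simp [Fin.sum_univ_three, habc])
    (by intro i _; fin_cases i <;> simp [ha, hb, hc])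
  simp only [Fin.prod_univ_three, lintegral_count, tsum_fintype] at h
  simp only [Matrix.cons_val_zero, Matrix.cons_val_one, Matrix.cons_val] at h
  rwa [Finset.sum_coe_sort s fun i => x i ^ a * y i ^ b * z i ^ c, Finset.sum_coe_sort s x,
    Finset.sum_coe_sort s y, Finset.sum_coe_sort s z] at h

theorem sum_rpow_mul_rpow_le {ι : Type*} (s : Finset ι) (x y : ι → ℝ≥0∞) {a b : ℝ}
    (ha : 0 ≤ a) (hb : 0 ≤ b) (hab : a + b = 1) :
    ∑ i ∈ s, x i ^ a * y i ^ b ≤ (∑ i ∈ s, x i) ^ a * (∑ i ∈ s, y i) ^ b := by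
  simpa using sum_rpow_mul_rpow_mul_rpow_le s x y (fun _ => 1) ha hb le_rfl (by simpa using hab)

/-- The Lorentz `L^{q,1}(μ)` norm of the restriction of `f` to `R`. -/
def localNorm (q : ℝ) (μ : Measure ℝ) (f : ℝ → ℝ) (R : Set ℝ) : ℝ≥0∞ :=
  ∫⁻ t in Ioi (0 : ℝ), μ ({x | t < |f x|} ∩ R) ^ (1 / q)

theorem localNorm_univ (q : ℝ) (μ : Measure ℝ) (f : ℝ → ℝ) :
    localNorm q μ f univ = lorentz q 1 μ f := by
  simp [localNorm, lorentz]

theorem measurable_measure_inter_rpow (q : ℝ) (μ : Measure ℝ) (f : ℝ → ℝ) (R : Set ℝ) (hq : 0 < q) :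
    Measurable fun t : ℝ => μ ({x | t < |f x|} ∩ R) ^ (1 / q) := by
  refine Antitone.measurable fun s t hst => ?_
  have hq' : 0 ≤ 1 / q := by positivity
  refine ENNReal.rpow_le_rpow (measure_mono ?_) hq'
  exact inter_subset_inter_left _ fun x hx => lt_of_le_of_lt hst hx

theorem localNorm_mono {q : ℝ} (hq : 0 < q) (μ : Measure ℝ) (f : ℝ → ℝ) {R S : Set ℝ}
    (h : R ⊆ S) : localNorm q μ f R ≤ localNorm q μ f S := by
  have hq' : 0 ≤ 1 / q := by positivity
  refine lintegral_mono fun t => ENNReal.rpow_le_rpow (measure_mono ?_) hq'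
  exact inter_subset_inter_right _ h

theorem sum_localNorm_rpow_le {q : ℝ} (hq : 1 ≤ q) (μ : Measure ℝ) {f : ℝ → ℝ} (hf : Measurable f)
    {ι : Type*} (s : Finset ι) {R : ι → Set ℝ} (hR : ∀ i ∈ s, MeasurableSet (R i))
    (hd : (s : Set ι).PairwiseDisjoint R) :
    ∑ i ∈ s, localNorm q μ f (R i) ^ q ≤ localNorm q μ f univ ^ q := by
  have hq0 : 0 < q := by linarith
  set S := ∑ i ∈ s, localNorm q μ f (R i) ^ q with hS
  by_cases hfin : localNorm q μ f univ = ∞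
  · rw [hfin, ENNReal.top_rpow_of_pos hq0]; exact le_top
  have hn : ∀ i, localNorm q μ f (R i) ≠ ∞ := fun i =>
    ne_top_of_le_ne_top hfin (localNorm_mono hq0 μ f (subset_univ _))
  have hSt : S ≠ ∞ := by
    rw [hS]
    exact (ENNReal.sum_lt_top.2 fun i _ => ENNReal.rpow_lt_top_of_nonneg hq0.le (hn i)).ne
  rcases eq_or_ne S 0 with h0 | h0
  · rw [h0]; exact zero_le
  have hqi : 0 ≤ 1 - 1 / q := by
    rw [sub_nonneg, div_le_one hq0]; exact hq
  have hqi' : 0 ≤ 1 / q := by positivity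
  have key : S ≤ S ^ (1 - 1 / q) * localNorm q μ f univ := by
    calc S = ∑ i ∈ s, (localNorm q μ f (R i) ^ q) ^ (1 - 1 / q) * localNorm q μ f (R i) := by
          refine Finset.sum_congr rfl fun i _ => ?_
          rw [← ENNReal.rpow_mul]
          rw [show q * (1 - 1 / q) = q - 1 by field_simp]
          conv_rhs => rw [← ENNReal.rpow_one (localNorm q μ f (R i)), ← ENNReal.rpow_mul, one_mul,
            ← ENNReal.rpow_add_of_nonneg _ _ (by linarith) zero_le_one, sub_add_cancel]
      _ = ∫⁻ t in Ioi (0 : ℝ), ∑ i ∈ s, (localNorm q μ f (R i) ^ q) ^ (1 - 1 / q) *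
            μ ({x | t < |f x|} ∩ R i) ^ (1 / q) := by
          rw [lintegral_finsetSum' _ fun i _ =>
            ((measurable_measure_inter_rpow q μ f (R i) hq0).const_mul _).aemeasurable]
          refine Finset.sum_congr rfl fun i _ => ?_
          rw [lintegral_const_mul _ (measurable_measure_inter_rpow q μ f (R i) hq0)]
          rfl
      _ ≤ ∫⁻ t in Ioi (0 : ℝ), S ^ (1 - 1 / q) * μ ({x | t < |f x|} ∩ univ) ^ (1 / q) := by
          refine lintegral_mono fun t => ?_
          refine (sum_rpow_mul_rpow_le s _ _ hqi hqi' (by ring)).trans ?_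
          refine mul_le_mul_right (ENNReal.rpow_le_rpow ?_ hqi') _
          have hm : MeasurableSet {x | t < |f x|} := measurableSet_lt measurable_const hf.abs
          rw [← measure_biUnion_finset (fun i hi j hj hij =>
            (hd hi hj hij).mono inter_subset_right inter_subset_right) fun i hi => hm.inter (hR i hi)]
          exact measure_mono (iUnion₂_subset fun i _ => inter_subset_inter_right _ (subset_univ _))
      _ = _ := by
          rw [lintegral_const_mul _ (measurable_measure_inter_rpow q μ f univ hq0)]
          rfl
  have h1 : S ^ (1 - 1 / q) * S ^ (1 / q) = S := by
    rw [← ENNReal.rpow_add _ _ h0 hSt]; simp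
  have h2 : S ^ (1 / q) ≤ localNorm q μ f univ := by
    refine (ENNReal.mul_le_mul_iff_right (a := S ^ (1 - 1 / q)) ?_ ?_).1 (by rwa [h1])
    · exact (ENNReal.rpow_pos (pos_iff_ne_zero.2 h0) hSt).ne'
    · exact ENNReal.rpow_ne_top_of_nonneg hqi hSt
  have h3 := ENNReal.rpow_le_rpow h2 hq0.le
  rwa [← ENNReal.rpow_mul, one_div, inv_mul_cancel₀ hq0.ne', ENNReal.rpow_one] at h3

theorem lintegral_mul_le_localNorm {q : ℝ} (hq : 1 ≤ q) {w : ℝ → ℝ} (hw : IsWeight w)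
    {f : ℝ → ℝ} (hf : Measurable f) {a b : ℝ} (hab : a < b) :
    (∫⁻ x in Icc a b, ‖f x‖ₑ) * wMeasure w (Icc a b) ^ (1 / q) ≤
      AqRConstR q w * volume (Icc a b) * localNorm q (wMeasure w) f (Icc a b) := by
  have hq0 : 0 < q := by linarith
  have h1 : ∫⁻ x in Icc a b, ‖f x‖ₑ =
      ∫⁻ t in Ioi (0 : ℝ), volume ({x | t < |f x|} ∩ Icc a b) := by
    have := lintegral_eq_lintegral_meas_lt (volume.restrict (Icc a b)) (f := fun x => |f x|)
      (Eventually.of_forall fun x => abs_nonneg _) hf.abs.aemeasurable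
    have e : ∀ x, ENNReal.ofReal |f x| = ‖f x‖ₑ := fun x => by
      rw [← Real.norm_eq_abs, ofReal_norm]
    simp only [e] at this
    rw [this]
    refine lintegral_congr fun t => ?_
    rw [Measure.restrict_apply (measurableSet_lt measurable_const hf.abs)]
  have hmeas : Measurable fun t : ℝ => volume ({x | t < |f x|} ∩ Icc a b) := by
    refine Antitone.measurable fun s t hst => measure_mono ?_
    exact inter_subset_inter_left _ fun x hx => lt_of_le_of_lt hst hx
  rw [h1, localNorm, ← lintegral_mul_const _ hmeas,
    ← lintegral_const_mul _ (measurable_measure_inter_rpow q _ f _ hq0)]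
  refine lintegral_mono fun t => ?_
  exact volume_mul_le_of_restricted hq hw hab inter_subset_right
    ((measurableSet_lt measurable_const hf.abs).inter measurableSet_Icc)

theorem exists_generations {ι : Type*} {W : ι → ℝ≥0∞} (hW0 : ∀ i, W i ≠ 0) (hWt : ∀ i, W i ≠ ∞)
    {Λ : ℝ≥0∞} (S : ι → Set ℝ) (J : Finset ι)
    (h : ∀ J' ⊆ J, ∃ K ⊆ J', (K : Set ι).PairwiseDisjoint S ∧
      ∑ i ∈ J', W i ≤ Λ * ∑ i ∈ K, W i) :
    ∃ g : ι → ℕ, ∀ n, {i | i ∈ J ∧ g i = n}.PairwiseDisjoint S ∧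
      ∑ i ∈ J with g i = n, W i ≤ (1 - Λ⁻¹) ^ n * ∑ i ∈ J, W i := by
  classical
  induction J using Finset.strongInduction with
  | H J ih =>
    rcases J.eq_empty_or_nonempty with rfl | hJ
    · exact ⟨fun _ => 0, fun n => by simp⟩
    obtain ⟨K, hKJ, hKd, hK⟩ := h J subset_rfl
    have hKne : K.Nonempty := by
      rw [Finset.nonempty_iff_ne_empty]
      rintro rfl
      rw [Finset.sum_empty, mul_zero, nonpos_iff_eq_zero, Finset.sum_eq_zero_iff] at hK
      obtain ⟨i, hi⟩ := hJ
      exact hW0 i (hK i hi)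
    obtain ⟨g, hg⟩ := ih (J \ K) (Finset.sdiff_ssubset hKJ hKne)
      fun J' hJ' => h J' (hJ'.trans Finset.sdiff_subset)
    have hsum := Finset.sum_sdiff (f := W) hKJ
    have hKt : ∑ i ∈ K, W i ≠ ∞ := (ENNReal.sum_lt_top.2 fun i _ => (hWt i).lt_top).ne
    have hJt : ∑ i ∈ J, W i ≠ ∞ := (ENNReal.sum_lt_top.2 fun i _ => (hWt i).lt_top).ne
    have hless : ∑ i ∈ J \ K, W i ≤ (1 - Λ⁻¹) * ∑ i ∈ J, W i := by
      rw [ENNReal.sub_mul (fun _ _ => hJt), one_mul]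
      have e : ∑ i ∈ J \ K, W i = ∑ i ∈ J, W i - ∑ i ∈ K, W i := by
        rw [← hsum, ENNReal.add_sub_cancel_right hKt]
      rw [e]
      refine tsub_le_tsub_left ?_ _
      rw [mul_comm, ← div_eq_mul_inv]
      exact ENNReal.div_le_of_le_mul' hK
    refine ⟨fun i => if i ∈ K then 0 else g i + 1, fun n => ?_⟩
    rcases n with _ | n
    · have e : {i | i ∈ J ∧ (if i ∈ K then 0 else g i + 1) = 0} = (K : Set ι) := by
        ext i
        by_cases hi : i ∈ K
        · simp [hi, hKJ hi]
        · simp [hi]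
      refine ⟨by rw [e]; exact hKd, ?_⟩
      rw [pow_zero, one_mul]
      exact Finset.sum_le_sum_of_subset (Finset.filter_subset _ _)
    · have e : ∀ i, (i ∈ J ∧ (if i ∈ K then 0 else g i + 1) = n + 1) ↔ (i ∈ J \ K ∧ g i = n) := by
        intro i
        by_cases hi : i ∈ K <;> simp [hi]
      obtain ⟨h1, h2⟩ := hg n
      refine ⟨by simpa only [e] using h1, ?_⟩
      have e2 : (J.filter fun i => (if i ∈ K then 0 else g i + 1) = n + 1) =
          (J \ K).filter fun i => g i = n := by
        ext i; rw [Finset.mem_filter, Finset.mem_filter]; exact e i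
      rw [e2, pow_succ, mul_assoc]
      exact h2.trans (by gcongr)

namespace IsAInfty

variable {μ : Measure ℝ}

theorem closedBall_pos (hμ : IsAInfty μ) {c r : ℝ} (hr : 0 < r) :
    0 < μ (Metric.closedBall c r) := by
  rw [Real.closedBall_eq_Icc]; exact hμ.pos _ _ (by linarith)

theorem closedBall_lt_top (hμ : IsAInfty μ) (c r : ℝ) : μ (Metric.closedBall c r) < ∞ := by
  rw [Real.closedBall_eq_Icc]; exact hμ.fin _ _

theorem exists_doubling (hμ : IsAInfty μ) {κ : ℝ} (hκ : 1 ≤ κ) :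
    ∃ D : ℝ≥0∞, D ≠ ∞ ∧ ∀ c r, 0 < r →
      μ (Metric.closedBall c (κ * r)) ≤ D * μ (Metric.closedBall c r) := by
  obtain ⟨D, hD, h⟩ := hμ.exists_le_mul (κ := ENNReal.ofReal κ) ENNReal.ofReal_ne_top
  refine ⟨D, hD, fun c r hr => ?_⟩
  have hr' : r ≤ κ * r := le_mul_of_one_le_left hr.le hκ
  simp only [Real.closedBall_eq_Icc]
  refine h _ _ (by linarith) _ (Icc_subset_Icc (by linarith) (by linarith)) measurableSet_Icc ?_
  rw [Real.volume_Icc, Real.volume_Icc, ← ENNReal.ofReal_mul (by linarith)]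
  exact ENNReal.ofReal_le_ofReal (by linarith)

theorem exists_disjoint_subfamily (hμ : IsAInfty μ) {Λ : ℝ≥0∞} (hΛ : Λ ≠ ∞) :
    ∃ M : ℝ≥0∞, M ≠ 0 ∧ M ≠ ∞ ∧ ∀ {ι : Type} (c r : ι → ℝ) (A : ι → Set ℝ) (J : Finset ι),
      (∀ i ∈ J, 0 < r i) → (∀ i ∈ J, MeasurableSet (A i)) →
      (∀ i ∈ J, A i ⊆ Metric.closedBall (c i) (r i)) → (J : Set ι).PairwiseDisjoint A →
      (∀ i ∈ J, μ (Metric.closedBall (c i) (r i)) ≤ Λ * μ (A i)) →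
      ∃ K ⊆ J, (K : Set ι).PairwiseDisjoint (fun i => Metric.closedBall (c i) (r i)) ∧
        ∑ i ∈ J, μ (Metric.closedBall (c i) (r i)) ≤
          M * ∑ i ∈ K, μ (Metric.closedBall (c i) (r i)) := by
  classical
  obtain ⟨D, hD, hdoub⟩ := hμ.exists_doubling (κ := 5) (by norm_num)
  refine ⟨Λ * D + 1, by simp, by simp [ENNReal.mul_eq_top, hΛ, hD], ?_⟩
  intro ι c r A J hr hAm hAs hAd hAw
  obtain ⟨u, huJ, hud, hu⟩ := Vitali.exists_disjoint_subfamily_covering_enlargement_closedBall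
    (J : Set ι) c r (∑ i ∈ J, |r i|) (fun a ha => (le_abs_self _).trans
      (Finset.single_le_sum (f := fun i => |r i|) (fun i _ => abs_nonneg _) ha)) 5 (by norm_num)
  lift u to Finset ι using J.finite_toSet.subset huJ
  refine ⟨u, by exact_mod_cast huJ, hud, ?_⟩
  calc ∑ i ∈ J, μ (Metric.closedBall (c i) (r i)) ≤ ∑ i ∈ J, Λ * μ (A i) := Finset.sum_le_sum hAw
    _ = Λ * μ (⋃ i ∈ J, A i) := by rw [← Finset.mul_sum, measure_biUnion_finset hAd hAm]
    _ ≤ Λ * μ (⋃ i ∈ u, Metric.closedBall (c i) (5 * r i)) := by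
        refine mul_le_mul_right (measure_mono (iUnion₂_subset fun i hi => ?_)) _
        obtain ⟨b, hb, hsub⟩ := hu i hi
        exact ((hAs i hi).trans hsub).trans
          (subset_biUnion_of_mem (u := fun i => Metric.closedBall (c i) (5 * r i)) hb)
    _ ≤ Λ * ∑ i ∈ u, μ (Metric.closedBall (c i) (5 * r i)) := by
        gcongr
        exact measure_biUnion_finset_le _ _
    _ ≤ Λ * ∑ i ∈ u, D * μ (Metric.closedBall (c i) (r i)) := by
        gcongr with i hi
        exact hdoub _ _ (hr i (huJ hi))
    _ = Λ * D * ∑ i ∈ u, μ (Metric.closedBall (c i) (r i)) := by rw [← Finset.mul_sum, mul_assoc]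
    _ ≤ _ := by gcongr; exact le_self_add

end IsAInfty

theorem sum_measure_inter_le {μ : Measure ℝ} (E : Set ℝ) {ι : Type*} (K : Finset ι)
    {B : ι → Set ℝ} (hB : ∀ i ∈ K, MeasurableSet (B i)) (hd : (K : Set ι).PairwiseDisjoint B) :
    ∑ i ∈ K, μ (E ∩ B i) ≤ μ (E ∩ ⋃ i ∈ K, B i) := by
  have h : ∀ S, MeasurableSet S → μ (E ∩ S) = μ.restrict E S := fun S hS => by
    rw [Measure.restrict_apply hS, inter_comm]
  rw [h _ (K.measurableSet_biUnion hB), measure_biUnion_finset hd hB]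
  exact (Finset.sum_congr rfl fun i hi => h _ (hB i hi)).le

theorem exists_stratum {L V W : ℝ≥0∞} (hL : 1 < L) (hV : V ≠ 0) (hVW : V ≤ W) (hW : W ≠ ∞) :
    ∃ n : ℕ, L ^ n * V ≤ W ∧ W ≤ L ^ (n + 1) * V := by
  classical
  have hex : ∃ n : ℕ, W < L ^ (n + 1) * V := by
    have h1 : Tendsto (fun n : ℕ => L ^ (n + 1) * V) atTop (nhds ∞) := by
      have := ENNReal.Tendsto.mul_const (b := V)
        ((tendsto_add_atTop_iff_nat 1).2 (ENNReal.tendsto_pow_atTop_nhds_top_iff.2 hL)) (Or.inl (by simp))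
      rwa [ENNReal.top_mul hV] at this
    exact (h1.eventually (lt_mem_nhds hW.lt_top)).exists
  refine ⟨Nat.find hex, ?_, (Nat.find_spec hex).le⟩
  rcases hn : Nat.find hex with _ | m
  · simpa using hVW
  · exact not_lt.1 (Nat.find_min hex (by omega))

namespace IsAInfty

variable {μ : Measure ℝ}

/-- Sorting a sparse family of intervals by the density of a set `E` and by generations. -/
theorem exists_labels (hμ : IsAInfty μ) {Λ L : ℝ≥0∞} (hΛ : Λ ≠ ∞) (hL : 1 < L) (hLt : L ≠ ∞) :
    ∃ M η : ℝ≥0∞, M ≠ ∞ ∧ η < 1 ∧ ∀ {ι : Type} (c r : ι → ℝ) (A : ι → Set ℝ) (J : Finset ι)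
      (E : Set ℝ), (∀ i, 0 < r i) → (∀ i ∈ J, MeasurableSet (A i)) →
      (∀ i ∈ J, A i ⊆ Metric.closedBall (c i) (r i)) → (J : Set ι).PairwiseDisjoint A →
      (∀ i ∈ J, μ (Metric.closedBall (c i) (r i)) ≤ Λ * μ (A i)) →
      ∃ s g : ι → ℕ, (∀ i ∈ J, μ (E ∩ Metric.closedBall (c i) (r i)) ≠ 0 →
        L ^ s i * μ (E ∩ Metric.closedBall (c i) (r i)) ≤ μ (Metric.closedBall (c i) (r i)) ∧
        μ (Metric.closedBall (c i) (r i)) ≤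
          L ^ (s i + 1) * μ (E ∩ Metric.closedBall (c i) (r i))) ∧
      ∀ n m, {i | i ∈ J ∧ μ (E ∩ Metric.closedBall (c i) (r i)) ≠ 0 ∧ s i = n ∧
          g i = m}.PairwiseDisjoint (fun i => Metric.closedBall (c i) (r i)) ∧
        ∀ K ⊆ J, (∀ i ∈ K, μ (E ∩ Metric.closedBall (c i) (r i)) ≠ 0 ∧ s i = n ∧ g i = m) →
        ∑ i ∈ K, μ (E ∩ Metric.closedBall (c i) (r i)) ≤ M * η ^ m * μ E := by
  classical
  obtain ⟨M, hM0, hMt, hM⟩ := hμ.exists_disjoint_subfamily hΛ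
  refine ⟨M * L, 1 - M⁻¹, ENNReal.mul_ne_top hMt hLt,
    ENNReal.sub_lt_self (by simp) (by simp) (ENNReal.inv_ne_zero.2 hMt), ?_⟩
  intro ι c r A J E hr hAm hAs hAd hAw
  set B : ι → Set ℝ := fun i => Metric.closedBall (c i) (r i) with hB
  have hBm : ∀ i, MeasurableSet (B i) := fun i => measurableSet_closedBall
  have hs : ∀ i, ∃ n : ℕ, μ (E ∩ B i) ≠ 0 → L ^ n * μ (E ∩ B i) ≤ μ (B i) ∧
      μ (B i) ≤ L ^ (n + 1) * μ (E ∩ B i) := by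
    intro i
    by_cases h0 : μ (E ∩ B i) = 0
    · exact ⟨0, fun h => absurd h0 h⟩
    · obtain ⟨n, hn⟩ := exists_stratum hL h0 (measure_mono inter_subset_right)
        (hμ.closedBall_lt_top _ _).ne
      exact ⟨n, fun _ => hn⟩
  choose s hs using hs
  set Jn : ℕ → Finset ι := fun n => J.filter fun i => μ (E ∩ B i) ≠ 0 ∧ s i = n with hJn
  have hsub : ∀ n, ∀ J' ⊆ Jn n, ∃ K ⊆ J', (K : Set ι).PairwiseDisjoint B ∧
      ∑ i ∈ J', μ (B i) ≤ M * ∑ i ∈ K, μ (B i) := by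
    intro n J' hJ'
    have hJJ : J' ⊆ J := hJ'.trans (Finset.filter_subset _ _)
    exact hM c r A J' (fun i _ => hr i) (fun i hi => hAm i (hJJ hi)) (fun i hi => hAs i (hJJ hi))
      (hAd.subset (by exact_mod_cast hJJ)) (fun i hi => hAw i (hJJ hi))
  choose g hg using fun n => exists_generations (W := fun i => μ (B i))
    (fun i => (hμ.closedBall_pos (hr i)).ne') (fun i => (hμ.closedBall_lt_top _ _).ne) B
    (Jn n) (hsub n)
  refine ⟨s, fun i => g (s i) i, fun i _ => hs i, fun n m => ⟨?_, ?_⟩⟩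
  · refine (hg n m).1.subset ?_
    rintro i ⟨hi, h0, hsi, hgi⟩
    refine ⟨Finset.mem_filter.2 ⟨hi, h0, hsi⟩, ?_⟩
    rw [← hsi]; exact hgi
  · intro K hKJ hK
    have hLn0 : L ^ n ≠ 0 := pow_ne_zero _ (zero_lt_one.trans hL).ne'
    have hLnt : L ^ n ≠ ∞ := ENNReal.pow_ne_top hLt
    refine (ENNReal.mul_le_mul_iff_right hLn0 hLnt).1 ?_
    obtain ⟨K', hK'J, hK'd, hK'⟩ := hsub n (Jn n) subset_rfl
    calc L ^ n * ∑ i ∈ K, μ (E ∩ B i) = ∑ i ∈ K, L ^ n * μ (E ∩ B i) := Finset.mul_sum _ _ _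
      _ ≤ ∑ i ∈ K, μ (B i) := by
          refine Finset.sum_le_sum fun i hi => ?_
          obtain ⟨h0, hsi, -⟩ := hK i hi
          rw [← hsi]; exact (hs i h0).1
      _ ≤ ∑ i ∈ Jn n with g n i = m, μ (B i) := by
          refine Finset.sum_le_sum_of_subset fun i hi => ?_
          obtain ⟨h0, hsi, hgi⟩ := hK i hi
          refine Finset.mem_filter.2 ⟨Finset.mem_filter.2 ⟨hKJ hi, h0, hsi⟩, ?_⟩
          rw [← hsi]; exact hgi
      _ ≤ (1 - M⁻¹) ^ m * ∑ i ∈ Jn n, μ (B i) := (hg n m).2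
      _ ≤ (1 - M⁻¹) ^ m * (M * ∑ i ∈ K', μ (B i)) := by gcongr
      _ ≤ (1 - M⁻¹) ^ m * (M * ∑ i ∈ K', L ^ (n + 1) * μ (E ∩ B i)) := by
          gcongr with i hi
          obtain ⟨h1, h0, hsi⟩ := Finset.mem_filter.1 (hK'J hi)
          rw [← hsi]; exact (hs i h0).2
      _ = L ^ n * (M * L * (1 - M⁻¹) ^ m * ∑ i ∈ K', μ (E ∩ B i)) := by
          rw [← Finset.mul_sum]; ring
      _ ≤ L ^ n * (M * L * (1 - M⁻¹) ^ m * μ E) := by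
          gcongr
          exact (sum_measure_inter_le E K' (fun i _ => hBm i) hK'd).trans
            (measure_mono inter_subset_left)

end IsAInfty

theorem sum_inter_le_of_pairs {μ : Measure ℝ} {ι κ : Type} [DecidableEq ι] [DecidableEq κ]
    (P : Finset (ι × κ)) (E : Set ℝ) (B : ι → Set ℝ) (B' : κ → Set ℝ)
    (hB : ∀ i, MeasurableSet (B i)) (h1 : (P.image Prod.fst : Set ι).PairwiseDisjoint B)
    (hsub : ∀ x ∈ P, B x.1 ⊆ B' x.2) :
    ∑ j ∈ P.image Prod.fst, μ (E ∩ B j) ≤ ∑ k ∈ P.image Prod.snd, μ (E ∩ B' k) := by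
  refine (sum_measure_inter_le E _ (fun i _ => hB i) h1).trans ?_
  refine (measure_mono ?_).trans (measure_biUnion_finset_le (P.image Prod.snd) fun k => E ∩ B' k)
  rintro y ⟨hyE, hy⟩
  simp only [mem_iUnion, Finset.mem_image, exists_prop] at hy
  obtain ⟨j, ⟨x, hx, rfl⟩, hy⟩ := hy
  simp only [mem_iUnion, Finset.mem_image, exists_prop]
  exact ⟨x.2, ⟨x, hx, rfl⟩, hyE, hsub x hx hy⟩

theorem closedBall_subset_closedBall_three {c c' r r' : ℝ} (h : r ≤ r')
    (hne : (Metric.closedBall c r ∩ Metric.closedBall c' r').Nonempty) :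
    Metric.closedBall c r ⊆ Metric.closedBall c' (3 * r') := by
  obtain ⟨y, hy, hy'⟩ := hne
  refine Metric.closedBall_subset_closedBall' ?_
  have := dist_triangle_left c c' y
  rw [Metric.mem_closedBall] at hy hy'
  linarith

variable {μ μ₁ μ₂ : Measure ℝ}

theorem sum_measure_closedBall_le_of_transfer (hac₂ : μ₂ ≪ volume) {L η : ℝ≥0∞}
    (hL : 1 < L) (hLt : L ≠ ∞)
    (htr : ∀ a b, a < b → ∀ (k : ℕ) (U : Set ℝ), IsOpen U →
      L ^ k * μ (U ∩ Icc a b) ≤ L * μ (Icc a b) →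
      μ₂ (U ∩ Icc a b) ≤ η ^ (k - 1) * μ₂ (Icc a b))
    {ι : Type} (F : Finset ι) (c r : ι → ℝ) (hr : ∀ j, 0 < r j)
    {c' r' : ℝ} (hr' : 0 < r')
    (hd : (F : Set ι).PairwiseDisjoint fun j => Metric.closedBall (c j) (r j))
    (hsub : ∀ j ∈ F, Metric.closedBall (c j) (r j) ⊆ Metric.closedBall c' r')
    (E : Set ℝ) (n m : ℕ)
    (hn : ∀ j ∈ F, μ (Metric.closedBall (c j) (r j)) ≤
      L ^ (n + 1) * μ (E ∩ Metric.closedBall (c j) (r j)))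
    (hm : L ^ m * μ (E ∩ Metric.closedBall c' r') ≤ μ (Metric.closedBall c' r')) :
    ∑ j ∈ F, μ₂ (Metric.closedBall (c j) (r j)) ≤
      η ^ (m - n - 1) * μ₂ (Metric.closedBall c' r') := by
  have hnull : ∀ j, μ₂ (Metric.closedBall (c j) (r j)) ≤ μ₂ (Metric.ball (c j) (r j)) := by
    intro j
    have h0 : μ₂ (Metric.sphere (c j) (r j)) = 0 := hac₂ (by
      rw [Real.sphere_eq_pair _ (hr j).le]; exact (Set.toFinite _).measure_zero _)
    rw [← Metric.ball_union_sphere]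
    exact (measure_union_le _ _).trans (by rw [h0, add_zero])
  set U : Set ℝ := ⋃ j ∈ F, Metric.ball (c j) (r j) with hU
  have hUo : IsOpen U := isOpen_biUnion fun _ _ => Metric.isOpen_ball
  have hdb : (F : Set ι).PairwiseDisjoint fun j => Metric.ball (c j) (r j) :=
    hd.mono fun j => Metric.ball_subset_closedBall
  have hUs : U ⊆ Metric.closedBall c' r' :=
    iUnion₂_subset fun j hj => Metric.ball_subset_closedBall.trans (hsub j hj)
  have hL0 : L ≠ 0 := (zero_lt_one.trans hL).ne'
  have hU1 : μ U ≤ L ^ (n + 1) * μ (E ∩ Metric.closedBall c' r') := by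
    calc μ U ≤ ∑ j ∈ F, μ (Metric.ball (c j) (r j)) := measure_biUnion_finset_le _ _
      _ ≤ ∑ j ∈ F, L ^ (n + 1) * μ (E ∩ Metric.closedBall (c j) (r j)) :=
          Finset.sum_le_sum fun j hj =>
            (measure_mono Metric.ball_subset_closedBall).trans (hn j hj)
      _ = L ^ (n + 1) * ∑ j ∈ F, μ (E ∩ Metric.closedBall (c j) (r j)) := by rw [Finset.mul_sum]
      _ ≤ L ^ (n + 1) * μ (E ∩ ⋃ j ∈ F, Metric.closedBall (c j) (r j)) := by
          gcongr
          exact sum_measure_inter_le E F (fun _ _ => measurableSet_closedBall) hd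
      _ ≤ _ := mul_le_mul_right
          (measure_mono (inter_subset_inter_right _ (iUnion₂_subset hsub))) _
  have hkey : L ^ (m - n) * μ U ≤ L * μ (Metric.closedBall c' r') := by
    rcases le_total m n with h | h
    · rw [Nat.sub_eq_zero_of_le h, pow_zero, one_mul]
      exact (measure_mono hUs).trans (le_mul_of_one_le_left' hL.le)
    · refine (ENNReal.mul_le_mul_iff_right (pow_ne_zero n hL0) (ENNReal.pow_ne_top hLt)).1 ?_
      calc L ^ n * (L ^ (m - n) * μ U) = L ^ m * μ U := by
            rw [← mul_assoc, ← pow_add, Nat.add_sub_cancel' h]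
        _ ≤ L ^ m * (L ^ (n + 1) * μ (E ∩ Metric.closedBall c' r')) := by gcongr
        _ = L ^ n * (L * (L ^ m * μ (E ∩ Metric.closedBall c' r'))) := by ring
        _ ≤ _ := by gcongr
  have hlt : c' - r' < c' + r' := by linarith
  have := htr _ _ hlt (m - n) U hUo (by
    rw [← Real.closedBall_eq_Icc, inter_eq_left.2 hUs]; exact hkey)
  rw [← Real.closedBall_eq_Icc, inter_eq_left.2 hUs] at this
  refine le_trans ?_ this
  rw [hU, measure_biUnion_finset hdb fun _ _ => measurableSet_ball]
  exact Finset.sum_le_sum fun j _ => hnull j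

theorem sum_pairs_le (hμ : IsAInfty μ) (hμ₂ : IsAInfty μ₂) {α β γ : ℝ} (hα : 0 ≤ α) (hβ : 0 ≤ β)
    (hγ : 0 ≤ γ) (habc : α + β + γ = 1)
    (hμ₁₂ : ∀ c r, 0 < r → μ (Metric.closedBall c r) ^ (α + β) ≤
      μ₁ (Metric.closedBall c r) ^ α * μ₂ (Metric.closedBall c r) ^ β)
    {D : ℝ≥0∞} (hD : ∀ c r, 0 < r →
      μ₂ (Metric.closedBall c (3 * r)) ≤ D * μ₂ (Metric.closedBall c r))
    {L η : ℝ≥0∞} (hL : 1 < L) (hLt : L ≠ ∞)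
    (htr : ∀ a b, a < b → ∀ (k : ℕ) (U : Set ℝ), IsOpen U →
      L ^ k * μ (U ∩ Icc a b) ≤ L * μ (Icc a b) →
      μ₂ (U ∩ Icc a b) ≤ η ^ (k - 1) * μ₂ (Icc a b))
    {φ ψ : Set ℝ → ℝ≥0∞} {N₁ N₂ : ℝ≥0∞}
    (hφ : ∀ {ι : Type} (s : Finset ι) (c r : ι → ℝ),
      (s : Set ι).PairwiseDisjoint (fun i => Metric.closedBall (c i) (r i)) →
      ∑ i ∈ s, φ (Metric.closedBall (c i) (r i)) ≤ N₁)
    (hψ : ∀ {ι : Type} (s : Finset ι) (c r : ι → ℝ),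
      (s : Set ι).PairwiseDisjoint (fun i => Metric.closedBall (c i) (r i)) →
      ∑ i ∈ s, ψ (Metric.closedBall (c i) (r i)) ≤ N₂)
    {ι κ : Type} [DecidableEq ι] [DecidableEq κ] (P : Finset (ι × κ)) (c r : ι → ℝ)
    (c' r' : κ → ℝ) (u : ι → ℝ≥0∞) (v : κ → ℝ≥0∞) (hr : ∀ i, 0 < r i) (hr' : ∀ k, 0 < r' k)
    (hu : ∀ x ∈ P, u x.1 * μ₁ (Metric.closedBall (c x.1) (r x.1)) ^ α ≤
      φ (Metric.closedBall (c x.1) (r x.1)) ^ α)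
    (hv : ∀ x ∈ P, v x.2 * μ₂ (Metric.closedBall (c' x.2) (r' x.2)) ^ β ≤
      ψ (Metric.closedBall (c' x.2) (r' x.2)) ^ β)
    (h1 : (P.image Prod.fst : Set ι).PairwiseDisjoint fun j => Metric.closedBall (c j) (r j))
    (h2 : (P.image Prod.snd : Set κ).PairwiseDisjoint
      fun k => Metric.closedBall (c' k) (3 * r' k))
    (hrr : ∀ x ∈ P, r x.1 ≤ r' x.2)
    (hne : ∀ x ∈ P, (Metric.closedBall (c x.1) (r x.1) ∩
      Metric.closedBall (c' x.2) (r' x.2)).Nonempty)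
    (E : Set ℝ) (n m : ℕ)
    (hn : ∀ x ∈ P, L ^ n * μ (E ∩ Metric.closedBall (c x.1) (r x.1)) ≤
        μ (Metric.closedBall (c x.1) (r x.1)) ∧
      μ (Metric.closedBall (c x.1) (r x.1)) ≤
        L ^ (n + 1) * μ (E ∩ Metric.closedBall (c x.1) (r x.1)))
    (hm : ∀ x ∈ P, L ^ m * μ (E ∩ Metric.closedBall (c' x.2) (3 * r' x.2)) ≤
      μ (Metric.closedBall (c' x.2) (3 * r' x.2)))
    {X X' : ℝ≥0∞} (hX : ∑ j ∈ P.image Prod.fst, μ (E ∩ Metric.closedBall (c j) (r j)) ≤ X)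
    (hX' : ∑ k ∈ P.image Prod.snd, μ (E ∩ Metric.closedBall (c' k) (3 * r' k)) ≤ X') :
    L ^ n * ∑ x ∈ P, u x.1 * v x.2 * μ (E ∩ (Metric.closedBall (c x.1) (r x.1) ∩
      Metric.closedBall (c' x.2) (r' x.2))) ≤
      N₁ ^ α * (η ^ (m - n - 1) * D * N₂) ^ β *
        ((L ^ (n + 1) * X) ^ (γ / 2) * (L ^ (n + 1) * X') ^ (γ / 2)) := by
  set B : ι → Set ℝ := fun j => Metric.closedBall (c j) (r j) with hBdef
  set B' : κ → Set ℝ := fun k => Metric.closedBall (c' k) (r' k) with hB'def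
  set T : κ → Set ℝ := fun k => Metric.closedBall (c' k) (3 * r' k) with hTdef
  change L ^ n * ∑ x ∈ P, u x.1 * v x.2 * μ (E ∩ (B x.1 ∩ B' x.2)) ≤ _
  have hBT : ∀ x ∈ P, B x.1 ⊆ T x.2 := fun x hx =>
    closedBall_subset_closedBall_three (hrr x hx) (hne x hx)
  have hB'T : ∀ k, B' k ⊆ T k := fun k =>
    Metric.closedBall_subset_closedBall (by linarith [hr' k])
  have hinj : Set.InjOn Prod.fst (P : Set (ι × κ)) := by
    intro x hx y hy hxy
    refine Prod.ext hxy ?_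
    by_contra hne'
    have hd := h2 (Finset.mem_coe.2 (Finset.mem_image_of_mem Prod.snd hx))
      (Finset.mem_coe.2 (Finset.mem_image_of_mem Prod.snd hy)) hne'
    obtain ⟨z, hz, -⟩ := hne x hx
    exact Set.disjoint_left.1 hd (hBT x hx hz) (hBT y hy (by rw [← hxy]; exact hz))
  have hterm : ∀ x ∈ P, L ^ n * (u x.1 * v x.2 * μ (E ∩ (B x.1 ∩ B' x.2))) ≤
      φ (B x.1) ^ α * (ψ (B' x.2) * (μ₂ (B x.1) / μ₂ (B' x.2))) ^ β * μ (B x.1) ^ γ := by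
    intro x hx
    have hw0 : μ₂ (B' x.2) ≠ 0 := (hμ₂.closedBall_pos (hr' _)).ne'
    have hwt : μ₂ (B' x.2) ≠ ∞ := (hμ₂.closedBall_lt_top _ _).ne
    have h0 : μ (B x.1) ≠ 0 := (hμ.closedBall_pos (hr _)).ne'
    have ht : μ (B x.1) ≠ ∞ := (hμ.closedBall_lt_top _ _).ne
    have hv' : v x.2 * μ₂ (B x.1) ^ β ≤ (ψ (B' x.2) * (μ₂ (B x.1) / μ₂ (B' x.2))) ^ β := by
      rw [ENNReal.mul_rpow_of_nonneg _ _ hβ]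
      refine le_trans ?_ (mul_le_mul_left (hv x hx) _)
      rw [mul_assoc, ← ENNReal.mul_rpow_of_nonneg _ _ hβ, ENNReal.mul_div_cancel hw0 hwt]
    calc L ^ n * (u x.1 * v x.2 * μ (E ∩ (B x.1 ∩ B' x.2)))
        ≤ L ^ n * (u x.1 * v x.2 * μ (E ∩ B x.1)) := by
          gcongr; exact inter_subset_left
      _ = u x.1 * v x.2 * (L ^ n * μ (E ∩ B x.1)) := by ring
      _ ≤ u x.1 * v x.2 * μ (B x.1) := mul_le_mul_right (hn x hx).1 _
      _ = u x.1 * v x.2 * (μ (B x.1) ^ (α + β) * μ (B x.1) ^ γ) := by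
          rw [← ENNReal.rpow_add _ _ h0 ht, habc, ENNReal.rpow_one]
      _ ≤ u x.1 * v x.2 * ((μ₁ (B x.1) ^ α * μ₂ (B x.1) ^ β) * μ (B x.1) ^ γ) := by
          gcongr; exact hμ₁₂ _ _ (hr _)
      _ = (u x.1 * μ₁ (B x.1) ^ α) * (v x.2 * μ₂ (B x.1) ^ β) * μ (B x.1) ^ γ := by ring
      _ ≤ _ := mul_le_mul_left (mul_le_mul' (hu x hx) hv') _
  have hsum_fst : ∀ f : ι → ℝ≥0∞, ∑ x ∈ P, f x.1 = ∑ j ∈ P.image Prod.fst, f j := fun f =>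
    (Finset.sum_image hinj).symm
  have s1 : ∑ x ∈ P, φ (B x.1) ≤ N₁ := by
    rw [hsum_fst fun j => φ (B j)]; exact hφ _ c r h1
  have s3 : ∑ x ∈ P, μ (B x.1) ≤
      L ^ (n + 1) * ∑ j ∈ P.image Prod.fst, μ (E ∩ B j) := by
    rw [← hsum_fst fun j => μ (E ∩ B j), Finset.mul_sum]
    exact Finset.sum_le_sum fun x hx => (hn x hx).2
  have s3' : ∑ j ∈ P.image Prod.fst, μ (E ∩ B j) ≤ X' :=
    (sum_inter_le_of_pairs P E B T (fun _ => measurableSet_closedBall) h1 hBT).trans hX'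
  have s2 : ∑ x ∈ P, ψ (B' x.2) * (μ₂ (B x.1) / μ₂ (B' x.2)) ≤ η ^ (m - n - 1) * D * N₂ := by
    rw [← Finset.sum_fiberwise_of_maps_to (t := P.image Prod.snd) (g := Prod.snd)
      (fun x hx => Finset.mem_image_of_mem _ hx)]
    calc _ ≤ ∑ k ∈ P.image Prod.snd, η ^ (m - n - 1) * D * ψ (B' k) := by
          refine Finset.sum_le_sum fun k hk => ?_
          obtain ⟨x₀, hx₀, rfl⟩ := Finset.mem_image.1 hk
          set k := x₀.2
          have hw0 : μ₂ (B' k) ≠ 0 := (hμ₂.closedBall_pos (hr' _)).ne'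
          have hwt : μ₂ (B' k) ≠ ∞ := (hμ₂.closedBall_lt_top _ _).ne
          set Q := P.filter fun x => x.2 = k with hQ
          have hQP : ∀ x ∈ Q, x ∈ P ∧ x.2 = k := fun x hx => Finset.mem_filter.1 hx
          have e : ∑ x ∈ Q, μ₂ (B x.1) = ∑ j ∈ Q.image Prod.fst, μ₂ (B j) :=
            (Finset.sum_image (f := fun j => μ₂ (B j))
              (hinj.mono fun x hx => (hQP x hx).1)).symm
          have hQ1 : ∑ j ∈ Q.image Prod.fst, μ₂ (B j) ≤ η ^ (m - n - 1) * μ₂ (T k) := by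
            refine sum_measure_closedBall_le_of_transfer hμ₂.ac hL hLt htr _ c r hr
              (by linarith [hr' k]) (h1.subset ?_) ?_ E n m ?_ (hm x₀ hx₀)
            · exact_mod_cast Finset.image_subset_image (Finset.filter_subset _ _)
            · intro j hj
              obtain ⟨x, hx, rfl⟩ := Finset.mem_image.1 hj
              have := hBT x (hQP x hx).1
              rwa [(hQP x hx).2] at this
            · intro j hj
              obtain ⟨x, hx, rfl⟩ := Finset.mem_image.1 hj
              exact (hn x (hQP x hx).1).2
          calc ∑ x ∈ Q, ψ (B' x.2) * (μ₂ (B x.1) / μ₂ (B' x.2))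
              = ∑ x ∈ Q, ψ (B' k) * (μ₂ (B' k))⁻¹ * μ₂ (B x.1) := by
                refine Finset.sum_congr rfl fun x hx => ?_
                rw [(hQP x hx).2, div_eq_mul_inv]; ring
            _ = ψ (B' k) * (μ₂ (B' k))⁻¹ * ∑ x ∈ Q, μ₂ (B x.1) := by rw [Finset.mul_sum]
            _ ≤ ψ (B' k) * (μ₂ (B' k))⁻¹ * (η ^ (m - n - 1) * (D * μ₂ (B' k))) := by
                rw [e]
                exact mul_le_mul_right (hQ1.trans (mul_le_mul_right (hD _ _ (hr' k)) _)) _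
            _ = ((μ₂ (B' k))⁻¹ * μ₂ (B' k)) * (η ^ (m - n - 1) * D * ψ (B' k)) := by ring
            _ = _ := by rw [ENNReal.inv_mul_cancel hw0 hwt, one_mul]
      _ = η ^ (m - n - 1) * D * ∑ k ∈ P.image Prod.snd, ψ (B' k) := by rw [Finset.mul_sum]
      _ ≤ _ := by
          gcongr
          exact hψ _ c' r' (h2.mono fun k => hB'T k)
  rw [Finset.mul_sum]
  refine (Finset.sum_le_sum hterm).trans ((sum_rpow_mul_rpow_mul_rpow_le P _ _ _ hα hβ hγ
    habc).trans ?_)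
  refine mul_le_mul' (mul_le_mul' (ENNReal.rpow_le_rpow s1 hα) (ENNReal.rpow_le_rpow s2 hβ)) ?_
  rw [← add_halves γ, ENNReal.rpow_add_of_nonneg _ _ (by linarith) (by linarith), add_halves]
  exact mul_le_mul' (ENNReal.rpow_le_rpow (s3.trans (mul_le_mul_right hX _)) (by linarith))
    (ENNReal.rpow_le_rpow (s3.trans (mul_le_mul_right s3' _)) (by linarith))

theorem sum_le_of_fiberwise {ι : Type*} (P : Finset ι) (f : ι → ℝ≥0∞) (ℓ : ι → ℕ × ℕ × ℕ × ℕ)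
    {C ρ : ℝ≥0∞}
    (h : ∀ b : ℕ × ℕ × ℕ × ℕ, ∑ x ∈ P with ℓ x = b, f x ≤
      C * (ρ ^ b.1 * (ρ ^ b.2.1 * (ρ ^ b.2.2.1 * ρ ^ b.2.2.2)))) :
    ∑ x ∈ P, f x ≤ C * ((1 - ρ)⁻¹ * ((1 - ρ)⁻¹ * ((1 - ρ)⁻¹ * (1 - ρ)⁻¹))) := by
  classical
  rw [← Finset.sum_fiberwise_of_maps_to (t := P.image ℓ) (g := ℓ)
      (fun x hx => Finset.mem_image_of_mem _ hx)]
  refine (Finset.sum_le_sum fun b _ => h b).trans ((ENNReal.sum_le_tsum _).trans ?_)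
  simp only [ENNReal.tsum_mul_left, ENNReal.tsum_prod', ENNReal.tsum_mul_right,
    ENNReal.tsum_geometric]
  exact le_rfl

theorem pow_mul_pow_sub_le {x τ ρ : ℝ≥0∞} (hρ : ρ ≤ 1) (h0 : ρ ≠ 0) (hx : x ≤ ρ ^ 2) (hτ : τ ≤ ρ)
    (n m : ℕ) : x ^ n * τ ^ (m - n - 1) ≤ ρ⁻¹ * (ρ ^ n * ρ ^ m) := by
  have ht : ρ ≠ ∞ := (hρ.trans_lt one_lt_top).ne
  refine (ENNReal.mul_le_mul_iff_right h0 ht).1 ?_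
  rw [← mul_assoc ρ ρ⁻¹, ENNReal.mul_inv_cancel h0 ht, one_mul, ← pow_add]
  calc ρ * (x ^ n * τ ^ (m - n - 1)) ≤ ρ * ((ρ ^ 2) ^ n * ρ ^ (m - n - 1)) := by gcongr
    _ = ρ ^ (1 + (2 * n + (m - n - 1))) := by rw [pow_add, pow_add, pow_mul, pow_one]
    _ ≤ ρ ^ (n + m) := pow_le_pow_right_of_le_one' hρ (by omega)

theorem class_bound {L D M₁ M₂ η η₁ η₂ N₁ N₂ V T ρ : ℝ≥0∞} {α β γ : ℝ} (hβ : 0 ≤ β)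
    (hγ : 0 ≤ γ) (hL : 1 < L) (hLt : L ≠ ∞) (hρ : ρ ≤ 1) (h0 : ρ ≠ 0)
    (hρL : L ^ (γ - 1) ≤ ρ ^ 2) (hρη : η ^ β ≤ ρ) (hρ₁ : η₁ ^ (γ / 2) ≤ ρ)
    (hρ₂ : η₂ ^ (γ / 2) ≤ ρ) (n m g g' : ℕ)
    (h : L ^ n * T ≤ N₁ ^ α * (η ^ (m - n - 1) * D * N₂) ^ β *
        ((L ^ (n + 1) * (M₁ * η₁ ^ g * V)) ^ (γ / 2) *
          (L ^ (n + 1) * (M₂ * η₂ ^ g' * V)) ^ (γ / 2))) :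
    T ≤ (D ^ β * L ^ γ * (M₁ ^ (γ / 2) * M₂ ^ (γ / 2)) * ρ⁻¹) * (N₁ ^ α * N₂ ^ β * V ^ γ) *
      (ρ ^ n * (ρ ^ m * (ρ ^ g * ρ ^ g'))) := by
  have hγ2 : 0 ≤ γ / 2 := by linarith
  have hL0 : L ≠ 0 := (zero_lt_one.trans hL).ne'
  have hpow : ∀ (x : ℝ≥0∞) (k : ℕ) (z : ℝ), (x ^ k) ^ z = (x ^ z) ^ k := fun x k z => by
    rw [← ENNReal.rpow_natCast, ← ENNReal.rpow_mul, mul_comm, ENNReal.rpow_mul,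
      ENNReal.rpow_natCast]
  have hhalf : ∀ x : ℝ≥0∞, x ^ (γ / 2) * x ^ (γ / 2) = x ^ γ := fun x => by
    rw [← ENNReal.rpow_add_of_nonneg _ _ hγ2 hγ2, add_halves]
  have hLγ : L ^ γ = L * L ^ (γ - 1) := by
    conv_rhs => rw [← ENNReal.rpow_one L, ← ENNReal.rpow_mul, one_mul]
    rw [← ENNReal.rpow_add _ _ hL0 hLt]; congr 1; ring
  refine (ENNReal.mul_le_mul_iff_right (pow_ne_zero n hL0) (ENNReal.pow_ne_top hLt)).1
    (h.trans ?_)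
  simp only [ENNReal.mul_rpow_of_nonneg _ _ hβ, ENNReal.mul_rpow_of_nonneg _ _ hγ2, hpow]
  calc _ = L ^ n * ((D ^ β * L ^ γ * (M₁ ^ (γ / 2) * M₂ ^ (γ / 2))) * (N₁ ^ α * N₂ ^ β * V ^ γ) *
        (((L ^ (γ - 1)) ^ n * (η ^ β) ^ (m - n - 1)) *
          ((η₁ ^ (γ / 2)) ^ g * (η₂ ^ (γ / 2)) ^ g'))) := by
        have e : (L ^ γ) ^ (n + 1) = L ^ γ * (L ^ n * (L ^ (γ - 1)) ^ n) := by
          rw [pow_succ', ← mul_pow, ← hLγ]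
        have e2 : (L ^ (γ / 2)) ^ (n + 1) * (L ^ (γ / 2)) ^ (n + 1) = (L ^ γ) ^ (n + 1) := by
          rw [← mul_pow, hhalf]
        calc _ = (D ^ β * (M₁ ^ (γ / 2) * M₂ ^ (γ / 2))) * (N₁ ^ α * N₂ ^ β) *
              (V ^ (γ / 2) * V ^ (γ / 2)) *
              ((L ^ (γ / 2)) ^ (n + 1) * (L ^ (γ / 2)) ^ (n + 1)) *
              ((η ^ β) ^ (m - n - 1) * ((η₁ ^ (γ / 2)) ^ g * (η₂ ^ (γ / 2)) ^ g')) := by ring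
          _ = _ := by rw [hhalf, e2, e]; ring
    _ ≤ L ^ n * ((D ^ β * L ^ γ * (M₁ ^ (γ / 2) * M₂ ^ (γ / 2))) * (N₁ ^ α * N₂ ^ β * V ^ γ) *
        ((ρ⁻¹ * (ρ ^ n * ρ ^ m)) * (ρ ^ g * ρ ^ g'))) := by
        exact mul_le_mul_right (mul_le_mul_right (mul_le_mul'
          (pow_mul_pow_sub_le hρ h0 hρL hρη n m)
          (mul_le_mul' (pow_le_pow_left' hρ₁ g) (pow_le_pow_left' hρ₂ g'))) _) _
    _ = _ := by ring

variable {μ μ₁ μ₂ : Measure ℝ}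

theorem exists_ordered_pairs_bound (hμ : IsAInfty μ) (hμ₂ : IsAInfty μ₂) {α β γ : ℝ} (hα : 0 < α)
    (hβ : 0 < β) (hγ : 0 < γ) (habc : α + β + γ = 1)
    (hμ₁₂ : ∀ c r, 0 < r → μ (Metric.closedBall c r) ^ (α + β) ≤
      μ₁ (Metric.closedBall c r) ^ α * μ₂ (Metric.closedBall c r) ^ β)
    {Λ : ℝ≥0∞} (hΛ : Λ ≠ ∞) :
    ∃ C : ℝ≥0∞, C ≠ ∞ ∧ ∀ (φ ψ : Set ℝ → ℝ≥0∞) (N₁ N₂ : ℝ≥0∞),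
    (∀ {ι : Type} (s : Finset ι) (c r : ι → ℝ),
      (s : Set ι).PairwiseDisjoint (fun i => Metric.closedBall (c i) (r i)) →
      ∑ i ∈ s, φ (Metric.closedBall (c i) (r i)) ≤ N₁) →
    (∀ {ι : Type} (s : Finset ι) (c r : ι → ℝ),
      (s : Set ι).PairwiseDisjoint (fun i => Metric.closedBall (c i) (r i)) →
      ∑ i ∈ s, ψ (Metric.closedBall (c i) (r i)) ≤ N₂) →
    ∀ {ι κ : Type} (J : Finset ι) (K : Finset κ) (c r : ι → ℝ)
    (c' r' : κ → ℝ) (A : ι → Set ℝ) (A' : κ → Set ℝ) (u : ι → ℝ≥0∞) (v : κ → ℝ≥0∞)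
    (E : Set ℝ), (∀ i, 0 < r i) → (∀ k, 0 < r' k) →
    (∀ i ∈ J, MeasurableSet (A i)) → (∀ i ∈ J, A i ⊆ Metric.closedBall (c i) (r i)) →
    (J : Set ι).PairwiseDisjoint A →
    (∀ i ∈ J, μ (Metric.closedBall (c i) (r i)) ≤ Λ * μ (A i)) →
    (∀ k ∈ K, MeasurableSet (A' k)) → (∀ k ∈ K, A' k ⊆ Metric.closedBall (c' k) (r' k)) →
    (K : Set κ).PairwiseDisjoint A' →
    (∀ k ∈ K, μ (Metric.closedBall (c' k) (r' k)) ≤ Λ * μ (A' k)) →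
    (∀ j ∈ J, u j * μ₁ (Metric.closedBall (c j) (r j)) ^ α ≤
      φ (Metric.closedBall (c j) (r j)) ^ α) →
    (∀ k ∈ K, v k * μ₂ (Metric.closedBall (c' k) (r' k)) ^ β ≤
      ψ (Metric.closedBall (c' k) (r' k)) ^ β) →
    ∑ x ∈ J ×ˢ K with r x.1 ≤ r' x.2, u x.1 * v x.2 *
      μ (E ∩ (Metric.closedBall (c x.1) (r x.1) ∩ Metric.closedBall (c' x.2) (r' x.2))) ≤
      C * (N₁ ^ α * N₂ ^ β * μ E ^ γ) := by
  classical
  obtain ⟨L, hL, hLt, η, hη, htr⟩ := IsAInfty.exists_transfer hμ hμ₂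
  obtain ⟨D, hDt, hD⟩ := hμ₂.exists_doubling (κ := 3) (by norm_num)
  obtain ⟨D', hD't, hD'⟩ := hμ.exists_doubling (κ := 3) (by norm_num)
  obtain ⟨M₁, η₁, hM₁, hη₁, hlab₁⟩ := hμ.exists_labels hΛ hL hLt
  obtain ⟨M₂, η₂, hM₂, hη₂, hlab₂⟩ := hμ.exists_labels (ENNReal.mul_ne_top hD't hΛ) hL hLt
  set ρ : ℝ≥0∞ := max 2⁻¹ (max (L ^ ((γ - 1) / 2))
    (max (η ^ β) (max (η₁ ^ (γ / 2)) (η₂ ^ (γ / 2))))) with hρdef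
  have hγ2 : 0 < γ / 2 := by linarith
  have hρ1 : ρ < 1 := by
    simp only [hρdef, max_lt_iff]
    exact ⟨ENNReal.inv_lt_one.2 ENNReal.one_lt_two,
      ENNReal.rpow_lt_one_of_one_lt_of_neg hL (by linarith),
      ENNReal.rpow_lt_one hη hβ, ENNReal.rpow_lt_one hη₁ hγ2, ENNReal.rpow_lt_one hη₂ hγ2⟩
  have hρ0 : ρ ≠ 0 := by
    refine (lt_of_lt_of_le ?_ (le_max_left _ _)).ne'
    exact ENNReal.inv_pos.2 ENNReal.ofNat_ne_top
  have hρL : L ^ (γ - 1) ≤ ρ ^ 2 := by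
    have h1 : L ^ ((γ - 1) / 2) ≤ ρ := (le_max_left _ _).trans (le_max_right _ _)
    calc L ^ (γ - 1) = (L ^ ((γ - 1) / 2)) ^ 2 := by
          rw [← ENNReal.rpow_natCast, ← ENNReal.rpow_mul]; congr 1; push_cast; ring
      _ ≤ ρ ^ 2 := by gcongr
  have hρη : η ^ β ≤ ρ := by simp [hρdef]
  have hρ₁ : η₁ ^ (γ / 2) ≤ ρ := by simp [hρdef]
  have hρ₂ : η₂ ^ (γ / 2) ≤ ρ := by simp [hρdef]
  set C₀ := D ^ β * L ^ γ * (M₁ ^ (γ / 2) * M₂ ^ (γ / 2)) * ρ⁻¹ with hC₀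
  set G := (1 - ρ)⁻¹ * ((1 - ρ)⁻¹ * ((1 - ρ)⁻¹ * (1 - ρ)⁻¹)) with hG
  have hGt : G ≠ ∞ := by
    have : (1 - ρ)⁻¹ ≠ ∞ := ENNReal.inv_ne_top.2 (tsub_pos_of_lt hρ1).ne'
    exact ENNReal.mul_ne_top this (ENNReal.mul_ne_top this (ENNReal.mul_ne_top this this))
  have hC₀t : C₀ ≠ ∞ := by
    have hf : ∀ {x : ℝ≥0∞} {z : ℝ}, x ≠ ∞ → 0 ≤ z → x ^ z ≠ ∞ := fun h hz =>
      ENNReal.rpow_ne_top_of_nonneg hz h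
    exact ENNReal.mul_ne_top (ENNReal.mul_ne_top (ENNReal.mul_ne_top (hf hDt hβ.le)
      (hf hLt hγ.le)) (ENNReal.mul_ne_top (hf hM₁ hγ2.le) (hf hM₂ hγ2.le)))
      (ENNReal.inv_ne_top.2 hρ0)
  refine ⟨C₀ * G, ENNReal.mul_ne_top hC₀t hGt, ?_⟩
  intro φ ψ N₁ N₂ hφ hψ ι κ J K c r c' r' A A' u v E hr hr' hAm hAs hAd hAw hA'm hA's hA'd hA'w
    hu hv
  obtain ⟨s, g, hs, hg⟩ := hlab₁ c r A J E hr hAm hAs hAd hAw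
  have hr'3 : ∀ k, 0 < 3 * r' k := fun k => by linarith [hr' k]
  obtain ⟨s', g', hs', hg'⟩ := hlab₂ c' (fun k => 3 * r' k) A' K E hr'3 hA'm
    (fun k hk => (hA's k hk).trans (Metric.closedBall_subset_closedBall (by linarith [hr' k])))
    hA'd (fun k hk => (hD' _ _ (hr' k)).trans (by
      rw [mul_assoc]; exact mul_le_mul_right (hA'w k hk) _))
  set F : ι × κ → ℝ≥0∞ := fun x => u x.1 * v x.2 *
      μ (E ∩ (Metric.closedBall (c x.1) (r x.1) ∩ Metric.closedBall (c' x.2) (r' x.2))) with hF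
  set P := (J ×ˢ K).filter fun x => r x.1 ≤ r' x.2 ∧
    μ (E ∩ (Metric.closedBall (c x.1) (r x.1) ∩ Metric.closedBall (c' x.2) (r' x.2))) ≠ 0 with hP
  have hsum : ∑ x ∈ J ×ˢ K with r x.1 ≤ r' x.2, F x = ∑ x ∈ P, F x := by
    symm
    refine Finset.sum_subset ?_ ?_
    · intro x hx
      rw [hP, Finset.mem_filter] at hx
      exact Finset.mem_filter.2 ⟨hx.1, hx.2.1⟩
    · intro x hx hx'
      rw [Finset.mem_filter] at hx
      by_contra hne
      refine hx' (Finset.mem_filter.2 ⟨hx.1, hx.2, fun h => hne ?_⟩)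
      simp only [hF, h, mul_zero]
  rw [hsum]
  have hmain := sum_le_of_fiberwise P F (fun x => (s x.1, s' x.2, g x.1, g' x.2))
    (C := C₀ * (N₁ ^ α * N₂ ^ β * μ E ^ γ)) (ρ := ρ) ?_
  · refine hmain.trans (le_of_eq ?_)
    rw [← hG]; ring
  rintro ⟨n, m, a, b⟩
  set Q := P.filter fun x => (s x.1, s' x.2, g x.1, g' x.2) = (n, m, a, b) with hQ
  have hQm : ∀ x ∈ Q, (x.1 ∈ J ∧ x.2 ∈ K) ∧ r x.1 ≤ r' x.2 ∧
      μ (E ∩ (Metric.closedBall (c x.1) (r x.1) ∩ Metric.closedBall (c' x.2) (r' x.2))) ≠ 0 ∧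
      s x.1 = n ∧ s' x.2 = m ∧ g x.1 = a ∧ g' x.2 = b := by
    intro x hx
    rw [hQ, Finset.mem_filter, hP, Finset.mem_filter, Finset.mem_product] at hx
    obtain ⟨⟨h1, h2, h3⟩, h4⟩ := hx
    simp only [Prod.mk.injEq] at h4
    exact ⟨h1, h2, h3, h4⟩
  have hE1 : ∀ x ∈ Q, μ (E ∩ Metric.closedBall (c x.1) (r x.1)) ≠ 0 := fun x hx h =>
    (hQm x hx).2.2.1 (measure_mono_null (inter_subset_inter_right _ inter_subset_left) h)
  have hE2 : ∀ x ∈ Q, μ (E ∩ Metric.closedBall (c' x.2) (3 * r' x.2)) ≠ 0 := fun x hx h =>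
    (hQm x hx).2.2.1 (measure_mono_null (inter_subset_inter_right _ (inter_subset_right.trans
      (Metric.closedBall_subset_closedBall (by linarith [hr' x.2])))) h)
  have hf1 : ∀ j ∈ Q.image Prod.fst, j ∈ J ∧ μ (E ∩ Metric.closedBall (c j) (r j)) ≠ 0 ∧
      s j = n ∧ g j = a := by
    intro j hj
    obtain ⟨x, hx, rfl⟩ := Finset.mem_image.1 hj
    obtain ⟨h1, h2, h3, h4, h5, h6, h7⟩ := hQm x hx
    exact ⟨h1.1, hE1 x hx, h4, h6⟩
  have hf2 : ∀ k ∈ Q.image Prod.snd, k ∈ K ∧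
      μ (E ∩ Metric.closedBall (c' k) (3 * r' k)) ≠ 0 ∧ s' k = m ∧ g' k = b := by
    intro k hk
    obtain ⟨x, hx, rfl⟩ := Finset.mem_image.1 hk
    obtain ⟨h1, h2, h3, h4, h5, h6, h7⟩ := hQm x hx
    exact ⟨h1.2, hE2 x hx, h5, h7⟩
  refine class_bound hβ.le hγ.le hL hLt hρ1.le hρ0 hρL hρη hρ₁ hρ₂ n m a b ?_
  refine sum_pairs_le hμ hμ₂ hα.le hβ.le hγ.le habc hμ₁₂ hD hL hLt htr hφ hψ Q c r c' r' u v hr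
    hr' (fun x hx => hu _ (hQm x hx).1.1) (fun x hx => hv _ (hQm x hx).1.2)
    ((hg n a).1.subset fun j hj => hf1 j hj) ((hg' m b).1.subset fun k hk => hf2 k hk)
    (fun x hx => (hQm x hx).2.1) (fun x hx => ?_) E n m (fun x hx => ?_) (fun x hx => ?_)
    ((hg n a).2 _ (fun j hj => (hf1 j hj).1) fun j hj => (hf1 j hj).2)
    ((hg' m b).2 _ (fun k hk => (hf2 k hk).1) fun k hk => (hf2 k hk).2)
  · exact (nonempty_of_measure_ne_zero (hQm x hx).2.2.1).mono inter_subset_right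
  · have := hs x.1 (hQm x hx).1.1 (hE1 x hx)
    rwa [(hQm x hx).2.2.2.1] at this
  · have := (hs' x.2 (hQm x hx).1.2 (hE2 x hx)).1
    rwa [(hQm x hx).2.2.2.2.1] at this

/-- A family of intervals with pairwise disjoint subsets of at least half their lengths. -/
structure IsSparse (S : Set (ℕ × ℝ × ℝ)) (A : ℕ × ℝ × ℝ → Set ℝ) : Prop where
  pos : ∀ s ∈ S, 0 < s.2.2
  measurableSet : ∀ s ∈ S, MeasurableSet (A s)
  subset : ∀ s ∈ S, A s ⊆ base s.2
  volume_le : ∀ s ∈ S, ENNReal.ofReal s.2.2 ≤ 2 * volume (A s)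
  disjoint : S.PairwiseDisjoint A

theorem triple_eq_closedBall (P : ℝ × ℝ) :
    triple P = Metric.closedBall (P.1 + P.2 / 2) (3 / 2 * P.2) := by
  rw [Real.closedBall_eq_Icc, triple]; congr 1 <;> ring

theorem base_subset_triple {P : ℝ × ℝ} (hP : 0 < P.2) : base P ⊆ triple P := by
  intro x hx
  exact ⟨by linarith [hx.1], by linarith [hx.2]⟩

theorem volume_triple (P : ℝ × ℝ) : volume (triple P) = 3 * ENNReal.ofReal P.2 := by
  rw [triple, Real.volume_Icc, show P.1 + 2 * P.2 - (P.1 - P.2) = 3 * P.2 by ring,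
    ENNReal.ofReal_mul (by norm_num)]
  norm_num

theorem IsAInfty.exists_carleson {μ : Measure ℝ} (hμ : IsAInfty μ) : ∃ Λ : ℝ≥0∞, Λ ≠ ∞ ∧
    ∀ (S : Set (ℕ × ℝ × ℝ)) (A : ℕ × ℝ × ℝ → Set ℝ), IsSparse S A → ∀ s ∈ S,
      μ (triple s.2) ≤ Λ * μ (A s) := by
  obtain ⟨Λ, hΛ, h⟩ := hμ.exists_le_mul (κ := 6) (by simp)
  refine ⟨Λ, hΛ, fun S A hS s hs => h _ _ (by linarith [hS.pos s hs]) _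
    ((hS.subset s hs).trans (base_subset_triple (hS.pos s hs))) (hS.measurableSet s hs) ?_⟩
  change volume (triple s.2) ≤ _
  rw [volume_triple]
  calc 3 * ENNReal.ofReal s.2.2 ≤ 3 * (2 * volume (A s)) := by gcongr; exact hS.volume_le s hs
    _ = 6 * volume (A s) := by rw [← mul_assoc]; norm_num

theorem mean_mul_rpow_le {q : ℝ} (hq : 1 ≤ q) {w : ℝ → ℝ} (hw : IsWeight w)
    {f : ℝ → ℝ} (hf : Measurable f) {P : ℝ × ℝ} (hP : 0 < P.2) :
    mean f P * wMeasure w (triple P) ^ (1 / q) ≤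
      3 * AqRConstR q w * localNorm q (wMeasure w) f (triple P) := by
  have h := lintegral_mul_le_localNorm hq hw hf (a := P.1 - P.2) (b := P.1 + 2 * P.2) (by linarith)
  change (∫⁻ x in triple P, ‖f x‖ₑ) * wMeasure w (triple P) ^ (1 / q) ≤
    _ * volume (triple P) * localNorm q (wMeasure w) f (triple P) at h
  rw [volume_triple] at h
  have h0 : ENNReal.ofReal P.2 ≠ 0 := by simpa using hP
  refine (ENNReal.mul_le_mul_iff_right h0 ENNReal.ofReal_ne_top).1 ?_
  rw [mean, ← mul_assoc, ENNReal.mul_div_cancel h0 ENNReal.ofReal_ne_top]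
  exact h.trans (le_of_eq (by ring))

theorem exists_ordered_sparse_bound {p₁ p₂ : ℝ} (hp₁ : 1 ≤ p₁) (hp₂ : 1 ≤ p₂) {w₁ w₂ : ℝ → ℝ}
    (hw₁ : IsWeight w₁) (hw₂ : IsWeight w₂) (hR₁ : AqRConstR p₁ w₁ < ⊤)
    (hR₂ : AqRConstR p₂ w₂ < ⊤) {μ : Measure ℝ} (hμ : IsAInfty μ) {γ : ℝ} (hγ : 0 < γ)
    (hγp : 1 / (4 * p₁) + 1 / (4 * p₂) + γ = 1)
    (hμ₁₂ : ∀ c r, 0 < r → μ (Metric.closedBall c r) ^ (1 / (4 * p₁) + 1 / (4 * p₂)) ≤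
      wMeasure w₁ (Metric.closedBall c r) ^ (1 / (4 * p₁)) *
        wMeasure w₂ (Metric.closedBall c r) ^ (1 / (4 * p₂))) :
    ∃ C : ℝ≥0∞, C ≠ ∞ ∧ ∀ f₁ f₂ : ℝ → ℝ, Measurable f₁ → Measurable f₂ →
    ∀ (S S' : Set (ℕ × ℝ × ℝ)) (A A' : ℕ × ℝ × ℝ → Set ℝ), IsSparse S A → IsSparse S' A' →
    ∀ (J : Finset S) (K : Finset S') (E : Set ℝ),
      ∑ x ∈ J ×ˢ K with x.1.1.2.2 ≤ x.2.1.2.2,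
        mean f₁ x.1.1.2 ^ (1 / 4 : ℝ) * mean f₂ x.2.1.2 ^ (1 / 4 : ℝ) *
          μ (E ∩ (triple x.1.1.2 ∩ triple x.2.1.2)) ≤
      C * (lorentz p₁ 1 (wMeasure w₁) f₁ ^ (1 / 4 : ℝ) *
        lorentz p₂ 1 (wMeasure w₂) f₂ ^ (1 / 4 : ℝ) * μ E ^ γ) := by
  obtain ⟨Λ, hΛ, hcar⟩ := hμ.exists_carleson
  have hα : 0 < 1 / (4 * p₁) := by positivity
  have hβ : 0 < 1 / (4 * p₂) := by positivity
  obtain ⟨C, hC, hmain⟩ := exists_ordered_pairs_bound hμ (isAInfty_of_restricted hp₂ hw₂ hR₂) hα hβ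
    hγ hγp hμ₁₂ hΛ
  have hq : (0 : ℝ) ≤ 1 / 4 := by norm_num
  refine ⟨C * ((3 * AqRConstR p₁ w₁) ^ (1 / 4 : ℝ) * (3 * AqRConstR p₂ w₂) ^ (1 / 4 : ℝ)),
    ENNReal.mul_ne_top hC (ENNReal.mul_ne_top
      (ENNReal.rpow_ne_top_of_nonneg hq (ENNReal.mul_ne_top (by simp) hR₁.ne))
      (ENNReal.rpow_ne_top_of_nonneg hq (ENNReal.mul_ne_top (by simp) hR₂.ne))), ?_⟩
  intro f₁ f₂ hf₁ hf₂ S S' A A' hS hS' J K E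
  have hsuper : ∀ {p : ℝ}, 1 ≤ p → ∀ (w : ℝ → ℝ) {f : ℝ → ℝ}, Measurable f → ∀ {ι : Type}
      (s : Finset ι) (c r : ι → ℝ),
      (s : Set ι).PairwiseDisjoint (fun i => Metric.closedBall (c i) (r i)) →
      ∑ i ∈ s, (3 * AqRConstR p w *
        localNorm p (wMeasure w) f (Metric.closedBall (c i) (r i))) ^ p ≤
        (3 * AqRConstR p w * lorentz p 1 (wMeasure w) f) ^ p := by
    intro p hp w f hf ι s c r hd
    have hp0 : 0 ≤ p := by linarith
    simp only [ENNReal.mul_rpow_of_nonneg _ _ hp0]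
    rw [← Finset.mul_sum, ← localNorm_univ]
    gcongr
    exact sum_localNorm_rpow_le hp _ hf s (fun _ _ => measurableSet_closedBall) hd
  have hpow : ∀ {p : ℝ}, 1 ≤ p → ∀ x : ℝ≥0∞, (x ^ p) ^ (1 / (4 * p)) = x ^ (1 / 4 : ℝ) := by
    intro p hp x
    rw [← ENNReal.rpow_mul]; congr 1
    have : p ≠ 0 := by positivity
    field_simp
  have havg : ∀ {p : ℝ}, 1 ≤ p → ∀ {w : ℝ → ℝ}, IsWeight w → ∀ {f : ℝ → ℝ}, Measurable f →
      ∀ P : ℝ × ℝ, 0 < P.2 → mean f P ^ (1 / 4 : ℝ) * wMeasure w (triple P) ^ (1 / (4 * p)) ≤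
        ((3 * AqRConstR p w * localNorm p (wMeasure w) f (triple P)) ^ p) ^ (1 / (4 * p)) := by
    intro p hp w hw f hf P hP
    rw [hpow hp]
    refine le_trans (le_of_eq ?_) (ENNReal.rpow_le_rpow (mean_mul_rpow_le hp hw hf hP) hq)
    rw [ENNReal.mul_rpow_of_nonneg _ _ hq, ← ENNReal.rpow_mul]
    congr 2
    have : p ≠ 0 := by positivity
    field_simp
  have h := hmain
    (fun R => (3 * AqRConstR p₁ w₁ * localNorm p₁ (wMeasure w₁) f₁ R) ^ p₁)
    (fun R => (3 * AqRConstR p₂ w₂ * localNorm p₂ (wMeasure w₂) f₂ R) ^ p₂) _ _ (hsuper hp₁ w₁ hf₁) (hsuper hp₂ w₂ hf₂) J K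
    (fun s => s.1.2.1 + s.1.2.2 / 2) (fun s => 3 / 2 * s.1.2.2)
    (fun s => s.1.2.1 + s.1.2.2 / 2) (fun s => 3 / 2 * s.1.2.2) (fun s => A s) (fun s => A' s)
    (fun s => mean f₁ s.1.2 ^ (1 / 4 : ℝ)) (fun s => mean f₂ s.1.2 ^ (1 / 4 : ℝ)) E
    (fun s => by have := hS.pos s s.2; positivity) (fun s => by have := hS'.pos s s.2; positivity)
    (fun s _ => hS.measurableSet s s.2)
    (fun s _ => by
      rw [← triple_eq_closedBall]
      exact (hS.subset s s.2).trans (base_subset_triple (hS.pos s s.2)))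
    (fun s _ t _ hst => hS.disjoint s.2 t.2 fun h => hst (Subtype.ext h))
    (fun s _ => by rw [← triple_eq_closedBall]; exact hcar S A hS s s.2)
    (fun s _ => hS'.measurableSet s s.2)
    (fun s _ => by
      rw [← triple_eq_closedBall]
      exact (hS'.subset s s.2).trans (base_subset_triple (hS'.pos s s.2)))
    (fun s _ t _ hst => hS'.disjoint s.2 t.2 fun h => hst (Subtype.ext h))
    (fun s _ => by rw [← triple_eq_closedBall]; exact hcar S' A' hS' s s.2)
    (fun s _ => by rw [← triple_eq_closedBall]; exact havg hp₁ hw₁ hf₁ _ (hS.pos s s.2))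
    (fun s _ => by rw [← triple_eq_closedBall]; exact havg hp₂ hw₂ hf₂ _ (hS'.pos s s.2))
  simp only [← triple_eq_closedBall, hpow hp₁, hpow hp₂, ENNReal.mul_rpow_of_nonneg _ _ hq,
    mul_le_mul_iff_right₀ (show (0 : ℝ) < 3 / 2 by norm_num)] at h
  refine h.trans (le_of_eq ?_)
  simp only [ENNReal.mul_rpow_of_nonneg _ _ hq]
  ring

theorem exists_sparse_bound {p₁ p₂ : ℝ} (hp₁ : 1 ≤ p₁) (hp₂ : 1 ≤ p₂) {w₁ w₂ : ℝ → ℝ}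
    (hw₁ : IsWeight w₁) (hw₂ : IsWeight w₂) (hR₁ : AqRConstR p₁ w₁ < ⊤)
    (hR₂ : AqRConstR p₂ w₂ < ⊤) {μ : Measure ℝ} (hμ : IsAInfty μ) {γ : ℝ} (hγ : 0 < γ)
    (hγp : 1 / (4 * p₁) + 1 / (4 * p₂) + γ = 1)
    (hμ₁₂ : ∀ c r, 0 < r → μ (Metric.closedBall c r) ^ (1 / (4 * p₁) + 1 / (4 * p₂)) ≤
      wMeasure w₁ (Metric.closedBall c r) ^ (1 / (4 * p₁)) *
        wMeasure w₂ (Metric.closedBall c r) ^ (1 / (4 * p₂))) :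
    ∃ C : ℝ≥0∞, C ≠ ∞ ∧ ∀ f₁ f₂ : ℝ → ℝ, Measurable f₁ → Measurable f₂ →
    ∀ (S S' : Set (ℕ × ℝ × ℝ)) (A A' : ℕ × ℝ × ℝ → Set ℝ), IsSparse S A → IsSparse S' A' →
    ∀ (J : Finset S) (K : Finset S') (E : Set ℝ),
      ∑ x ∈ J ×ˢ K, mean f₁ x.1.1.2 ^ (1 / 4 : ℝ) * mean f₂ x.2.1.2 ^ (1 / 4 : ℝ) *
          μ (E ∩ (triple x.1.1.2 ∩ triple x.2.1.2)) ≤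
      C * (lorentz p₁ 1 (wMeasure w₁) f₁ ^ (1 / 4 : ℝ) *
        lorentz p₂ 1 (wMeasure w₂) f₂ ^ (1 / 4 : ℝ) * μ E ^ γ) := by
  classical
  obtain ⟨C₁, hC₁, h₁⟩ := exists_ordered_sparse_bound hp₁ hp₂ hw₁ hw₂ hR₁ hR₂ hμ hγ hγp hμ₁₂
  obtain ⟨C₂, hC₂, h₂⟩ := exists_ordered_sparse_bound hp₂ hp₁ hw₂ hw₁ hR₂ hR₁ hμ hγ
    (by linarith) (fun c r hr => by rw [add_comm, mul_comm (wMeasure w₂ _ ^ _)]; exact hμ₁₂ c r hr)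
  refine ⟨C₁ + C₂, ENNReal.add_ne_top.2 ⟨hC₁, hC₂⟩, ?_⟩
  intro f₁ f₂ hf₁ hf₂ S S' A A' hS hS' J K E
  rw [← Finset.sum_filter_add_sum_filter_not (J ×ˢ K) fun x => x.1.1.2.2 ≤ x.2.1.2.2, add_mul]
  refine add_le_add (h₁ f₁ f₂ hf₁ hf₂ S S' A A' hS hS' J K E) ?_
  have h := h₂ f₂ f₁ hf₂ hf₁ S' S A' A hS' hS K J E
  rw [mul_comm (lorentz p₂ 1 (wMeasure w₂) f₂ ^ (1 / 4 : ℝ))] at h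
  refine le_trans ?_ h
  refine (Finset.sum_le_sum_of_subset (t := (J ×ˢ K).filter fun x => x.2.1.2.2 ≤ x.1.1.2.2)
    fun x hx => ?_).trans (le_of_eq ?_)
  · rw [Finset.mem_filter] at hx ⊢
    exact ⟨hx.1, (not_le.1 hx.2).le⟩
  · refine Finset.sum_equiv (Equiv.prodComm _ _) (fun x => ?_) fun x _ => ?_
    · simp only [Finset.mem_filter, Finset.mem_product, Equiv.prodComm_apply, Prod.fst_swap,
        Prod.snd_swap, and_comm]
    · simp only [Equiv.prodComm_apply, Prod.fst_swap, Prod.snd_swap]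
      rw [inter_comm (triple x.1.1.2), mul_comm (mean f₁ x.1.1.2 ^ (1 / 4 : ℝ))]

/-- The sum of the fourth roots of the averages over the members of a family. -/
def rootSum (f : ℝ → ℝ) (S : Set (ℕ × ℝ × ℝ)) (x : ℝ) : ℝ≥0∞ :=
  ∑' s : S, (triple s.1.2).indicator (fun _ => mean f s.1.2 ^ (1 / 4 : ℝ)) x

theorem measurable_rootSum (f : ℝ → ℝ) {S : Set (ℕ × ℝ × ℝ)} (hS : S.Countable) :
    Measurable (rootSum f S) := by
  have := hS.to_subtype
  exact Measurable.tsum fun s => measurable_const.indicator (measurableSet_triple _)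

theorem sum_mean_rpow_le_rootSum (f : ℝ → ℝ) {S : Set (ℕ × ℝ × ℝ)} {x : ℝ}
    (hS : ∀ s ∈ S, 0 < s.2.2) (F : Finset (ℕ × ℝ × ℝ)) (hF : ∀ s ∈ F, s ∈ S ∧ x ∈ base s.2) :
    (∑ s ∈ F, mean f s.2) ^ (1 / 4 : ℝ) ≤ rootSum f S x := by
  classical
  refine (Finset.le_sum_of_subadditive (fun y : ℝ≥0∞ => y ^ (1 / 4 : ℝ))
    (ENNReal.zero_rpow_of_pos (by norm_num)).le
    (fun a b => ENNReal.rpow_add_le_add_rpow a b (by norm_num) (by norm_num)) F _).trans ?_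
  have h1 : ∑ s ∈ F, mean f s.2 ^ (1 / 4 : ℝ) =
      ∑ s ∈ F.subtype (· ∈ S), (triple s.1.2).indicator (fun _ => mean f s.1.2 ^ (1 / 4 : ℝ)) x := by
    rw [← Finset.sum_subtype_of_mem (p := (· ∈ S)) _ fun s hs => (hF s hs).1]
    refine Finset.sum_congr rfl fun s hs => ?_
    rw [indicator_of_mem]
    exact base_subset_triple (hS s s.2) (hF s (Finset.mem_subtype.1 hs)).2
  rw [h1]
  exact ENNReal.sum_le_tsum _

theorem setLIntegral_rootSum_mul_le {μ : Measure ℝ} {f₁ f₂ : ℝ → ℝ} {S S' : Set (ℕ × ℝ × ℝ)}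
    (hS : S.Countable) (hS' : S'.Countable) (E : Set ℝ) {R : ℝ≥0∞}
    (h : ∀ (J : Finset S) (K : Finset S'),
      ∑ x ∈ J ×ˢ K, mean f₁ x.1.1.2 ^ (1 / 4 : ℝ) * mean f₂ x.2.1.2 ^ (1 / 4 : ℝ) *
          μ (E ∩ (triple x.1.1.2 ∩ triple x.2.1.2)) ≤ R) :
    ∫⁻ x in E, rootSum f₁ S x * rootSum f₂ S' x ∂μ ≤ R := by
  classical
  have := hS.to_subtype
  have := hS'.to_subtype
  have e : ∀ x, rootSum f₁ S x * rootSum f₂ S' x = ∑' s : S × S',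
      (triple s.1.1.2 ∩ triple s.2.1.2).indicator
        (fun _ => mean f₁ s.1.1.2 ^ (1 / 4 : ℝ) * mean f₂ s.2.1.2 ^ (1 / 4 : ℝ)) x := by
    intro x
    rw [ENNReal.tsum_prod', rootSum, ← ENNReal.tsum_mul_right]
    refine tsum_congr fun s => ?_
    rw [rootSum, ← ENNReal.tsum_mul_left]
    refine tsum_congr fun s' => ?_
    rw [inter_indicator_mul]
  simp only [e]
  have hm : ∀ s : S × S', MeasurableSet (triple s.1.1.2 ∩ triple s.2.1.2) := fun s =>
    (measurableSet_triple _).inter (measurableSet_triple _)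
  rw [lintegral_tsum fun s => (measurable_const.indicator (hm s)).aemeasurable,
    ENNReal.tsum_eq_iSup_sum]
  refine iSup_le fun P => ?_
  refine le_trans ?_ (h (P.image Prod.fst) (P.image Prod.snd))
  refine (Finset.sum_le_sum_of_subset (t := P.image Prod.fst ×ˢ P.image Prod.snd) ?_).trans
    (le_of_eq ?_)
  · exact fun x hx => Finset.mem_product.2
      ⟨Finset.mem_image_of_mem _ hx, Finset.mem_image_of_mem _ hx⟩
  · refine Finset.sum_congr rfl fun x _ => ?_
    rw [lintegral_indicator_const (hm x), Measure.restrict_apply (hm x), inter_comm E]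

theorem exists_local_weak_bound {p p₁ p₂ : ℝ} (hp₁ : 1 ≤ p₁) (hp₂ : 1 ≤ p₂)
    (hp : 1 / p = 1 / p₁ + 1 / p₂) {w₁ w₂ : ℝ → ℝ}
    (hw₁ : IsWeight w₁) (hw₂ : IsWeight w₂) (hR₁ : AqRConstR p₁ w₁ < ⊤)
    (hR₂ : AqRConstR p₂ w₂ < ⊤) {μ : Measure ℝ} (hμ : IsAInfty μ)
    (hμ₁₂ : ∀ c r, 0 < r → μ (Metric.closedBall c r) ^ (1 / (4 * p₁) + 1 / (4 * p₂)) ≤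
      wMeasure w₁ (Metric.closedBall c r) ^ (1 / (4 * p₁)) *
        wMeasure w₂ (Metric.closedBall c r) ^ (1 / (4 * p₂))) :
    ∃ C : ℝ≥0∞, C ≠ ∞ ∧ ∀ f₁ f₂ : ℝ → ℝ, Measurable f₁ → Measurable f₂ →
      Integrable f₁ → Integrable f₂ → ∀ Q : ℝ × ℝ, 0 < Q.2 → (triple Q).indicator f₁ = f₁ →
      (triple Q).indicator f₂ = f₂ → ∀ t : ℝ, 0 < t →
      ENNReal.ofReal t * μ (base Q ∩ {x | t < ‖hilbertR f₁ x * hilbertR f₂ x‖}) ^ (1 / p) ≤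
        C * (lorentz p₁ 1 (wMeasure w₁) f₁ * lorentz p₂ 1 (wMeasure w₂) f₂) := by
  have hp₁0 : 0 < p₁ := by linarith
  have hp₂0 : 0 < p₂ := by linarith
  have hq : (0 : ℝ) ≤ 1 / 4 := by norm_num
  have i1 : 1 / p₁ ≤ 1 := (div_le_one hp₁0).2 hp₁
  have i2 : 1 / p₂ ≤ 1 := (div_le_one hp₂0).2 hp₂
  have e1 : 1 / (4 * p₁) = 1 / 4 * (1 / p₁) := by field_simp
  have e2 : 1 / (4 * p₂) = 1 / 4 * (1 / p₂) := by field_simp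
  set γ := 1 - 1 / 4 * (1 / p) with hγdef
  have hγ : 0 < γ := by rw [hγdef, hp]; linarith
  have hγ1 : 0 < 1 - γ := by
    rw [hγdef, hp]
    have : 0 < 1 / p₁ := by positivity
    have : 0 < 1 / p₂ := by positivity
    linarith
  obtain ⟨C, hC, hbound⟩ := exists_sparse_bound hp₁ hp₂ hw₁ hw₂ hR₁ hR₂ hμ hγ
    (by rw [hγdef, hp, e1, e2]; ring) hμ₁₂
  set k : ℝ≥0∞ := ENNReal.ofReal 101500 ^ (1 / 4 : ℝ) with hk
  have hkt : k ≠ ∞ := ENNReal.rpow_ne_top_of_nonneg hq ENNReal.ofReal_ne_top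
  refine ⟨(k * k * C) ^ (4 : ℝ), ENNReal.rpow_ne_top_of_nonneg (by norm_num)
    (ENNReal.mul_ne_top (ENNReal.mul_ne_top hkt hkt) hC), ?_⟩
  intro f₁ f₂ hm₁ hm₂ hi₁ hi₂ Q hQ hs₁ hs₂ t ht
  obtain ⟨S, A, hSc, hSp, hSd, hS⟩ := exists_sparse hm₁ hi₁ hQ
  obtain ⟨S', A', hSc', hSp', hSd', hS'⟩ := exists_sparse hm₂ hi₂ hQ
  have hSA : IsSparse S A := ⟨fun s hs => (hSp s hs).1, fun s hs => (hSp s hs).2.1,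
    fun s hs => (hSp s hs).2.2.1, fun s hs => (hSp s hs).2.2.2, hSd⟩
  have hSA' : IsSparse S' A' := ⟨fun s hs => (hSp' s hs).1, fun s hs => (hSp' s hs).2.1,
    fun s hs => (hSp' s hs).2.2.1, fun s hs => (hSp' s hs).2.2.2, hSd'⟩
  set N := lorentz p₁ 1 (wMeasure w₁) f₁ ^ (1 / 4 : ℝ) *
    lorentz p₂ 1 (wMeasure w₂) f₂ ^ (1 / 4 : ℝ) with hN
  set τ := ENNReal.ofReal t ^ (1 / 4 : ℝ) with hτ
  set E : Set ℝ := base Q ∩ {x | τ ≤ k * k * (rootSum f₁ S x * rootSum f₂ S' x)} with hE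
  have hEm : MeasurableSet E := (measurableSet_base Q).inter (measurableSet_le measurable_const
    (((measurable_rootSum f₁ hSc).mul (measurable_rootSum f₂ hSc')).const_mul _))
  have hEt : μ E ≠ ∞ := ne_top_of_le_ne_top (hμ.fin Q.1 (Q.1 + Q.2)).ne
    (measure_mono (inter_subset_left.trans Ico_subset_Icc_self))
  have hle : μ (base Q ∩ {x | t < ‖hilbertR f₁ x * hilbertR f₂ x‖}) ≤ μ E := by
    refine measure_mono_ae (hμ.ac.ae_le ?_)
    have hroot : ∀ {f : ℝ → ℝ} {S : Set (ℕ × ℝ × ℝ)}, Integrable f →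
        (triple Q).indicator f = f → (∀ s ∈ S, 0 < s.2.2) →
        (∀ᵐ x, x ∈ base Q → ∃ F : Finset (ℕ × ℝ × ℝ), (∀ s ∈ F, s ∈ S ∧ x ∈ base s.2) ∧
        upperHilbert ((triple Q).indicator f) x ≤
          ENNReal.ofReal 101500 * ∑ s ∈ F, mean f s.2) →
        ∀ᵐ x, x ∈ base Q → ‖hilbertR f x‖ₑ ^ (1 / 4 : ℝ) ≤ k * rootSum f S x := by
      intro f S hi hs hpos h
      filter_upwards [h, upperHilbert_eq hi] with x hx hux hxQ
      obtain ⟨F, hF, hFx⟩ := hx hxQ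
      rw [hs, hux] at hFx
      refine (ENNReal.rpow_le_rpow hFx hq).trans ?_
      rw [ENNReal.mul_rpow_of_nonneg _ _ hq]
      exact mul_le_mul_right (sum_mean_rpow_le_rootSum f hpos F hF) _
    filter_upwards [hroot hi₁ hs₁ hSA.pos hS, hroot hi₂ hs₂ hSA'.pos hS'] with x h1 h2 hx
    obtain ⟨hxQ, hxt⟩ := hx
    refine ⟨hxQ, ?_⟩
    have h3 : ENNReal.ofReal t ≤ ‖hilbertR f₁ x‖ₑ * ‖hilbertR f₂ x‖ₑ := by
      rw [← enorm_mul, ← ofReal_norm]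
      exact ENNReal.ofReal_le_ofReal (le_of_lt hxt)
    calc τ ≤ (‖hilbertR f₁ x‖ₑ * ‖hilbertR f₂ x‖ₑ) ^ (1 / 4 : ℝ) := ENNReal.rpow_le_rpow h3 hq
      _ = ‖hilbertR f₁ x‖ₑ ^ (1 / 4 : ℝ) * ‖hilbertR f₂ x‖ₑ ^ (1 / 4 : ℝ) :=
          ENNReal.mul_rpow_of_nonneg _ _ hq
      _ ≤ (k * rootSum f₁ S x) * (k * rootSum f₂ S' x) := mul_le_mul' (h1 hxQ) (h2 hxQ)
      _ = _ := by ring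
  have hmain : τ * μ E ≤ k * k * (C * (N * μ E ^ γ)) := by
    calc τ * μ E = ∫⁻ _ in E, τ ∂μ := by rw [setLIntegral_const]
      _ ≤ ∫⁻ x in E, k * k * (rootSum f₁ S x * rootSum f₂ S' x) ∂μ :=
          setLIntegral_mono' hEm fun x hx => hx.2
      _ = k * k * ∫⁻ x in E, rootSum f₁ S x * rootSum f₂ S' x ∂μ :=
          lintegral_const_mul _ ((measurable_rootSum f₁ hSc).mul (measurable_rootSum f₂ hSc'))
      _ ≤ _ := mul_le_mul_right (setLIntegral_rootSum_mul_le hSc hSc' E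
          (hbound f₁ f₂ hm₁ hm₂ S S' A A' hSA hSA' · · E)) _
  have hmain2 : τ * μ E ^ (1 - γ) ≤ k * k * C * N := by
    rcases eq_or_ne (μ E) 0 with h0 | h0
    · rw [h0, ENNReal.zero_rpow_of_pos hγ1, mul_zero]; exact zero_le
    have hz : μ E ^ γ ≠ 0 := (ENNReal.rpow_pos (pos_iff_ne_zero.2 h0) hEt).ne'
    have hzt : μ E ^ γ ≠ ∞ := ENNReal.rpow_ne_top_of_nonneg hγ.le hEt
    refine (ENNReal.mul_le_mul_iff_left hz hzt).1 ?_
    rw [mul_assoc, ← ENNReal.rpow_add _ _ h0 hEt, sub_add_cancel, ENNReal.rpow_one]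
    exact hmain.trans (le_of_eq (by ring))
  have h4 : (0 : ℝ) ≤ 4 := by norm_num
  have hroot4 : ∀ x : ℝ≥0∞, (x ^ (1 / 4 : ℝ)) ^ (4 : ℝ) = x := fun x => by
    rw [← ENNReal.rpow_mul]; norm_num
  have hfin := ENNReal.rpow_le_rpow hmain2 h4
  rw [ENNReal.mul_rpow_of_nonneg _ _ h4, ENNReal.mul_rpow_of_nonneg (k * k * C) _ h4, hN,
    ENNReal.mul_rpow_of_nonneg (_ ^ (1 / 4 : ℝ)) _ h4, hτ, hroot4, hroot4, hroot4,
    ← ENNReal.rpow_mul, show (1 - γ) * 4 = 1 / p by rw [hγdef]; ring] at hfin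
  refine le_trans (mul_le_mul_right (ENNReal.rpow_le_rpow hle ?_) _) hfin
  rw [hp]; positivity

theorem exists_lintegral_div_le {p : ℝ} (hp : 1 ≤ p) {w : ℝ → ℝ} (hw : IsWeight w)
    (hR : AqRConstR p w < ⊤) : ∃ C : ℝ≥0∞, C ≠ ∞ ∧ ∀ f : ℝ → ℝ, Measurable f →
      ∫⁻ t, ‖f t / (1 + |t|)‖ₑ ≤ C * lorentz p 1 (wMeasure w) f := by
  have hp0 : 0 < 1 / p := by positivity
  have hμ := isAInfty_of_restricted hp hw hR
  set μ := wMeasure w with hμdef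
  obtain ⟨η, hη, hhalf⟩ := hμ.exists_half
  set I : ℕ → Set ℝ := fun k => Icc (-(2 : ℝ) ^ k) (2 ^ k) with hI
  have hlt : ∀ k : ℕ, -(2 : ℝ) ^ k < 2 ^ k := fun k => by
    have : (0 : ℝ) < 2 ^ k := by positivity
    linarith
  have hvol : ∀ k, volume (I k) = ENNReal.ofReal (2 * 2 ^ k) := fun k => by
    rw [hI, Real.volume_Icc]; congr 1; ring
  have hdecay : ∀ k, μ (I 0) ≤ η ^ k * μ (I k) := by
    intro k
    induction k with
    | zero => simp
    | succ k ih =>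
      refine ih.trans ?_
      rw [pow_succ, mul_assoc]
      gcongr
      have h2 : (2 : ℝ) ^ k ≤ 2 ^ (k + 1) := pow_le_pow_right₀ (by norm_num) (by omega)
      refine hhalf _ _ (hlt (k + 1)) _ (Icc_subset_Icc (by linarith) h2) measurableSet_Icc ?_
      change 2 * volume (I k) ≤ volume (I (k + 1))
      rw [hvol, hvol, show (2 : ℝ≥0∞) = ENNReal.ofReal 2 by simp,
        ← ENNReal.ofReal_mul (by norm_num)]
      exact ENNReal.ofReal_le_ofReal (by rw [pow_succ]; linarith)
  set σ := η ^ (1 / p) with hσ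
  have hσ1 : σ < 1 := ENNReal.rpow_lt_one hη hp0
  set m := μ (I 0) ^ (1 / p) with hm
  have hI0 : μ (I 0) ≠ 0 := (hμ.pos _ _ (hlt 0)).ne'
  have hI0t : μ (I 0) ≠ ∞ := (hμ.fin _ _).ne
  have hm0 : m ≠ 0 := (ENNReal.rpow_pos (pos_iff_ne_zero.2 hI0) hI0t).ne'
  have hmt : m ≠ ∞ := ENNReal.rpow_ne_top_of_nonneg hp0.le hI0t
  refine ⟨4 * AqRConstR p w * (1 - σ)⁻¹ * m⁻¹, ?_, fun f hf => ?_⟩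
  · exact ENNReal.mul_ne_top (ENNReal.mul_ne_top (ENNReal.mul_ne_top (by simp) hR.ne)
      (ENNReal.inv_ne_top.2 (tsub_pos_of_lt hσ1).ne')) (ENNReal.inv_ne_top.2 hm0)
  have hpt : ∀ t, ‖f t / (1 + |t|)‖ₑ ≤
      ∑' k : ℕ, (I k).indicator (fun t => ENNReal.ofReal (2 * (2 ^ k)⁻¹) * ‖f t‖ₑ) t := by
    intro t
    classical
    have hex : ∃ k : ℕ, |t| ≤ 2 ^ k := by
      obtain ⟨k, hk⟩ := pow_unbounded_of_one_lt |t| (show (1 : ℝ) < 2 by norm_num)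
      exact ⟨k, hk.le⟩
    refine le_trans ?_ (ENNReal.le_tsum (Nat.find hex))
    have hk := Nat.find_spec hex
    have hkm : ∀ j < Nat.find hex, ¬ |t| ≤ 2 ^ j := fun j hj => Nat.find_min hex hj
    generalize Nat.find hex = k at hk hkm
    rw [indicator_of_mem (show t ∈ I k from abs_le.1 hk), ← ofReal_norm, ← ofReal_norm,
      ← ENNReal.ofReal_mul (by positivity)]
    refine ENNReal.ofReal_le_ofReal ?_
    have h1t : 0 < 1 + |t| := by positivity
    rw [norm_div, Real.norm_of_nonneg h1t.le, div_eq_inv_mul]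
    refine mul_le_mul_of_nonneg_right ?_ (norm_nonneg _)
    have h2k : (0 : ℝ) < 2 ^ k := by positivity
    rw [← div_eq_mul_inv, inv_eq_one_div, div_le_div_iff₀ h1t h2k]
    rcases k with _ | k
    · have := abs_nonneg t
      norm_num; linarith
    · have := not_le.1 (hkm k (by omega))
      rw [pow_succ]; linarith
  have hlocal : ∀ k, m * (ENNReal.ofReal (2 * (2 ^ k)⁻¹) * ∫⁻ t in I k, ‖f t‖ₑ) ≤
      4 * AqRConstR p w * lorentz p 1 μ f * σ ^ k := by
    intro k
    have hmk : m ≤ σ ^ k * μ (I k) ^ (1 / p) := by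
      refine (ENNReal.rpow_le_rpow (hdecay k) hp0.le).trans (le_of_eq ?_)
      rw [ENNReal.mul_rpow_of_nonneg _ _ hp0.le, hσ, ← ENNReal.rpow_natCast, ← ENNReal.rpow_mul,
        mul_comm (k : ℝ), ENNReal.rpow_mul, ENNReal.rpow_natCast]
    have h := lintegral_mul_le_localNorm hp hw hf (hlt k)
    change (∫⁻ x in I k, ‖f x‖ₑ) * μ (I k) ^ (1 / p) ≤
      _ * volume (I k) * localNorm p μ f (I k) at h
    have hn : localNorm p μ f (I k) ≤ lorentz p 1 μ f := by
      rw [← localNorm_univ]; exact localNorm_mono (by linarith) _ _ (subset_univ _)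
    have h4 : ENNReal.ofReal (2 * (2 ^ k)⁻¹) * volume (I k) = 4 := by
      have : (2 : ℝ) ^ k ≠ 0 := by positivity
      rw [hvol, ← ENNReal.ofReal_mul (by positivity),
        show 2 * ((2 : ℝ) ^ k)⁻¹ * (2 * 2 ^ k) = 4 by field_simp; norm_num]
      norm_num
    calc m * (ENNReal.ofReal (2 * (2 ^ k)⁻¹) * ∫⁻ t in I k, ‖f t‖ₑ)
        ≤ (σ ^ k * μ (I k) ^ (1 / p)) *
          (ENNReal.ofReal (2 * (2 ^ k)⁻¹) * ∫⁻ t in I k, ‖f t‖ₑ) := mul_le_mul_left hmk _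
      _ = σ ^ k * ENNReal.ofReal (2 * (2 ^ k)⁻¹) *
          ((∫⁻ t in I k, ‖f t‖ₑ) * μ (I k) ^ (1 / p)) := by ring
      _ ≤ σ ^ k * ENNReal.ofReal (2 * (2 ^ k)⁻¹) *
          (AqRConstR p w * volume (I k) * lorentz p 1 μ f) :=
          mul_le_mul_right (h.trans (mul_le_mul_right hn _)) _
      _ = (ENNReal.ofReal (2 * (2 ^ k)⁻¹) * volume (I k)) *
          (AqRConstR p w * lorentz p 1 μ f * σ ^ k) := by ring
      _ = _ := by rw [h4]; ring
  refine (ENNReal.mul_le_mul_iff_right hm0 hmt).1 ?_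
  calc m * ∫⁻ t, ‖f t / (1 + |t|)‖ₑ
      ≤ m * ∫⁻ t, ∑' k : ℕ, (I k).indicator
        (fun t => ENNReal.ofReal (2 * (2 ^ k)⁻¹) * ‖f t‖ₑ) t :=
        mul_le_mul_right (lintegral_mono hpt) _
    _ = m * ∑' k : ℕ, ENNReal.ofReal (2 * (2 ^ k)⁻¹) * ∫⁻ t in I k, ‖f t‖ₑ := by
        rw [lintegral_tsum fun k =>
          ((hf.enorm.const_mul _).indicator measurableSet_Icc).aemeasurable]
        congr 1
        refine tsum_congr fun k => ?_
        rw [lintegral_indicator measurableSet_Icc, lintegral_const_mul _ hf.enorm]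
    _ = ∑' k : ℕ, m * (ENNReal.ofReal (2 * (2 ^ k)⁻¹) * ∫⁻ t in I k, ‖f t‖ₑ) :=
        ENNReal.tsum_mul_left.symm
    _ ≤ ∑' k : ℕ, 4 * AqRConstR p w * lorentz p 1 μ f * σ ^ k := ENNReal.tsum_le_tsum hlocal
    _ = (m * m⁻¹) * (4 * AqRConstR p w * (1 - σ)⁻¹ * lorentz p 1 μ f) := by
        rw [ENNReal.tsum_mul_left, ENNReal.tsum_geometric, ENNReal.mul_inv_cancel hm0 hmt]; ring
    _ = _ := by ring

theorem hilbertR_eq_zero {f : ℝ → ℝ} (hf : f =ᵐ[volume] 0) (x : ℝ) : hilbertR f x = 0 := by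
  have h : ∀ ε : ℝ, ∫ t in {t : ℝ | ε < |x - t|}, f t / (x - t) = 0 := fun ε =>
    integral_eq_zero_of_ae (ae_restrict_of_ae (by
      filter_upwards [hf] with t ht
      rw [ht]; simp))
  simp only [hilbertR, h]
  exact tendsto_const_nhds.limUnder_eq

theorem lorentz_cutoff_le {p : ℝ} (hp : 0 < p) (μ : Measure ℝ) (f : ℝ → ℝ) (n : ℕ) :
    lorentz p 1 μ (cutoff n f) ≤ lorentz p 1 μ f := by
  rw [← localNorm_univ, ← localNorm_univ]
  refine lintegral_mono fun t => ENNReal.rpow_le_rpow (measure_mono ?_) (by positivity)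
  refine inter_subset_inter_left _ fun x hx => ?_
  have hx' : t < |cutoff n f x| := hx
  change t < |f x|
  refine lt_of_lt_of_le hx' ?_
  simpa only [Real.norm_eq_abs, cutoff] using norm_indicator_le_norm_self f x

theorem exists_weak_bound {p p₁ p₂ : ℝ} (hp₁ : 1 ≤ p₁) (hp₂ : 1 ≤ p₂)
    (hp : 1 / p = 1 / p₁ + 1 / p₂) {w₁ w₂ : ℝ → ℝ}
    (hw₁ : IsWeight w₁) (hw₂ : IsWeight w₂) (hR₁ : AqRConstR p₁ w₁ < ⊤)
    (hR₂ : AqRConstR p₂ w₂ < ⊤) {μ : Measure ℝ} (hμ : IsAInfty μ)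
    (hμ₁₂ : ∀ c r, 0 < r → μ (Metric.closedBall c r) ^ (1 / (4 * p₁) + 1 / (4 * p₂)) ≤
      wMeasure w₁ (Metric.closedBall c r) ^ (1 / (4 * p₁)) *
        wMeasure w₂ (Metric.closedBall c r) ^ (1 / (4 * p₂))) :
    ∃ C : ℝ≥0∞, C ≠ ∞ ∧ ∀ f₁ f₂ : ℝ → ℝ, Measurable f₁ → Measurable f₂ →
      wLorentz p μ (fun x => hilbertR f₁ x * hilbertR f₂ x) ≤
        C * (lorentz p₁ 1 (wMeasure w₁) f₁ * lorentz p₂ 1 (wMeasure w₂) f₂) := by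
  obtain ⟨C, hC, hloc⟩ := exists_local_weak_bound hp₁ hp₂ hp hw₁ hw₂ hR₁ hR₂ hμ hμ₁₂
  obtain ⟨C₁, hC₁, hI₁⟩ := exists_lintegral_div_le hp₁ hw₁ hR₁
  obtain ⟨C₂, hC₂, hI₂⟩ := exists_lintegral_div_le hp₂ hw₂ hR₂
  have hp0 : 0 < 1 / p := by rw [hp]; positivity
  refine ⟨C + 1, by simp [hC], fun f₁ f₂ hf₁ hf₂ => ?_⟩
  set N₁ := lorentz p₁ 1 (wMeasure w₁) f₁ with hN₁
  set N₂ := lorentz p₂ 1 (wMeasure w₂) f₂ with hN₂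
  refine iSup₂_le fun t ht => ?_
  have hzero : ∀ {f : ℝ → ℝ}, Measurable f → ∫⁻ t, ‖f t / (1 + |t|)‖ₑ ≤ 0 →
      ∀ x, hilbertR f x = 0 := by
    intro f hf h
    refine hilbertR_eq_zero ?_
    have h0 := (lintegral_eq_zero_iff (by fun_prop)).1 (le_antisymm h zero_le)
    filter_upwards [h0] with x hx
    simp only [Pi.zero_apply, enorm_eq_zero] at hx
    have : (0 : ℝ) < 1 + |x| := by positivity
    exact (_root_.div_eq_zero_iff.1 hx).resolve_right this.ne'
  have htriv : (∀ x, hilbertR f₁ x * hilbertR f₂ x = 0) →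
      ENNReal.ofReal t * μ {x | t < ‖hilbertR f₁ x * hilbertR f₂ x‖} ^ (1 / p) ≤
        (C + 1) * (N₁ * N₂) := by
    intro h
    have : {x | t < ‖hilbertR f₁ x * hilbertR f₂ x‖} = ∅ := by
      refine eq_empty_of_forall_notMem fun x hx => ?_
      have hx' : t < ‖hilbertR f₁ x * hilbertR f₂ x‖ := hx
      rw [h x, norm_zero] at hx'
      exact lt_asymm ht hx'
    rw [this, measure_empty, ENNReal.zero_rpow_of_pos hp0, mul_zero]
    exact zero_le
  rcases eq_or_ne N₁ 0 with h1 | h1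
  · refine htriv fun x => ?_
    rw [hzero hf₁ (by simpa [← hN₁, h1] using hI₁ f₁ hf₁) x, zero_mul]
  rcases eq_or_ne N₂ 0 with h2 | h2
  · refine htriv fun x => ?_
    rw [hzero hf₂ (by simpa [← hN₂, h2] using hI₂ f₂ hf₂) x, mul_zero]
  rcases eq_or_ne N₁ ∞ with h1t | h1t
  · rw [h1t, ENNReal.top_mul h2, ENNReal.mul_top (by simp)]; exact le_top
  rcases eq_or_ne N₂ ∞ with h2t | h2t
  · rw [h2t, ENNReal.mul_top h1, ENNReal.mul_top (by simp)]; exact le_top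
  have hfinint : ∀ {f : ℝ → ℝ}, Measurable f → ∫⁻ t, ‖f t / (1 + |t|)‖ₑ < ∞ →
      Integrable fun t => f t / (1 + |t|) := fun hf h =>
    ⟨Measurable.aestronglyMeasurable (by fun_prop), h⟩
  have hi₁ := hfinint hf₁ ((hI₁ f₁ hf₁).trans_lt (ENNReal.mul_lt_top hC₁.lt_top h1t.lt_top))
  have hi₂ := hfinint hf₂ ((hI₂ f₂ hf₂).trans_lt (ENNReal.mul_lt_top hC₂.lt_top h2t.lt_top))
  set P : ℕ → Set ℝ := fun n => base (-(n : ℝ), 2 * (n : ℝ)) ∩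
    {x | t < ‖hilbertR (cutoff n f₁) x * hilbertR (cutoff n f₂) x‖} with hP
  have hbound : ∀ n : ℕ, n ≠ 0 → ENNReal.ofReal t * μ (P n) ^ (1 / p) ≤ (C + 1) * (N₁ * N₂) := by
    intro n hn
    have hn0 : (0 : ℝ) < n := by positivity
    have hind : ∀ f : ℝ → ℝ, (triple (-(n : ℝ), 2 * (n : ℝ))).indicator (cutoff n f) =
        cutoff n f := by
      intro f
      rw [indicator_eq_self, cutoff]
      refine support_indicator_subset.trans fun x hx => ?_
      exact ⟨by simp only; linarith [hx.1], by simp only; linarith [hx.2]⟩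
    have h := hloc (cutoff n f₁) (cutoff n f₂) (hf₁.indicator measurableSet_Ico)
      (hf₂.indicator measurableSet_Ico) (integrable_cutoff hf₁ hi₁ n)
      (integrable_cutoff hf₂ hi₂ n) (-(n : ℝ), 2 * (n : ℝ)) (by simpa using hn0) (hind f₁)
      (hind f₂) t ht
    refine h.trans (mul_le_mul' le_self_add (mul_le_mul' ?_ ?_))
    · exact lorentz_cutoff_le (by linarith) _ _ _
    · exact lorentz_cutoff_le (by linarith) _ _ _
  have hsub : μ {x | t < ‖hilbertR f₁ x * hilbertR f₂ x‖} ≤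
      μ (⋃ N : ℕ, ⋂ n ≥ N, P (n + 1)) := by
    refine measure_mono_ae (hμ.ac.ae_le ?_)
    filter_upwards [tendsto_hilbertR_cutoff hf₁ hi₁, tendsto_hilbertR_cutoff hf₂ hi₂]
      with x h1 h2 hx
    have hev : ∀ᶠ n : ℕ in atTop, x ∈ P n := by
      have hlim := (h1.mul h2).norm.eventually (lt_mem_nhds (show t < _ from hx))
      obtain ⟨M, hM⟩ := exists_nat_gt |x|
      filter_upwards [hlim, eventually_ge_atTop M] with n hn hMn
      refine ⟨?_, hn⟩
      have : (M : ℝ) ≤ n := by exact_mod_cast hMn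
      obtain ⟨h3, h4⟩ := abs_lt.1 (hM.trans_le this)
      exact ⟨h3.le, by simp only; linarith⟩
    obtain ⟨M, hM⟩ := eventually_atTop.1 hev
    exact mem_iUnion.2 ⟨M, mem_iInter₂.2 fun n hn => hM _ (by omega)⟩
  have hmono : Monotone fun N : ℕ => ⋂ n ≥ N, P (n + 1) := by
    intro N N' hNN
    exact biInter_subset_biInter_left fun n hn => le_trans hNN hn
  refine (mul_le_mul_right (ENNReal.rpow_le_rpow hsub hp0.le) _).trans ?_
  rw [hmono.measure_iUnion]
  have ht0 : ENNReal.ofReal t ≠ 0 := by simpa using ht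
  rw [mul_comm, ← ENNReal.le_div_iff_mul_le (Or.inl ht0) (Or.inl ENNReal.ofReal_ne_top),
    one_div, ENNReal.rpow_inv_le_iff (by simpa using hp0)]
  refine iSup_le fun N => ?_
  rw [← ENNReal.rpow_inv_le_iff (by simpa using hp0), ← one_div,
    ENNReal.le_div_iff_mul_le (Or.inl ht0) (Or.inl ENNReal.ofReal_ne_top), mul_comm]
  refine le_trans (mul_le_mul_right (ENNReal.rpow_le_rpow (measure_mono ?_) hp0.le) _)
    (hbound (N + 1) (by omega))
  exact biInter_subset_of_mem (show N ≥ N from le_rfl)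

theorem closedBall_rpow_le {p p₁ p₂ : ℝ} (hp₁ : 1 ≤ p₁) (hp₂ : 1 ≤ p₂)
    (hp : 1 / p = 1 / p₁ + 1 / p₂) {w₁ w₂ : ℝ → ℝ} (hw₁ : IsWeight w₁) (hw₂ : IsWeight w₂)
    {A : Set ℝ} (hA : MeasurableSet A) (h0 : 0 ≤ p / p₁) (h1 : p / p₁ ≤ 1)
    (h12 : p / p₂ = 1 - p / p₁) (hp0 : 0 < p) :
    wMeasure (fun x => w₁ x ^ (p / p₁) * w₂ x ^ (p / p₂)) A ^ (1 / (4 * p₁) + 1 / (4 * p₂)) ≤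
      wMeasure w₁ A ^ (1 / (4 * p₁)) * wMeasure w₂ A ^ (1 / (4 * p₂)) := by
  have hs : 1 / (4 * p₁) + 1 / (4 * p₂) = 1 / 4 * (1 / p) := by rw [hp]; field_simp
  have hz : 0 ≤ 1 / (4 * p₁) + 1 / (4 * p₂) := by positivity
  have e1 : p / p₁ * (1 / 4 * (1 / p)) = 1 / (4 * p₁) := by field_simp
  have e2 : p / p₂ * (1 / 4 * (1 / p)) = 1 / (4 * p₂) := by field_simp
  have h := ENNReal.rpow_le_rpow (wMeasure_mul_rpow_le h0 h1 hw₁ hw₂ hA) hz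
  rwa [ENNReal.mul_rpow_of_nonneg _ _ hz, ← ENNReal.rpow_mul, ← ENNReal.rpow_mul, ← h12, hs, e1,
    e2, ← hs] at h

end HilbertProduct

/-- Restricted weak-type bounds for the product of Hilbert transforms: if
`1/p = 1/p₁ + 1/p₂`, `p_j ≥ 1` and `w_j ∈ A_{p_j}^𝓡`, then
`H₂(f₁,f₂) = (Hf₁)(Hf₂)` maps `L^{p₁,1}(w₁) × L^{p₂,1}(w₂)` into
`L^{p,∞}(w₁^{p/p₁} w₂^{p/p₂})`. -/
theorem stmt14 (p1 p2 p : ℝ) (hp1 : 1 ≤ p1) (hp2 : 1 ≤ p2)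
    (hp : 1 / p = 1 / p1 + 1 / p2)
    (w1 w2 : ℝ → ℝ) (hw1 : IsWeight w1) (hw2 : IsWeight w2)
    (hR1 : AqRConstR p1 w1 < ⊤) (hR2 : AqRConstR p2 w2 < ⊤) :
    ∃ C : ℝ≥0∞, C < ⊤ ∧ ∀ f1 f2 : ℝ → ℝ, Measurable f1 → Measurable f2 →
      wLorentz p (wMeasure fun x => w1 x ^ (p / p1) * w2 x ^ (p / p2))
          (fun x => hilbertR f1 x * hilbertR f2 x) ≤
        C * lorentz p1 1 (wMeasure w1) f1 * lorentz p2 1 (wMeasure w2) f2 := by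
  have hp0 : 0 < p := one_div_pos.1 (by rw [hp]; positivity)
  have h0 : 0 ≤ p / p1 := by positivity
  have h2 : 0 ≤ p / p2 := by positivity
  have h12 : p / p2 = 1 - p / p1 := by
    have : p * (1 / p) = p * (1 / p1) + p * (1 / p2) := by rw [hp]; ring
    rw [mul_one_div_cancel hp0.ne', mul_one_div, mul_one_div] at this
    linarith
  have h1 : p / p1 ≤ 1 := by linarith
  have hA := HilbertProduct.isAInfty_mul_rpow h0 h1 hw1 hw2
    (HilbertProduct.isAInfty_of_restricted hp1 hw1 hR1)
    (HilbertProduct.isAInfty_of_restricted hp2 hw2 hR2)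
  rw [← h12] at hA
  obtain ⟨C, hC, h⟩ := HilbertProduct.exists_weak_bound hp1 hp2 hp hw1 hw2 hR1 hR2 hA
    fun c r _ => HilbertProduct.closedBall_rpow_le hp1 hp2 hp hw1 hw2
      measurableSet_closedBall h0 h1 h12 hp0
  refine ⟨C, hC.lt_top, fun f1 f2 hf1 hf2 => ?_⟩
  rw [mul_assoc]
  exact h f1 f2 hf1 hf2
end
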